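/- For all σ, σ', λ, λ' > 0, the mismatched free energy converges as n → ∞ and the limit equals: −1/(4λ'σ'⁴) + 1/(√λ' σ'²) − 3/4 + ln(λ'^{1/4} σ') if λ ≤ 1/σ⁴ and λ' ≥ 1/σ'⁴; ½ ln(√(λλ') σ²σ'²) − 1/(4λ'σ'⁴) − λσ⁴/4 + √(λ/λ')·σ²/(2σ'²) + 1/(2√(λλ') σ²σ'²) − ½ if λ ≥ 1/σ⁴ and √(λλ') ≥ 1/(σ²σ'²); and 0 otherwise. -/

import Mathlib

open MeasureTheory ProbabilityTheory Filter Matrix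

noncomputable section

instance {n : ℕ} : MeasurableSpace (Matrix (Fin n) (Fin n) ℝ) :=
  inferInstanceAs (MeasurableSpace (Fin n → Fin n → ℝ))

/-- Squared Frobenius norm of a matrix. -/
def frobSq {n : ℕ} (M : Matrix (Fin n) (Fin n) ℝ) : ℝ := ∑ i, ∑ j, (M i j) ^ 2

/-- i.i.d. centered Gaussian prior with variance `v` on `ℝⁿ`. -/
def gaussPrior (n : ℕ) (v : ℝ) : Measure (Fin n → ℝ) :=
  Measure.pi fun _ => gaussianReal 0 (Real.toNNReal v)

/-- Law of the symmetric noise matrix `Z`: independent `N(0,1)` entries above the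
diagonal and `N(0,2)` entries on the diagonal, extended symmetrically. -/
def noiseMeasure (n : ℕ) : Measure (Matrix (Fin n) (Fin n) ℝ) :=
  (Measure.pi fun p : Fin n × Fin n =>
      gaussianReal 0 (if p.1 = p.2 then 2 else 1)).map
    (fun g => Matrix.of fun i j => if i ≤ j then g (i, j) else g (j, i))

/-- Observation matrix `Y = √(λ/n) s sᵀ + Z`. -/
def obs (n : ℕ) (lam : ℝ) (s : Fin n → ℝ) (Z : Matrix (Fin n) (Fin n) ℝ) :
    Matrix (Fin n) (Fin n) ℝ :=
  Real.sqrt (lam / n) • Matrix.vecMulVec s s + Z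

/-- Partition function `Z(Y)`. -/
def partitionFn (n : ℕ) (sig' lam' : ℝ) (Y : Matrix (Fin n) (Fin n) ℝ) : ℝ :=
  ∫ x, Real.exp (-(lam' / (4 * n)) * (∑ i, (x i) ^ 2) ^ 2 +
      (1 / 2) * Real.sqrt (lam' / n) * Matrix.trace (Y * Matrix.vecMulVec x x))
    ∂gaussPrior n (sig' ^ 2)

/-- Mismatched free energy `f_n = −(1/n) E[ln Z(Y)]`. -/
def freeEnergy (n : ℕ) (sig sig' lam lam' : ℝ) : ℝ :=
  -(1 / (n : ℝ)) *
    ∫ p, Real.log (partitionFn n sig' lam' (obs n lam p.1 p.2))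
      ∂((gaussPrior n (sig ^ 2)).prod (noiseMeasure n))

/-- The limiting mismatched free energy formula, eq. (16) of the paper. -/
def fLim (sig sig' lam lam' : ℝ) : ℝ :=
  if lam ≤ 1 / sig ^ 4 ∧ 1 / sig' ^ 4 ≤ lam' then
    -1 / (4 * lam' * sig' ^ 4) + 1 / (Real.sqrt lam' * sig' ^ 2) - 3 / 4 +
      Real.log (lam' ^ ((1 : ℝ) / 4) * sig')
  else if 1 / sig ^ 4 ≤ lam ∧ 1 / (sig ^ 2 * sig' ^ 2) ≤ Real.sqrt (lam * lam') then
    (1 / 2) * Real.log (Real.sqrt (lam * lam') * sig ^ 2 * sig' ^ 2) -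
      1 / (4 * lam' * sig' ^ 4) - lam * sig ^ 4 / 4 +
      Real.sqrt (lam / lam') * sig ^ 2 / (2 * sig' ^ 2) +
      1 / (2 * Real.sqrt (lam * lam') * sig ^ 2 * sig' ^ 2) - 1 / 2
  else 0

section

open MeasureTheory ProbabilityTheory Filter Matrix
open scoped NNReal ENNReal
noncomputable section

theorem stein1 (v : ℝ≥0) (hv : v ≠ 0) (f f' : ℝ → ℝ) (hd : ∀ x, HasDerivAt f (f' x) x)
    (hf : Integrable f (gaussianReal 0 v)) (hf' : Integrable f' (gaussianReal 0 v))
    (hxf : Integrable (fun x => x * f x) (gaussianReal 0 v)) :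
    ∫ x, x * f x ∂gaussianReal 0 v = v * ∫ x, f' x ∂gaussianReal 0 v := by
  have hv' : (v : ℝ) ≠ 0 := by exact_mod_cast hv
  have key : ∀ h : ℝ → ℝ, Integrable h (gaussianReal 0 v) ↔
      Integrable (fun x => gaussianPDFReal 0 v x * h x) := by
    intro h
    rw [gaussianReal_of_var_ne_zero _ hv, integrable_withDensity_iff_integrable_smul' (measurable_gaussianPDF 0 v)
      (ae_of_all _ fun x => gaussianPDF_lt_top)]
    simp [toReal_gaussianPDF]
  have hpd : ∀ x, HasDerivAt (gaussianPDFReal 0 v) (-(x / v) * gaussianPDFReal 0 v x) x := by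
    intro x
    rw [gaussianPDFReal_def]
    have h1 : HasDerivAt (fun x : ℝ => -(x - 0) ^ 2 / (2 * (v:ℝ))) (-(x / v)) x := by
      have := (((hasDerivAt_id x).sub_const 0).pow 2).neg.div_const (2 * (v:ℝ))
      refine this.congr_deriv ?_
      simp
      field_simp
    have := (h1.exp).const_mul ((√(2 * Real.pi * v))⁻¹)
    refine this.congr_deriv ?_
    ring
  rw [key] at hf hf' hxf
  have e1 : Integrable (f * fun x => -(x / v) * gaussianPDFReal 0 v x) := by
    refine (hxf.const_mul (-(1/(v:ℝ)))).congr (ae_of_all _ fun x => ?_)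
    simp; field_simp
  have := integral_mul_deriv_eq_deriv_mul_of_integrable (u := f) (u' := f') (fun x _ => hd x) (fun x _ => hpd x)
    e1
    (hf'.congr (ae_of_all _ fun x => by simp; ring)) (hf.congr (ae_of_all _ fun x => by simp; ring))
  rw [integral_gaussianReal_eq_integral_smul hv, integral_gaussianReal_eq_integral_smul hv]
  have h2 : ∫ x, gaussianPDFReal 0 v x • (x * f x) = -(v:ℝ) * ∫ x, f x * (-(x / v) * gaussianPDFReal 0 v x) := by
    rw [← integral_const_mul]
    congr 1; ext x; simp; field_simp
  rw [h2, this, neg_mul_neg]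
  congr 2; ext x; simp; ring

variable {K : Type*} [Fintype K] [DecidableEq K]

/-- Product Gaussian measure. -/
def gpi (v : K → ℝ≥0) : Measure (K → ℝ) := Measure.pi fun k => gaussianReal 0 (v k)

instance (v : K → ℝ≥0) : IsProbabilityMeasure (gpi v) := by unfold gpi; infer_instance

theorem mp_update (v : K → ℝ≥0) (k : K) :
    MeasurePreserving (fun p : (K → ℝ) × ℝ => Function.update p.1 k p.2)
      ((gpi v).prod (gaussianReal 0 (v k))) (gpi v) := by
  have hm : Measurable (fun p : (K → ℝ) × ℝ => Function.update p.1 k p.2) := by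
    rw [measurable_pi_iff]; intro j
    by_cases h : j = k
    · subst h; simpa using measurable_snd
    · simp only [Function.update_of_ne h]; fun_prop
  refine ⟨hm, ?_⟩
  symm
  apply Measure.pi_eq
  intro s hs
  rw [Measure.map_apply hm (MeasurableSet.univ_pi hs)]
  have : (fun p : (K → ℝ) × ℝ => Function.update p.1 k p.2) ⁻¹' (Set.univ.pi s) =
      (Set.univ.pi (Function.update s k Set.univ)) ×ˢ (s k) := by
    ext p
    simp only [Set.mem_preimage, Set.mem_pi, Set.mem_univ, forall_true_left, Set.mem_prod]
    constructor
    · intro h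
      refine ⟨fun j => ?_, by simpa using h k⟩
      by_cases hj : j = k
      · subst hj; simp
      · simpa [Function.update_of_ne hj] using h j
    · rintro ⟨h1, h2⟩ j
      by_cases hj : j = k
      · subst hj; simpa
      · simpa [Function.update_of_ne hj] using h1 j
  rw [this, Measure.prod_prod, gpi, Measure.pi_pi]
  rw [← Finset.mul_prod_erase _ _ (Finset.mem_univ k), ← Finset.mul_prod_erase Finset.univ (fun i => gaussianReal 0 (v i) (s i)) (Finset.mem_univ k)]
  simp only [Function.update_self, measure_univ, one_mul]
  rw [mul_comm]
  congr 1
  apply Finset.prod_congr rfl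
  intro j hj
  rw [Function.update_of_ne (Finset.ne_of_mem_erase hj)]

theorem stein_pi (v : K → ℝ≥0) (k : K) (hv : v k ≠ 0) (F F' : (K → ℝ) → ℝ)
    (hd : ∀ g s, HasDerivAt (fun s => F (Function.update g k s)) (F' (Function.update g k s)) s)
    (hf : Integrable F (gpi v)) (hf' : Integrable F' (gpi v))
    (hxf : Integrable (fun g => g k * F g) (gpi v)) :
    ∫ g, g k * F g ∂gpi v = v k * ∫ g, F' g ∂gpi v := by
  have mp := mp_update v k
  have cv : ∀ h : (K → ℝ) → ℝ, Integrable h (gpi v) → ∫ g, h g ∂gpi v =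
      ∫ g, ∫ s, h (Function.update g k s) ∂gaussianReal 0 (v k) ∂gpi v := by
    intro h hh
    have h3 : Integrable (fun p : (K → ℝ) × ℝ => h (Function.update p.1 k p.2)) ((gpi v).prod (gaussianReal 0 (v k))) :=
      mp.integrable_comp_of_integrable hh
    rw [← integral_prod _ h3]
    have := integral_map (f := h) mp.measurable.aemeasurable (μ := (gpi v).prod (gaussianReal 0 (v k))) (by rw [mp.map_eq]; exact hh.1)
    rw [← this, mp.map_eq]
  have ci : ∀ h : (K → ℝ) → ℝ, Integrable h (gpi v) →
      ∀ᵐ g ∂gpi v, Integrable (fun s => h (Function.update g k s)) (gaussianReal 0 (v k)) := by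
    intro h hh
    have h3 : Integrable (fun p : (K → ℝ) × ℝ => h (Function.update p.1 k p.2)) ((gpi v).prod (gaussianReal 0 (v k))) :=
      mp.integrable_comp_of_integrable hh
    exact h3.prod_right_ae
  rw [cv _ hxf, cv _ hf', ← integral_const_mul]
  apply integral_congr_ae
  filter_upwards [ci _ hf, ci _ hf', ci _ hxf] with g h1 h2 h3
  simp only [Function.update_self] at h3 ⊢
  exact stein1 (v k) hv _ _ (hd g) h1 h2 h3

end

end

section

open MeasureTheory ProbabilityTheory Filter Matrix
open scoped NNReal ENNReal
noncomputable section
set_option linter.unusedSectionVars false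

section gibbs
variable {X : Type*} [MeasurableSpace X]

/-- Gibbs average of `f` with log-weight `L`. -/
def Gav (ν : Measure X) (L f : X → ℝ) : ℝ := (∫ x, f x * Real.exp (L x) ∂ν) / (∫ x, Real.exp (L x) ∂ν)

theorem integrable_bdd (ν : Measure X) [IsFiniteMeasure ν] {f : X → ℝ} (hf : Measurable f) {B : ℝ} (hB : ∀ x, |f x| ≤ B) : Integrable f ν :=
  Integrable.of_bound hf.aestronglyMeasurable B (ae_of_all _ hB)

theorem exp_bdd {a B : ℝ} (h : |a| ≤ B) : |Real.exp a| ≤ Real.exp B := by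
  rw [abs_of_pos (Real.exp_pos _)]; exact Real.exp_le_exp.2 ((abs_le.1 h).2)

theorem integrable_mul_exp (ν : Measure X) [IsFiniteMeasure ν] {f L : X → ℝ} (hf : Measurable f) (hL : Measurable L)
    {B BL : ℝ} (hB : ∀ x, |f x| ≤ B) (hBL : ∀ x, |L x| ≤ BL) : Integrable (fun x => f x * Real.exp (L x)) ν := by
  apply integrable_bdd ν (by fun_prop) (B := B * Real.exp BL)
  intro x
  rw [abs_mul]
  exact mul_le_mul (hB x) (exp_bdd (hBL x)) (abs_nonneg _) ((abs_nonneg _).trans (hB x))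

theorem integrable_exp_bdd (ν : Measure X) [IsFiniteMeasure ν] {L : X → ℝ} (hL : Measurable L)
    {BL : ℝ} (hBL : ∀ x, |L x| ≤ BL) : Integrable (fun x => Real.exp (L x)) ν :=
  integrable_bdd ν (by fun_prop) (fun x => exp_bdd (hBL x))

theorem Zpos (ν : Measure X) [IsFiniteMeasure ν] [NeZero ν] {L : X → ℝ} (hL : Measurable L)
    {BL : ℝ} (hBL : ∀ x, |L x| ≤ BL) : 0 < ∫ x, Real.exp (L x) ∂ν :=
  integral_exp_pos (integrable_exp_bdd ν hL hBL)

theorem Gav_abs_le (ν : Measure X) [IsFiniteMeasure ν] [NeZero ν] {f L : X → ℝ} (hf : Measurable f) (hL : Measurable L)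
    {B BL : ℝ} (hB : ∀ x, |f x| ≤ B) (hBL : ∀ x, |L x| ≤ BL) : |Gav ν L f| ≤ B := by
  have hp := Zpos ν hL hBL
  unfold Gav
  rw [abs_div, abs_of_pos hp, div_le_iff₀ hp, ← integral_const_mul]
  refine (abs_integral_le_integral_abs).trans (integral_mono ((integrable_mul_exp ν hf hL hB hBL).abs) ((integrable_exp_bdd ν hL hBL).const_mul _) fun x => ?_)
  simp only [abs_mul, abs_of_pos (Real.exp_pos _)]
  exact mul_le_mul_of_nonneg_right (hB x) (Real.exp_pos _).le

theorem logZ_abs_le (ν : Measure X) [IsFiniteMeasure ν] [NeZero ν] {L : X → ℝ} (hL : Measurable L)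
    {BL : ℝ} (hBL : ∀ x, |L x| ≤ BL) : |Real.log (∫ x, Real.exp (L x) ∂ν)| ≤ BL + |Real.log (ν.real Set.univ)| := by
  have hp := Zpos ν hL hBL
  have hν : 0 < ν.real Set.univ := by
    rw [measureReal_def]; exact ENNReal.toReal_pos (NeZero.ne _) (measure_ne_top _ _)
  have h1 : ∫ x, Real.exp (L x) ∂ν ≤ ∫ x, Real.exp BL ∂ν :=
    integral_mono (integrable_exp_bdd ν hL hBL) (integrable_const _) fun x => Real.exp_le_exp.2 (abs_le.1 (hBL x)).2
  have h2 : ∫ x, Real.exp (-BL) ∂ν ≤ ∫ x, Real.exp (L x) ∂ν :=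
    integral_mono (integrable_const _) (integrable_exp_bdd ν hL hBL) fun x => Real.exp_le_exp.2 (abs_le.1 (hBL x)).1
  rw [integral_const, smul_eq_mul] at h1 h2
  have h3 := Real.log_le_log hp h1
  have h4 := Real.log_le_log (by positivity) h2
  rw [Real.log_mul hν.ne' (Real.exp_pos _).ne', Real.log_exp] at h3 h4
  have := neg_abs_le (Real.log (ν.real Set.univ))
  have := le_abs_self (Real.log (ν.real Set.univ))
  rw [abs_le]; constructor <;> linarith

theorem hasDerivAt_expint (ν : Measure X) [IsFiniteMeasure ν] (f : X → ℝ) (L L' : ℝ → X → ℝ) (t0 Bf BL BL' : ℝ)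
    (hf : Measurable f) (hL : ∀ t, Measurable (L t)) (hL' : ∀ t, Measurable (L' t)) (hBf : ∀ x, |f x| ≤ Bf)
    (hBL : ∀ t ∈ Metric.ball t0 1, ∀ x, |L t x| ≤ BL) (hBL' : ∀ t ∈ Metric.ball t0 1, ∀ x, |L' t x| ≤ BL')
    (hd : ∀ t x, HasDerivAt (fun t => L t x) (L' t x) t) :
    HasDerivAt (fun t => ∫ x, f x * Real.exp (L t x) ∂ν) (∫ x, f x * L' t0 x * Real.exp (L t0 x) ∂ν) t0 := by
  have hm : t0 ∈ Metric.ball t0 1 := Metric.mem_ball_self one_pos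
  refine (hasDerivAt_integral_of_dominated_loc_of_deriv_le (F := fun t x => f x * Real.exp (L t x))
    (F' := fun t x => f x * L' t x * Real.exp (L t x)) (bound := fun _ => Bf * BL' * Real.exp BL) (Metric.ball_mem_nhds t0 one_pos) ?_ ?_ ?_ ?_ ?_ ?_).2
  · refine Eventually.of_forall fun t => Measurable.aestronglyMeasurable ?_
    have := hL t; fun_prop
  · exact integrable_mul_exp ν hf (hL t0) hBf (hBL t0 hm)
  · have := hL t0; have := hL' t0
    exact Measurable.aestronglyMeasurable (by fun_prop)
  · refine ae_of_all _ fun x t ht => ?_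
    rw [Real.norm_eq_abs, abs_mul, abs_mul]
    have h0 := hBf x
    have h1 := hBL' t ht x
    have h2 := exp_bdd (hBL t ht x)
    gcongr
    · exact mul_nonneg ((abs_nonneg _).trans h0) ((abs_nonneg _).trans h1)
    · exact (abs_nonneg _).trans h0
  · exact integrable_const _
  · refine ae_of_all _ fun x t ht => ?_
    refine (((hd t x).exp).const_mul (f x)).congr_deriv ?_
    ring

theorem hasDerivAt_logZ (ν : Measure X) [IsFiniteMeasure ν] [NeZero ν] (L L' : ℝ → X → ℝ) (t0 BL BL' : ℝ)
    (hL : ∀ t, Measurable (L t)) (hL' : ∀ t, Measurable (L' t))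
    (hBL : ∀ t ∈ Metric.ball t0 1, ∀ x, |L t x| ≤ BL) (hBL' : ∀ t ∈ Metric.ball t0 1, ∀ x, |L' t x| ≤ BL')
    (hd : ∀ t x, HasDerivAt (fun t => L t x) (L' t x) t) :
    HasDerivAt (fun t => Real.log (∫ x, Real.exp (L t x) ∂ν)) (Gav ν (L t0) (L' t0)) t0 := by
  have h := hasDerivAt_expint ν (fun _ => 1) L L' t0 1 BL BL' measurable_const hL hL' (by simp) hBL hBL' hd
  simp only [one_mul] at h
  exact h.log (Zpos ν (hL t0) (hBL t0 (Metric.mem_ball_self one_pos))).ne'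

theorem hasDerivAt_Gav (ν : Measure X) [IsFiniteMeasure ν] [NeZero ν] (f : X → ℝ) (L L' : ℝ → X → ℝ) (t0 Bf BL BL' : ℝ)
    (hf : Measurable f) (hL : ∀ t, Measurable (L t)) (hL' : ∀ t, Measurable (L' t)) (hBf : ∀ x, |f x| ≤ Bf)
    (hBL : ∀ t ∈ Metric.ball t0 1, ∀ x, |L t x| ≤ BL) (hBL' : ∀ t ∈ Metric.ball t0 1, ∀ x, |L' t x| ≤ BL')
    (hd : ∀ t x, HasDerivAt (fun t => L t x) (L' t x) t) :
    HasDerivAt (fun t => Gav ν (L t) f) (Gav ν (L t0) (fun x => f x * L' t0 x) - Gav ν (L t0) f * Gav ν (L t0) (L' t0)) t0 := by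
  have h1 := hasDerivAt_expint ν f L L' t0 Bf BL BL' hf hL hL' hBf hBL hBL' hd
  have h := hasDerivAt_expint ν (fun _ => 1) L L' t0 1 BL BL' measurable_const hL hL' (by simp) hBL hBL' hd
  simp only [one_mul] at h
  have hp := (Zpos ν (hL t0) (hBL t0 (Metric.mem_ball_self one_pos))).ne'
  refine (h1.div h hp).congr_deriv ?_
  unfold Gav
  field_simp

theorem Gav_const_mul (ν : Measure X) (L f : X → ℝ) (c : ℝ) : Gav ν L (fun x => c * f x) = c * Gav ν L f := by
  unfold Gav
  simp only [mul_assoc, integral_const_mul, mul_div_assoc]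

theorem Gav_sub (ν : Measure X) {L f h : X → ℝ} (hf : Integrable (fun x => f x * Real.exp (L x)) ν)
    (hh : Integrable (fun x => h x * Real.exp (L x)) ν) :
    Gav ν L (fun x => f x - h x) = Gav ν L f - Gav ν L h := by
  unfold Gav
  simp only [sub_mul]
  rw [integral_sub hf hh, sub_div]

theorem Gav_add (ν : Measure X) {L f h : X → ℝ} (hf : Integrable (fun x => f x * Real.exp (L x)) ν)
    (hh : Integrable (fun x => h x * Real.exp (L x)) ν) :
    Gav ν L (fun x => f x + h x) = Gav ν L f + Gav ν L h := by
  unfold Gav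
  simp only [add_mul]
  rw [integral_add hf hh, add_div]

theorem Gav_sum (ν : Measure X) {ι : Type*} (s : Finset ι) {L : X → ℝ} {f : ι → X → ℝ} (hf : ∀ i ∈ s, Integrable (fun x => f i x * Real.exp (L x)) ν) :
    Gav ν L (fun x => ∑ i ∈ s, f i x) = ∑ i ∈ s, Gav ν L (f i) := by
  unfold Gav
  simp only [Finset.sum_mul]
  rw [integral_finsetSum _ hf, Finset.sum_div]

theorem measurable_Gav {Ω : Type*} [MeasurableSpace Ω] (ν : Measure X) [IsFiniteMeasure ν] {L f : Ω → X → ℝ}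
    (hL : Measurable (Function.uncurry L)) (hf : Measurable (Function.uncurry f)) :
    Measurable (fun ω => Gav ν (L ω) (f ω)) := by
  unfold Gav
  apply Measurable.div
  · have : StronglyMeasurable (Function.uncurry fun ω x => f ω x * Real.exp (L ω x)) :=
      (hf.mul hL.exp).stronglyMeasurable
    exact this.integral_prod_right.measurable
  · have : StronglyMeasurable (Function.uncurry fun ω x => Real.exp (L ω x)) :=
      (hL.exp).stronglyMeasurable
    exact this.integral_prod_right.measurable

theorem measurable_Z {Ω : Type*} [MeasurableSpace Ω] (ν : Measure X) [SFinite ν] {L : Ω → X → ℝ}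
    (hL : Measurable (Function.uncurry L)) :
    Measurable (fun ω => ∫ x, Real.exp (L ω x) ∂ν) := by
  have : StronglyMeasurable (Function.uncurry fun ω x => Real.exp (L ω x)) :=
      (hL.exp).stronglyMeasurable
  exact this.integral_prod_right.measurable

end gibbs

section interp
variable {K : Type*} [Fintype K] [DecidableEq K] {X : Type*} [MeasurableSpace X]

theorem gpi_integrable_pow (v : K → ℝ≥0) (k : K) (m : ℕ) : Integrable (fun g => (g k) ^ m) (gpi v) := by
  have h : Integrable (fun x : ℝ => x ^ m) (gaussianReal 0 (v k)) := by
    have := (memLp_id_gaussianReal (μ := 0) (v := v k) (m : ℝ≥0))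
    rcases Nat.eq_zero_or_pos m with rfl | hm
    · simp
    · have := this.integrable_norm_pow (by positivity)
      rw [← integrable_norm_iff (by fun_prop)]
      simpa using this
  exact integrable_comp_eval (μ := fun k => gaussianReal 0 (v k)) (i := k) h

theorem gpi_integrable_id (v : K → ℝ≥0) (k : K) : Integrable (fun g => g k) (gpi v) := by
  simpa using gpi_integrable_pow v k 1

/-- The centred Gaussian interpolating Hamiltonian. -/
def Lf (v : K → ℝ≥0) (a : K → X → ℝ) (p g : K → ℝ) (x : X) : ℝ :=
  ∑ k, (p k * g k * a k x - p k ^ 2 * v k * (a k x) ^ 2 / 2)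

/-- Bound for the Hamiltonian. -/
def Mf (v : K → ℝ≥0) (B : ℝ) (g : K → ℝ) : ℝ := ∑ k, (|g k| * B + v k * B ^ 2)

theorem Lf_measurable (v : K → ℝ≥0) {a : K → X → ℝ} (ha : ∀ k, Measurable (a k)) (p : K → ℝ) :
    Measurable (Function.uncurry (Lf v a p)) := by
  unfold Lf Function.uncurry
  fun_prop

theorem Lf_measurable' (v : K → ℝ≥0) {a : K → X → ℝ} (ha : ∀ k, Measurable (a k)) (p g : K → ℝ) :
    Measurable (Lf v a p g) := by
  unfold Lf
  fun_prop

theorem Lf_bdd (v : K → ℝ≥0) {a : K → X → ℝ} {B : ℝ} (hB : ∀ k x, |a k x| ≤ B) {p : K → ℝ}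
    (hp : ∀ k, |p k| ≤ 1) (g : K → ℝ) (x : X) : |Lf v a p g x| ≤ Mf v B g := by
  unfold Lf Mf
  refine (Finset.abs_sum_le_sum_abs _ _).trans (Finset.sum_le_sum fun k _ => ?_)
  have h1 : |p k * g k * a k x| ≤ |g k| * B := by
    rw [abs_mul, abs_mul]
    have := hB k x; have := hp k; have := abs_nonneg (g k); have := abs_nonneg (a k x)
    calc |p k| * |g k| * |a k x| ≤ 1 * |g k| * B := by gcongr
      _ = _ := by ring
  have h2 : |p k ^ 2 * v k * (a k x) ^ 2 / 2| ≤ v k * B ^ 2 := by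
    rw [abs_of_nonneg (by positivity)]
    have e1 : p k ^ 2 ≤ 1 := by rw [sq_le_one_iff_abs_le_one]; exact hp k
    have e2 : a k x ^ 2 ≤ B ^ 2 := sq_le_sq' (by linarith [(abs_le.1 (hB k x)).1]) (abs_le.1 (hB k x)).2
    calc p k ^ 2 * v k * (a k x) ^ 2 / 2 ≤ 1 * v k * B ^ 2 / 2 := by gcongr
      _ ≤ _ := by nlinarith [(by positivity : 0 ≤ v k * B ^ 2)]
  calc _ ≤ |p k * g k * a k x| + |p k ^ 2 * v k * (a k x) ^ 2 / 2| := abs_sub _ _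
    _ ≤ _ := by linarith

theorem Mf_integrable (v : K → ℝ≥0) (B : ℝ) : Integrable (Mf v B) (gpi v) := by
  unfold Mf
  refine integrable_finsetSum _ fun k _ => ?_
  exact ((gpi_integrable_id v k).abs.mul_const B).add (integrable_const _)

theorem integrable_logZ (ν : Measure X) [IsFiniteMeasure ν] [NeZero ν] (v : K → ℝ≥0) {a : K → X → ℝ}
    (ha : ∀ k, Measurable (a k)) {B : ℝ} (hB : ∀ k x, |a k x| ≤ B) {p : K → ℝ} (hp : ∀ k, |p k| ≤ 1) :
    Integrable (fun g => Real.log (∫ x, Real.exp (Lf v a p g x) ∂ν)) (gpi v) := by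
  refine Integrable.mono' ((Mf_integrable v B).add (integrable_const |Real.log (ν.real Set.univ)|)) ?_ ?_
  · exact (measurable_Z ν (Lf_measurable v ha p)).log.aestronglyMeasurable
  · exact ae_of_all _ fun g => logZ_abs_le ν (Lf_measurable' v ha p g) (Lf_bdd v hB hp g)

theorem integrable_Gav (ν : Measure X) [IsFiniteMeasure ν] [NeZero ν] (v : K → ℝ≥0) {a : K → X → ℝ}
    (ha : ∀ k, Measurable (a k)) {B : ℝ} (hB : ∀ k x, |a k x| ≤ B) {p : K → ℝ} (hp : ∀ k, |p k| ≤ 1)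
    {f : X → ℝ} (hf : Measurable f) {Bf : ℝ} (hBf : ∀ x, |f x| ≤ Bf) :
    Integrable (fun g => Gav ν (Lf v a p g) f) (gpi v) := by
  refine Integrable.of_bound (measurable_Gav ν (Lf_measurable v ha p) (f := fun _ => f) (hf.comp measurable_snd)).aestronglyMeasurable Bf ?_
  exact ae_of_all _ fun g => Gav_abs_le ν hf (Lf_measurable' v ha p g) hBf (Lf_bdd v hB hp g)

theorem stein_Gav (ν : Measure X) [IsFiniteMeasure ν] [NeZero ν] (v : K → ℝ≥0) (hv : ∀ k, v k ≠ 0) {a : K → X → ℝ}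
    (ha : ∀ k, Measurable (a k)) {B : ℝ} (hB : ∀ k x, |a k x| ≤ B) {p : K → ℝ} (hp : ∀ k, |p k| ≤ 1) (k : K) :
    ∫ g, g k * Gav ν (Lf v a p g) (a k) ∂gpi v =
      v k * ∫ g, p k * (Gav ν (Lf v a p g) (fun x => a k x ^ 2) - Gav ν (Lf v a p g) (a k) ^ 2) ∂gpi v := by
  have hsq : ∀ x, |a k x ^ 2| ≤ B ^ 2 := fun x => by rw [abs_pow]; exact pow_le_pow_left₀ (abs_nonneg _) (hB k x) 2
  have i1 := integrable_Gav ν v ha hB hp (ha k) (hB k)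
  refine stein_pi v k (hv k) (fun g => Gav ν (Lf v a p g) (a k)) _ ?_ i1 ?_ ?_
  · intro g s0
    have := hasDerivAt_Gav ν (a k) (fun s => Lf v a p (Function.update g k s)) (fun s x => p k * a k x) s0 B
      (Mf v B (fun j => |g j| + |s0| + 1)) B (ha k) (fun t => Lf_measurable' v ha p _) (fun _ => by have := ha k; fun_prop) (hB k) ?_ ?_ ?_
    · refine this.congr_deriv ?_
      have e : (fun x => a k x * (p k * a k x)) = fun x => p k * (a k x ^ 2) := by ext; ring
      rw [e, Gav_const_mul, Gav_const_mul]; ring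
    · intro s hs x
      refine (Lf_bdd v hB hp _ x).trans ?_
      unfold Mf
      refine Finset.sum_le_sum fun j _ => ?_
      have hB0 : 0 ≤ B := (abs_nonneg _).trans (hB k x)
      have : |Function.update g k s j| ≤ abs (|g j| + |s0| + 1) := by
        rw [abs_of_nonneg (a := |g j| + |s0| + 1) (by positivity)]
        by_cases hj : j = k
        · subst hj
          simp only [Function.update_self]
          rw [Metric.mem_ball, Real.dist_eq] at hs
          have := abs_sub_abs_le_abs_sub s s0
          have := abs_nonneg (g j)
          linarith
        · rw [Function.update_of_ne hj]
          have := abs_nonneg s0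
          linarith
      gcongr
    · intro s _ x
      rw [abs_mul]
      calc |p k| * |a k x| ≤ 1 * B := mul_le_mul (hp k) (hB k x) (abs_nonneg _) (by norm_num)
        _ = B := one_mul _
    · intro s x
      unfold Lf
      have e : (fun t => ∑ j, (p j * Function.update g k t j * a j x - p j ^ 2 * (v j) * a j x ^ 2 / 2)) =
        fun t => (p k * t * a k x - p k ^ 2 * (v k) * a k x ^ 2 / 2) + ∑ j ∈ Finset.univ.erase k, (p j * g j * a j x - p j ^ 2 * (v j) * a j x ^ 2 / 2) := by
        ext t
        rw [← Finset.add_sum_erase _ _ (Finset.mem_univ k)]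
        simp only [Function.update_self]
        congr 1
        refine Finset.sum_congr rfl fun j hj => ?_
        rw [Function.update_of_ne (Finset.ne_of_mem_erase hj)]
      rw [e]
      refine ((((hasDerivAt_id s).const_mul (p k)).mul_const (a k x)).sub_const _ |>.add_const _).congr_deriv ?_
      simp
  · refine ((integrable_Gav ν v ha hB hp ((ha k).pow_const 2) hsq).sub ?_).const_mul _
    refine Integrable.of_bound (i1.1.pow 2) (B ^ 2) (ae_of_all _ fun g => ?_)
    simp only [Real.norm_eq_abs, Pi.pow_apply, abs_pow]
    exact pow_le_pow_left₀ (abs_nonneg _) (Gav_abs_le ν (ha k) (Lf_measurable' v ha p g) (hB k) (Lf_bdd v hB hp g)) 2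
  · refine Integrable.mul_bdd (c := B) (gpi_integrable_id v k) i1.1 (ae_of_all _ fun g => ?_)
    exact Gav_abs_le ν (ha k) (Lf_measurable' v ha p g) (hB k) (Lf_bdd v hB hp g)

theorem interp (ν : Measure X) [IsFiniteMeasure ν] [NeZero ν] (v : K → ℝ≥0) (hv : ∀ k, v k ≠ 0) {a : K → X → ℝ}
    (ha : ∀ k, Measurable (a k)) {B : ℝ} (hB : ∀ k x, |a k x| ≤ B) {p p' : ℝ → K → ℝ} (hp : ∀ t k, |p t k| ≤ 1)
    (hp' : ∀ t k, |p' t k| ≤ 1) (hd : ∀ t k, HasDerivAt (fun t => p t k) (p' t k) t) (t0 : ℝ) :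
    HasDerivAt (fun t => ∫ g, Real.log (∫ x, Real.exp (Lf v a (p t) g x) ∂ν) ∂gpi v)
      (- ∑ k, p t0 k * p' t0 k * v k * ∫ g, Gav ν (Lf v a (p t0) g) (a k) ^ 2 ∂gpi v) t0 := by
  have hsq : ∀ k x, |a k x ^ 2| ≤ B ^ 2 := fun k x => by rw [abs_pow]; exact pow_le_pow_left₀ (abs_nonneg _) (hB k x) 2
  have i1 := fun k => integrable_Gav ν v ha hB (hp t0) (ha k) (hB k)
  have i2 := fun k => integrable_Gav ν v ha hB (hp t0) ((ha k).pow_const 2) (hsq k)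
  have i3 : ∀ k, Integrable (fun g => Gav ν (Lf v a (p t0) g) (a k) ^ 2) (gpi v) := fun k => by
    refine Integrable.of_bound ((i1 k).1.pow 2) (B ^ 2) (ae_of_all _ fun g => ?_)
    simp only [Real.norm_eq_abs, Pi.pow_apply, abs_pow]
    exact pow_le_pow_left₀ (abs_nonneg _) (Gav_abs_le ν (ha k) (Lf_measurable' v ha (p t0) g) (hB k) (Lf_bdd v hB (hp t0) g)) 2
  have i4 : ∀ k, Integrable (fun g => g k * Gav ν (Lf v a (p t0) g) (a k)) (gpi v) := fun k => by
    refine Integrable.mul_bdd (c := B) (gpi_integrable_id v k) (i1 k).1 (ae_of_all _ fun g => ?_)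
    exact Gav_abs_le ν (ha k) (Lf_measurable' v ha (p t0) g) (hB k) (Lf_bdd v hB (hp t0) g)
  let L' : ℝ → (K → ℝ) → X → ℝ := fun t g x => ∑ k, (p' t k * g k * a k x - p t k * p' t k * v k * (a k x) ^ 2)
  have hL'm : ∀ t, Measurable (Function.uncurry (L' t)) := by
    intro t; unfold L' Function.uncurry; fun_prop
  have hLmeas' : ∀ t g, Measurable (L' t g) := by
    intro t g; unfold L'; fun_prop
  have hL'b : ∀ t g x, |L' t g x| ≤ Mf v B g := by
    intro t g x
    unfold L' Mf
    refine (Finset.abs_sum_le_sum_abs _ _).trans (Finset.sum_le_sum fun k _ => ?_)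
    have h1 : |p' t k * g k * a k x| ≤ |g k| * B := by
      rw [abs_mul, abs_mul]
      have := hB k x; have := hp' t k; have := abs_nonneg (g k); have := abs_nonneg (a k x)
      calc |p' t k| * |g k| * |a k x| ≤ 1 * |g k| * B := by gcongr
        _ = _ := by ring
    have h2 : |p t k * p' t k * v k * (a k x) ^ 2| ≤ v k * B ^ 2 := by
      rw [abs_mul, abs_mul, abs_mul, abs_of_nonneg (by positivity : (0:ℝ) ≤ v k)]
      have e3 := hsq k x; have := hp t k; have := hp' t k
      calc |p t k| * |p' t k| * v k * |a k x ^ 2| ≤ 1 * 1 * v k * B ^ 2 := by gcongr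
        _ = _ := by ring
    calc _ ≤ |p' t k * g k * a k x| + |p t k * p' t k * v k * (a k x) ^ 2| := abs_sub _ _
      _ ≤ _ := by linarith
  have key := hasDerivAt_integral_of_dominated_loc_of_deriv_le (μ := gpi v)
    (F := fun t g => Real.log (∫ x, Real.exp (Lf v a (p t) g x) ∂ν))
    (F' := fun t g => Gav ν (Lf v a (p t) g) (L' t g)) (bound := Mf v B) (Metric.ball_mem_nhds t0 one_pos)
    (Eventually.of_forall fun t => (integrable_logZ ν v ha hB (hp t)).1) (integrable_logZ ν v ha hB (hp t0))
    (measurable_Gav ν (Lf_measurable v ha (p t0)) (hL'm t0)).aestronglyMeasurable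
    (ae_of_all _ fun g t _ => Gav_abs_le ν (hLmeas' t g) (Lf_measurable' v ha (p t) g) (hL'b t g) (Lf_bdd v hB (hp t) g))
    (Mf_integrable v B)
    (ae_of_all _ fun g t _ => by
      refine hasDerivAt_logZ ν (fun t => Lf v a (p t) g) (fun t => L' t g) t (Mf v B g) (Mf v B g) (fun t => Lf_measurable' v ha (p t) g)
        (fun t => hLmeas' t g) (fun t _ x => Lf_bdd v hB (hp t) g x) (fun t _ x => hL'b t g x) ?_
      intro t x
      unfold Lf L'
      refine HasDerivAt.fun_sum fun k _ => ?_
      have d1 := ((hd t k).mul_const (g k)).mul_const (a k x)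
      have d2 := ((((hd t k).pow 2).mul_const (v k : ℝ)).mul_const ((a k x)^2)).div_const 2
      refine (d1.sub d2).congr_deriv ?_
      push_cast; ring)
  refine key.2.congr_deriv ?_
  have e1 : ∀ g, Gav ν (Lf v a (p t0) g) (L' t0 g) = ∑ k, (p' t0 k * (g k * Gav ν (Lf v a (p t0) g) (a k)) - p t0 k * p' t0 k * v k * Gav ν (Lf v a (p t0) g) (fun x => a k x ^ 2)) := by
    intro g
    have hLm := Lf_measurable' v ha (p t0) g
    have hLb := Lf_bdd v hB (hp t0) g
    have b1 := fun k => integrable_mul_exp ν (ha k) hLm (hB k) hLb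
    have b2 := fun k => integrable_mul_exp ν ((ha k).pow_const 2) hLm (hsq k) hLb
    have b1' : ∀ k, Integrable (fun x => p' t0 k * g k * a k x * Real.exp (Lf v a (p t0) g x)) ν := fun k =>
      ((b1 k).const_mul (p' t0 k * g k)).congr (ae_of_all _ fun x => by ring)
    have b2' : ∀ k, Integrable (fun x => p t0 k * p' t0 k * v k * (a k x) ^ 2 * Real.exp (Lf v a (p t0) g x)) ν := fun k =>
      ((b2 k).const_mul (p t0 k * p' t0 k * v k)).congr (ae_of_all _ fun x => by ring)
    unfold L'
    rw [Gav_sum]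
    · refine Finset.sum_congr rfl fun k _ => ?_
      rw [Gav_sub ν (b1' k) (b2' k), Gav_const_mul, Gav_const_mul]; ring
    · intro k _
      simp only [sub_mul]
      exact (b1' k).sub (b2' k)
  simp_rw [e1]
  rw [integral_finsetSum]
  swap
  · exact fun k _ => ((i4 k).const_mul _).sub ((i2 k).const_mul _)
  rw [← Finset.sum_neg_distrib]
  refine Finset.sum_congr rfl fun k _ => ?_
  rw [integral_sub ((i4 k).const_mul _) ((i2 k).const_mul _), integral_const_mul, integral_const_mul, stein_Gav ν v hv ha hB (hp t0) k,
    integral_const_mul, integral_sub (i2 k) (i3 k)]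
  ring

end interp
end

end

section

open MeasureTheory ProbabilityTheory Filter Matrix
open scoped NNReal ENNReal
noncomputable section
set_option linter.unusedSectionVars false

/-- Variances of the independent noise entries. -/
def vk (n : ℕ) : Fin n × Fin n → ℝ≥0 := fun p => if p.1 = p.2 then 2 else 1

theorem vk_ne (n : ℕ) (p) : vk n p ≠ 0 := by unfold vk; split_ifs <;> norm_num

/-- Coefficient of the noise entry `g p`. -/
def ak (n : ℕ) (p : Fin n × Fin n) (x : Fin n → ℝ) : ℝ :=
  if p.1 < p.2 then x p.1 * x p.2 / √n else if p.1 = p.2 then x p.1 * x p.2 / (2 * √n) else 0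

/-- The Gaussian quadratic form. -/
def Jg (n : ℕ) (g : Fin n × Fin n → ℝ) (x : Fin n → ℝ) : ℝ := ∑ p, g p * ak n p x

/-- Symmetric noise matrix, scaled by 1/√n. -/
def wg (n : ℕ) (g : Fin n × Fin n → ℝ) (i j : Fin n) : ℝ := (if i ≤ j then g (i, j) else g (j, i)) / √n

theorem wg_symm (n : ℕ) (g : Fin n × Fin n → ℝ) (i j : Fin n) : wg n g i j = wg n g j i := by
  unfold wg
  rcases lt_trichotomy i j with h | h | h
  · simp [h.le, not_le.2 h]
  · simp [h]
  · simp [h.le, not_le.2 h]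

theorem sum_swap_half {n : ℕ} (f b : Fin n × Fin n → ℝ) (h : ∀ i j, f (i, j) + f (j, i) = b (i, j)) :
    ∑ p, f p = (1/2) * ∑ i, ∑ j, b (i, j) := by
  have h1 : ∑ p, f p = ∑ i, ∑ j, f (i, j) := Fintype.sum_prod_type _
  have h2 : ∑ p, f p = ∑ i, ∑ j, f (j, i) := by rw [h1, Finset.sum_comm]
  have h3 : ∑ i, ∑ j, b (i, j) = ∑ p, f p + ∑ p, f p := by
    conv_rhs => rw [h2]
    nth_rewrite 1 [← h2]
    rw [h1, ← Finset.sum_add_distrib]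
    refine Finset.sum_congr rfl fun i _ => ?_
    rw [← Finset.sum_add_distrib]
    exact Finset.sum_congr rfl fun j _ => (h i j).symm
  rw [h3]; ring

theorem Jg_eq (n : ℕ) (g : Fin n × Fin n → ℝ) (x : Fin n → ℝ) :
    Jg n g x = (1/2) * ∑ i, ∑ j, wg n g i j * x i * x j := by
  unfold Jg
  refine sum_swap_half _ (fun p => wg n g p.1 p.2 * x p.1 * x p.2) fun i j => ?_
  unfold ak wg
  rcases lt_trichotomy i j with h | h | h
  · simp [h, h.le, not_lt.2 h.le, h.ne']; ring
  · subst h; simp; ring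
  · simp [h, not_le.2 h, not_lt.2 h.le, h.ne']; ring

theorem ak_cov (n : ℕ) (x y : Fin n → ℝ) :
    ∑ p, (vk n p : ℝ) * ak n p x * ak n p y = (x ⬝ᵥ y) ^ 2 / (2 * n) := by
  have hs : √(n:ℝ) * √(n:ℝ) = n := Real.mul_self_sqrt (Nat.cast_nonneg _)
  rw [sum_swap_half _ (fun p => (x p.1 * y p.1) * (x p.2 * y p.2) / n)]
  · unfold dotProduct
    rw [pow_two, Finset.sum_mul_sum]
    simp_rw [← Finset.sum_div]
    ring
  · intro i j
    unfold ak vk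
    have key : ∀ a b : ℝ, a / √n * (b / √n) = a * b / n := fun a b => by rw [div_mul_div_comm, hs]
    have key2 : ∀ a b : ℝ, a / (2 * √n) * (b / (2 * √n)) = a * b / (4 * n) := fun a b => by rw [div_mul_div_comm]; rw [show 2 * √(n:ℝ) * (2 * √n) = 4 * (√(n:ℝ) * √n) by ring, hs]
    rcases lt_trichotomy i j with h | h | h
    · simp [h, not_lt.2 h.le, h.ne', h.ne, key]; ring
    · subst h; simp [mul_assoc, key2]; ring
    · simp [h, not_lt.2 h.le, h.ne', h.ne, key]; ring

theorem ak_meas (n : ℕ) (p) : Measurable (ak n p) := by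
  unfold ak; split_ifs <;> fun_prop

theorem Jg_meas (n : ℕ) : Measurable (Function.uncurry (Jg n)) := by
  have := ak_meas n
  unfold Jg Function.uncurry; fun_prop

/-- Reduced Hamiltonian. -/
def Hr (n : ℕ) (θ : ℝ) (s : Fin n → ℝ) (g : Fin n × Fin n → ℝ) (x : Fin n → ℝ) : ℝ :=
  -(x ⬝ᵥ x) ^ 2 / (4 * n) + Jg n g x + θ / (2 * n) * (s ⬝ᵥ x) ^ 2

/-- Reduced partition function. -/
def Zr (n : ℕ) (c θ : ℝ) (s : Fin n → ℝ) (g : Fin n × Fin n → ℝ) : ℝ :=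
  ∫ x, Real.exp (Hr n θ s g x) ∂gaussPrior n (1 / c)

/-- Reduced expected log-partition function. -/
def Fr (n : ℕ) (c θ : ℝ) : ℝ := ∫ p, Real.log (Zr n c θ p.1 p.2) ∂((gaussPrior n 1).prod (gpi (vk n)))

instance (n : ℕ) (v : ℝ) : IsProbabilityMeasure (gaussPrior n v) := by unfold gaussPrior; infer_instance

theorem gaussPrior_scale (n : ℕ) (r v : ℝ) (hv : 0 ≤ v) :
    (gaussPrior n v).map (fun x i => r * x i) = gaussPrior n (r ^ 2 * v) := by
  unfold gaussPrior
  rw [Measure.pi_map_pi (f := fun _ (x:ℝ) => r * x) (fun i => by fun_prop)]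
  congr 1; ext1 i
  rw [gaussianReal_map_const_mul, mul_zero]
  congr 1
  ext
  simp [Real.coe_toNNReal _ hv, Real.coe_toNNReal _ (mul_nonneg (sq_nonneg r) hv)]

theorem measurable_entry {n : ℕ} (i j : Fin n) : Measurable (fun Z : Matrix (Fin n) (Fin n) ℝ => Z i j) := by
  have : Measurable (fun Z : Fin n → Fin n → ℝ => Z i j) := by fun_prop
  exact this

theorem reduction (n : ℕ) (hn : 0 < n) (sig sig' lam lam' : ℝ)
    (hsig : 0 < sig) (hsig' : 0 < sig') (hlam : 0 < lam) (hlam' : 0 < lam') :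
    freeEnergy n sig sig' lam lam' = -(1 / (n:ℝ)) * Fr n (1 / (√lam' * sig' ^ 2)) (√lam * sig ^ 2) := by
  have hn' : (0:ℝ) < n := by exact_mod_cast hn
  unfold freeEnergy Fr
  congr 1
  let W : (Fin n × Fin n → ℝ) → Matrix (Fin n) (Fin n) ℝ := fun g => Matrix.of fun i j => if i ≤ j then g (i, j) else g (j, i)
  have hW : Measurable W := by
    have : Measurable (fun (g : Fin n × Fin n → ℝ) (i j : Fin n) => if i ≤ j then g (i, j) else g (j, i)) := by
      refine measurable_pi_iff.2 fun i => measurable_pi_iff.2 fun j => ?_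
      split_ifs <;> fun_prop
    exact this
  have hm : (gaussPrior n (sig ^ 2)).prod (noiseMeasure n) =
      ((gaussPrior n 1).prod (gpi (vk n))).map (Prod.map (fun x i => sig * x i) W) := by
    rw [← Measure.map_prod_map _ _ (by fun_prop) hW, gaussPrior_scale n sig 1 zero_le_one, mul_one]
    rfl
  have tr : ∀ (Y : Matrix (Fin n) (Fin n) ℝ) (x : Fin n → ℝ), Matrix.trace (Y * Matrix.vecMulVec x x) = ∑ i, ∑ j, Y i j * x i * x j := by
    intro Y x
    simp only [Matrix.trace, Matrix.diag, Matrix.mul_apply, Matrix.vecMulVec_apply]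
    refine Finset.sum_congr rfl fun i _ => Finset.sum_congr rfl fun j _ => by ring
  rw [hm, integral_map]
  rotate_left
  · exact (by fun_prop : Measurable (Prod.map (fun (x : Fin n → ℝ) i => sig * x i) W)).aemeasurable
  · apply Measurable.aestronglyMeasurable
    apply Measurable.log
    unfold partitionFn
    have hmm : Measurable (Function.uncurry fun (p : (Fin n → ℝ) × Matrix (Fin n) (Fin n) ℝ) (x : Fin n → ℝ) => (-(lam' / (4 * n)) * (∑ i, (x i) ^ 2) ^ 2 +
      (1 / 2) * Real.sqrt (lam' / n) * Matrix.trace (obs n lam p.1 p.2 * Matrix.vecMulVec x x))) := by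
      simp only [tr, obs]
      unfold Function.uncurry
      simp only [Matrix.add_apply, Matrix.smul_apply, Matrix.vecMulVec_apply]
      have := fun i j : Fin n => measurable_entry i j
      fun_prop
    exact measurable_Z (gaussPrior n (sig' ^ 2)) hmm
  refine integral_congr_ae (ae_of_all _ fun p => ?_)
  obtain ⟨s, g⟩ := p
  simp only [Prod.map]
  congr 1
  unfold partitionFn Zr
  have hq : 0 < √lam' := Real.sqrt_pos.2 hlam'
  have hg : gaussPrior n (1 / (1 / (√lam' * sig' ^ 2))) = (gaussPrior n (sig' ^ 2)).map (fun x i => √(√lam') * x i) := by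
    rw [gaussPrior_scale n _ _ (sq_nonneg _), Real.sq_sqrt hq.le]
    simp
  have hHr : Measurable (fun x => Hr n (√lam * sig ^ 2) s g x) := by
    unfold Hr dotProduct
    have := (Jg_meas n).comp (measurable_const (a := g) |>.prodMk measurable_id : Measurable fun x : Fin n → ℝ => (g, x))
    have h2 : Measurable (fun x => Jg n g x) := this
    fun_prop
  rw [hg, integral_map (by fun_prop : Measurable fun (x : Fin n → ℝ) i => √(√lam') * x i).aemeasurable (hHr.exp.aestronglyMeasurable)]
  refine integral_congr_ae (ae_of_all _ fun x => ?_)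
  simp only
  congr 1
  rw [tr]
  unfold Hr
  rw [Jg_eq]
  have hr4 : √(√lam') * √(√lam') = √lam' := Real.mul_self_sqrt hq.le
  have hr2 : √lam' * √lam' = lam' := Real.mul_self_sqrt hlam'.le
  have hrn : √(n:ℝ) * √n = n := Real.mul_self_sqrt hn'.le
  have hrn' : √(n:ℝ) ≠ 0 := (Real.sqrt_pos.2 hn').ne'
  have e1 : ((fun i => √(√lam') * x i) ⬝ᵥ fun i => √(√lam') * x i) = √lam' * ∑ i, x i ^ 2 := by
    unfold dotProduct
    rw [Finset.mul_sum]
    refine Finset.sum_congr rfl fun i _ => ?_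
    linear_combination (x i ^ 2) * hr4
  have e2 : (s ⬝ᵥ fun i => √(√lam') * x i) = √(√lam') * ∑ i, s i * x i := by
    unfold dotProduct
    rw [Finset.mul_sum]
    exact Finset.sum_congr rfl fun i _ => by ring
  have e3 : ∑ i, ∑ j, obs n lam (fun i => sig * s i) (W g) i j * x i * x j =
      √(lam / n) * sig ^ 2 * (∑ i, s i * x i) ^ 2 + √n * ∑ i, ∑ j, wg n g i j * x i * x j := by
    rw [pow_two (∑ i, s i * x i), Finset.sum_mul_sum, Finset.mul_sum, Finset.mul_sum, ← Finset.sum_add_distrib]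
    refine Finset.sum_congr rfl fun i _ => ?_
    rw [Finset.mul_sum, Finset.mul_sum, ← Finset.sum_add_distrib]
    refine Finset.sum_congr rfl fun j _ => ?_
    simp only [obs, Matrix.add_apply, Matrix.smul_apply, Matrix.vecMulVec_apply, W, Matrix.of_apply, wg, smul_eq_mul]
    field_simp
  have e4 : ∑ i, ∑ j, wg n g i j * (√(√lam') * x i) * (√(√lam') * x j) = √lam' * ∑ i, ∑ j, wg n g i j * x i * x j := by
    simp_rw [Finset.mul_sum]
    refine Finset.sum_congr rfl fun i _ => Finset.sum_congr rfl fun j _ => ?_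
    linear_combination (wg n g i j * x i * x j) * hr4
  rw [e1, e2, e3, e4, Real.sqrt_div hlam'.le, Real.sqrt_div hlam.le]
  have h5 : (√(√lam') * ∑ i, s i * x i) ^ 2 = √lam' * (∑ i, s i * x i) ^ 2 := by rw [mul_pow, pow_two (√(√lam')), hr4]
  rw [h5]
  generalize (∑ i, ∑ j, wg n g i j * x i * x j) = A
  generalize (∑ i, s i * x i) = D
  generalize (∑ i, x i ^ 2) = Q
  have h6 : lam' / (4 * n) * Q ^ 2 = (√lam' * Q)^2 / (4 * n) := by rw [mul_pow, pow_two (√lam'), hr2]; ring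
  have h7 : √lam' / √n * (√lam / √n) = √lam' * √lam / n := by rw [div_mul_div_comm, hrn]
  have h8 : (√lam' / √n) * √n = √lam' := by field_simp
  calc _ = -(lam' / (4 * n) * Q ^ 2) + 1/2 * ((√lam' / √n * (√lam / √n)) * sig^2 * D^2) + 1/2 * ((√lam' / √n) * √n) * A := by ring
    _ = _ := by rw [h6, h7, h8]; ring

end

end

section

open MeasureTheory ProbabilityTheory Filter Matrix
open scoped NNReal ENNReal
noncomputable section
set_option linter.unusedSectionVars false

theorem gaussPrior_eq_gpi (n : ℕ) (v : ℝ) : gaussPrior n v = gpi (fun _ : Fin n => Real.toNNReal v) := rfl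

theorem dot_meas {n : ℕ} (z : Fin n → ℝ) : Measurable (fun s : Fin n → ℝ => z ⬝ᵥ s) := by
  unfold dotProduct; fun_prop

theorem sq_meas {n : ℕ} : Measurable (fun s : Fin n → ℝ => s ⬝ᵥ s) := by
  unfold dotProduct; fun_prop

theorem dot_update {n : ℕ} (z s : Fin n → ℝ) (i : Fin n) (t : ℝ) :
    z ⬝ᵥ Function.update s i t = z ⬝ᵥ s + z i * (t - s i) := by
  unfold dotProduct
  rw [← Finset.add_sum_erase _ _ (Finset.mem_univ i), ← Finset.add_sum_erase Finset.univ (fun i => z i * s i) (Finset.mem_univ i)]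
  have : ∑ j ∈ Finset.univ.erase i, z j * Function.update s i t j = ∑ j ∈ Finset.univ.erase i, z j * s j :=
    Finset.sum_congr rfl fun j hj => by rw [Function.update_of_ne (Finset.ne_of_mem_erase hj)]
  rw [this, Function.update_self]; ring

theorem hasDerivAt_dot_update {n : ℕ} (z s : Fin n → ℝ) (i : Fin n) (t : ℝ) :
    HasDerivAt (fun t => z ⬝ᵥ Function.update s i t) (z i) t := by
  simp only [dot_update]
  refine ((((hasDerivAt_id t).sub_const (s i)).const_mul (z i)).const_add (z ⬝ᵥ s)).congr_deriv (by simp)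

theorem dot_pow4_int (n : ℕ) (v : ℝ) (z : Fin n → ℝ) : Integrable (fun s => (z ⬝ᵥ s) ^ 4) (gaussPrior n v) := by
  have h : MemLp (fun s => z ⬝ᵥ s) 4 (gaussPrior n v) := by
    unfold dotProduct
    refine memLp_finsetSum _ fun i _ => ?_
    refine MemLp.const_mul ?_ _
    have h1 := memLp_id_gaussianReal (μ := 0) (v := Real.toNNReal v) 4
    exact h1.comp_measurePreserving (measurePreserving_eval (fun _ : Fin n => gaussianReal 0 (Real.toNNReal v)) i)
  have := h.integrable_norm_pow (p := 4) (by norm_num)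
  refine this.congr (ae_of_all _ fun s => ?_)
  simp only [Real.norm_eq_abs]
  rw [show (4:ℕ) = 2 * 2 by norm_num, pow_mul, sq_abs, ← pow_mul]

theorem abs_mul4_le (a b c d : ℝ) : |a * b * c * d| ≤ a ^ 4 + b ^ 4 + c ^ 4 + d ^ 4 := by
  rw [abs_le]
  constructor <;>
  nlinarith [sq_nonneg (a * b - c * d), sq_nonneg (a * b + c * d), sq_nonneg (a ^ 2 - b ^ 2), sq_nonneg (c ^ 2 - d ^ 2), sq_nonneg (a^2), sq_nonneg (b^2), sq_nonneg (c^2), sq_nonneg (d^2)]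

theorem dot4_int (n : ℕ) (v : ℝ) (a b c d : Fin n → ℝ) :
    Integrable (fun s => (a ⬝ᵥ s) * (b ⬝ᵥ s) * (c ⬝ᵥ s) * (d ⬝ᵥ s)) (gaussPrior n v) := by
  refine Integrable.mono' ((((dot_pow4_int n v a).add (dot_pow4_int n v b)).add (dot_pow4_int n v c)).add (dot_pow4_int n v d)) ?_ (ae_of_all _ fun s => abs_mul4_le _ _ _ _)
  have := dot_meas a; have := dot_meas b; have := dot_meas c; have := dot_meas d
  exact Measurable.aestronglyMeasurable (by fun_prop)

theorem dot3_int (n : ℕ) (v : ℝ) (a b c : Fin n → ℝ) :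
    Integrable (fun s => (a ⬝ᵥ s) * (b ⬝ᵥ s) * (c ⬝ᵥ s)) (gaussPrior n v) := by
  refine Integrable.mono' ((((dot_pow4_int n v a).add (dot_pow4_int n v b)).add (dot_pow4_int n v c)).add (integrable_const (1:ℝ))) ?_ (ae_of_all _ fun s => ?_)
  · have := dot_meas a; have := dot_meas b; have := dot_meas c
    exact Measurable.aestronglyMeasurable (by fun_prop)
  · simpa using abs_mul4_le (a ⬝ᵥ s) (b ⬝ᵥ s) (c ⬝ᵥ s) 1

theorem dot2_int (n : ℕ) (v : ℝ) (a b : Fin n → ℝ) :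
    Integrable (fun s => (a ⬝ᵥ s) * (b ⬝ᵥ s)) (gaussPrior n v) := by
  refine Integrable.mono' ((((dot_pow4_int n v a).add (dot_pow4_int n v b)).add (integrable_const (1:ℝ))).add (integrable_const (1:ℝ))) ?_ (ae_of_all _ fun s => ?_)
  · have := dot_meas a; have := dot_meas b
    exact Measurable.aestronglyMeasurable (by fun_prop)
  · simpa using abs_mul4_le (a ⬝ᵥ s) (b ⬝ᵥ s) 1 1

theorem dot1_int (n : ℕ) (v : ℝ) (a : Fin n → ℝ) :
    Integrable (fun s => (a ⬝ᵥ s)) (gaussPrior n v) := by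
  refine Integrable.mono' ((((dot_pow4_int n v a).add (integrable_const (1:ℝ))).add (integrable_const (1:ℝ))).add (integrable_const (1:ℝ))) ?_ (ae_of_all _ fun s => ?_)
  · exact (dot_meas a).aestronglyMeasurable
  · simpa using abs_mul4_le (a ⬝ᵥ s) 1 1 1

/-- Stein in the form of a sum over directions. -/
theorem stein_dot (n : ℕ) {v : ℝ} (hv : 0 < v) (z : Fin n → ℝ) (F : (Fin n → ℝ) → ℝ) (F' : Fin n → (Fin n → ℝ) → ℝ)
    (hd : ∀ i g s, HasDerivAt (fun s => F (Function.update g i s)) (F' i (Function.update g i s)) s)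
    (hf : Integrable F (gaussPrior n v)) (hf' : ∀ i, Integrable (F' i) (gaussPrior n v))
    (hxf : ∀ i, Integrable (fun g => g i * F g) (gaussPrior n v)) :
    ∫ s, (z ⬝ᵥ s) * F s ∂gaussPrior n v = v * ∫ s, ∑ i, z i * F' i s ∂gaussPrior n v := by
  have h1 : ∀ s : Fin n → ℝ, (z ⬝ᵥ s) * F s = ∑ i, z i * (s i * F s) := fun s => by
    unfold dotProduct; rw [Finset.sum_mul]; exact Finset.sum_congr rfl fun i _ => by ring
  simp_rw [h1]
  rw [integral_finsetSum _ fun i _ => (hxf i).const_mul _, integral_finsetSum _ fun i _ => (hf' i).const_mul _, Finset.mul_sum]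
  refine Finset.sum_congr rfl fun i _ => ?_
  rw [integral_const_mul, integral_const_mul]
  have := stein_pi (fun _ : Fin n => Real.toNNReal v) i (by simpa using hv) F (F' i) (hd i) hf (hf' i) (hxf i)
  rw [gaussPrior_eq_gpi, this, Real.coe_toNNReal _ hv.le]; ring

theorem coord_eq_dot {n : ℕ} (i : Fin n) (s : Fin n → ℝ) : s i = Pi.single i 1 ⬝ᵥ s := by simp

theorem mom2 (n : ℕ) {v : ℝ} (hv : 0 < v) (z y : Fin n → ℝ) :
    ∫ s, (z ⬝ᵥ s) * (y ⬝ᵥ s) ∂gaussPrior n v = v * (z ⬝ᵥ y) := by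
  rw [stein_dot n hv z (fun s => y ⬝ᵥ s) (fun i _ => y i) (fun i g s => hasDerivAt_dot_update y g i s) (dot1_int n v y)
    (fun i => integrable_const _) (fun i => by simp_rw [fun s : Fin n → ℝ => coord_eq_dot i s]; exact dot2_int n v _ _)]
  simp [dotProduct]

theorem mom22 (n : ℕ) {v : ℝ} (hv : 0 < v) (z y : Fin n → ℝ) :
    ∫ s, (z ⬝ᵥ s) ^ 2 * (y ⬝ᵥ s) ^ 2 ∂gaussPrior n v = v ^ 2 * ((z ⬝ᵥ z) * (y ⬝ᵥ y) + 2 * (z ⬝ᵥ y) ^ 2) := by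
  have h0 : ∀ s, (z ⬝ᵥ s) ^ 2 * (y ⬝ᵥ s) ^ 2 = (z ⬝ᵥ s) * ((z ⬝ᵥ s) * (y ⬝ᵥ s) * (y ⬝ᵥ s)) := fun s => by ring
  simp_rw [h0]
  rw [stein_dot n hv z (fun s => (z ⬝ᵥ s) * (y ⬝ᵥ s) * (y ⬝ᵥ s)) (fun i s => z i * ((y ⬝ᵥ s) * (y ⬝ᵥ s)) + 2 * y i * ((z ⬝ᵥ s) * (y ⬝ᵥ s)))]
  · have e : ∀ s, ∑ i, z i * (z i * ((y ⬝ᵥ s) * (y ⬝ᵥ s)) + 2 * y i * ((z ⬝ᵥ s) * (y ⬝ᵥ s))) =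
      (z ⬝ᵥ z) * ((y ⬝ᵥ s) * (y ⬝ᵥ s)) + 2 * (z ⬝ᵥ y) * ((z ⬝ᵥ s) * (y ⬝ᵥ s)) := by
      intro s
      generalize (y ⬝ᵥ s) = a
      generalize (z ⬝ᵥ s) = b
      unfold dotProduct
      rw [Finset.mul_sum, Finset.sum_mul, Finset.sum_mul, ← Finset.sum_add_distrib]
      exact Finset.sum_congr rfl fun i _ => by ring
    simp_rw [e]
    rw [integral_add ((dot2_int n v y y).const_mul _) ((dot2_int n v z y).const_mul _), integral_const_mul, integral_const_mul, mom2 n hv, mom2 n hv]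
    ring
  · intro i g s
    have h1 := hasDerivAt_dot_update y g i s
    have h2 := hasDerivAt_dot_update z g i s
    refine ((h2.mul h1).mul h1).congr_deriv ?_
    simp only [Pi.mul_apply]
    ring
  · exact dot3_int n v z y y
  · exact fun i => ((dot2_int n v y y).const_mul _).add ((dot2_int n v z y).const_mul _)
  · intro i
    simp_rw [fun s : Fin n → ℝ => coord_eq_dot i s]
    exact (dot4_int n v (Pi.single i 1) z y y).congr (ae_of_all _ fun s => by ring)

theorem sq_eq_sum {n : ℕ} (s : Fin n → ℝ) : s ⬝ᵥ s = ∑ i, (Pi.single i 1 ⬝ᵥ s) * (Pi.single i 1 ⬝ᵥ s) := by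
  simp_rw [← coord_eq_dot]; rfl

theorem sq_int (n : ℕ) (v : ℝ) : Integrable (fun s => s ⬝ᵥ s) (gaussPrior n v) := by
  simp_rw [sq_eq_sum]
  exact integrable_finsetSum _ fun i _ => dot2_int n v _ _

theorem sqsq_eq_sum {n : ℕ} (s : Fin n → ℝ) : (s ⬝ᵥ s) ^ 2 = ∑ i, ∑ j, (Pi.single i 1 ⬝ᵥ s) ^ 2 * (Pi.single j 1 ⬝ᵥ s) ^ 2 := by
  rw [pow_two, ← Finset.sum_mul_sum]
  have : s ⬝ᵥ s = ∑ i, (Pi.single i 1 ⬝ᵥ s) ^ 2 := by rw [sq_eq_sum]; simp [pow_two]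
  rw [← this]

theorem sqsq_int (n : ℕ) (v : ℝ) : Integrable (fun s => (s ⬝ᵥ s) ^ 2) (gaussPrior n v) := by
  simp_rw [sqsq_eq_sum]
  refine integrable_finsetSum _ fun i _ => integrable_finsetSum _ fun j _ => ?_
  exact (dot4_int n v (Pi.single i 1) (Pi.single i 1) (Pi.single j 1) (Pi.single j 1)).congr (ae_of_all _ fun s => by ring)

theorem sq_mean (n : ℕ) {v : ℝ} (hv : 0 < v) : ∫ s, s ⬝ᵥ s ∂gaussPrior n v = n * v := by
  simp_rw [sq_eq_sum]
  rw [integral_finsetSum _ fun i _ => dot2_int n v _ _]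
  simp_rw [mom2 n hv]
  simp

theorem sqsq_mean (n : ℕ) {v : ℝ} (hv : 0 < v) : ∫ s, (s ⬝ᵥ s) ^ 2 ∂gaussPrior n v = v ^ 2 * (n ^ 2 + 2 * n) := by
  have hi : ∀ i j : Fin n, Integrable (fun s : Fin n → ℝ => (Pi.single i 1 ⬝ᵥ s) ^ 2 * (Pi.single j 1 ⬝ᵥ s) ^ 2) (gaussPrior n v) := fun i j =>
    (dot4_int n v (Pi.single i 1) (Pi.single i 1) (Pi.single j 1) (Pi.single j 1)).congr (ae_of_all _ fun s => by ring)
  simp_rw [sqsq_eq_sum]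
  rw [integral_finsetSum _ fun i _ => integrable_finsetSum _ fun j _ => hi i j]
  have : ∀ i : Fin n, ∫ s, ∑ j, (Pi.single i 1 ⬝ᵥ s) ^ 2 * (Pi.single j 1 ⬝ᵥ s) ^ 2 ∂gaussPrior n v = v ^ 2 * (n + 2) := by
    intro i
    rw [integral_finsetSum _ fun j _ => hi i j]
    simp_rw [mom22 n hv]
    rw [← Finset.mul_sum, Finset.sum_add_distrib]
    congr 1
    simp [Pi.single_apply]
  simp_rw [this]
  simp; ring

theorem dev_mean (n : ℕ) (hn : 0 < n) {v : ℝ} (hv : 0 < v) :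
    Integrable (fun s => (s ⬝ᵥ s / n - v) ^ 2) (gaussPrior n v) ∧ ∫ s, (s ⬝ᵥ s / n - v) ^ 2 ∂gaussPrior n v = 2 * v ^ 2 / n := by
  have hn' : (n:ℝ) ≠ 0 := by exact_mod_cast hn.ne'
  have e : ∀ s : Fin n → ℝ, (s ⬝ᵥ s / n - v) ^ 2 = (1 / (n:ℝ) ^ 2) * (s ⬝ᵥ s) ^ 2 - (2 * v / n) * (s ⬝ᵥ s) + v ^ 2 := fun s => by field_simp; ring
  simp_rw [e]
  have i1 := (sqsq_int n v).const_mul (1 / (n:ℝ) ^ 2)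
  have i2 := (sq_int n v).const_mul (2 * v / n)
  refine ⟨(i1.sub i2).add (integrable_const _), ?_⟩
  have i3 := i1.sub i2
  have e2 := integral_add i3 (integrable_const (v^2))
  simp only [Pi.sub_apply] at e2
  rw [e2, integral_sub i1 i2, integral_const_mul, integral_const_mul, sq_mean n hv, sqsq_mean n hv]
  simp
  field_simp
  ring

/-- Markov bound: at least half the prior mass is in a ball. -/
theorem prior_ball (n : ℕ) {v : ℝ} (hv : 0 < v) {R : ℝ} (hR : 2 * (n * v) ≤ R) (hR0 : 0 < R) :
    1 / 2 ≤ (gaussPrior n v).real {x | x ⬝ᵥ x ≤ R} := by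
  have h1 := mul_meas_ge_le_integral_of_nonneg (μ := gaussPrior n v) (f := fun x => x ⬝ᵥ x) (ae_of_all _ fun x => by
    show 0 ≤ x ⬝ᵥ x
    exact Finset.sum_nonneg fun i _ => mul_self_nonneg _) (sq_int n v) R
  rw [sq_mean n hv] at h1
  have h2 : (gaussPrior n v).real {x | R ≤ x ⬝ᵥ x} ≤ 1 / 2 := by
    by_contra h
    push Not at h
    nlinarith
  have h3 : (gaussPrior n v).real {x | x ⬝ᵥ x ≤ R}ᶜ ≤ (gaussPrior n v).real {x | R ≤ x ⬝ᵥ x} := by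
    refine measureReal_mono (fun x hx => ?_) (measure_ne_top _ _)
    simp only [Set.mem_compl_iff, Set.mem_setOf_eq, not_le] at hx ⊢
    exact hx.le
  have hm : MeasurableSet {x : Fin n → ℝ | x ⬝ᵥ x ≤ R} := measurableSet_le sq_meas measurable_const
  rw [probReal_compl_eq_one_sub hm] at h3
  linarith

end

end

section

open MeasureTheory ProbabilityTheory Filter Matrix
open scoped NNReal ENNReal
noncomputable section
set_option linter.unusedSectionVars false

theorem sq_nn {n : ℕ} (x : Fin n → ℝ) : 0 ≤ x ⬝ᵥ x := Finset.sum_nonneg fun i _ => mul_self_nonneg _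

theorem dot_cs {n : ℕ} (s x : Fin n → ℝ) : (s ⬝ᵥ x) ^ 2 ≤ (s ⬝ᵥ s) * (x ⬝ᵥ x) := by
  have := Finset.sum_mul_sq_le_sq_mul_sq Finset.univ s x
  simpa [dotProduct, pow_two] using this

theorem coord_mul_le {n : ℕ} (x : Fin n → ℝ) (i j : Fin n) : |x i * x j| ≤ x ⬝ᵥ x := by
  have h : ∀ i, x i * x i ≤ x ⬝ᵥ x := fun i => Finset.single_le_sum (f := fun i => x i * x i) (fun j _ => mul_self_nonneg _) (Finset.mem_univ i)
  have h1 := h i; have h2 := h j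
  rw [abs_le]
  constructor <;> nlinarith [mul_self_nonneg (x i + x j), mul_self_nonneg (x i - x j)]

theorem ak_le {n : ℕ} (p : Fin n × Fin n) (x : Fin n → ℝ) : |ak n p x| ≤ (x ⬝ᵥ x) / √n := by
  have h0 := sq_nn x
  have h1 := coord_mul_le x p.1 p.2
  have hs := Real.sqrt_nonneg (n:ℝ)
  unfold ak
  split_ifs
  · rw [abs_div, abs_of_nonneg hs]; gcongr
  · rw [abs_div, abs_of_nonneg (by positivity : 0 ≤ 2 * √(n:ℝ))]
    calc |x p.1 * x p.2| / (2 * √n) = |x p.1 * x p.2| / √n / 2 := by rw [div_div, mul_comm 2]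
      _ ≤ |x p.1 * x p.2| / √n := by
          have : 0 ≤ |x p.1 * x p.2| / √n := by positivity
          linarith
      _ ≤ _ := by gcongr
  · simp; positivity

/-- ℓ¹ norm of the noise. -/
def G1 {n : ℕ} (g : Fin n × Fin n → ℝ) : ℝ := ∑ p, |g p|

theorem G1_nn {n : ℕ} (g : Fin n × Fin n → ℝ) : 0 ≤ G1 g := Finset.sum_nonneg fun _ _ => abs_nonneg _

theorem Jg_le {n : ℕ} (g : Fin n × Fin n → ℝ) (x : Fin n → ℝ) : |Jg n g x| ≤ G1 g / √n * (x ⬝ᵥ x) := by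
  unfold Jg G1
  refine (Finset.abs_sum_le_sum_abs _ _).trans ?_
  rw [Finset.sum_div, Finset.sum_mul]
  refine Finset.sum_le_sum fun p _ => ?_
  rw [abs_mul]
  calc |g p| * |ak n p x| ≤ |g p| * ((x ⬝ᵥ x) / √n) := by gcongr; exact ak_le p x
    _ = _ := by ring

theorem Hr_le {n : ℕ} (hn : 0 < n) {θ : ℝ} (hθ : 0 ≤ θ) (s : Fin n → ℝ) (g : Fin n × Fin n → ℝ) (x : Fin n → ℝ) :
    Hr n θ s g x ≤ 2 * G1 g ^ 2 + θ ^ 2 * (s ⬝ᵥ s) ^ 2 / (2 * n) := by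
  have hn' : (0:ℝ) < n := by exact_mod_cast hn
  have h1 := (abs_le.1 (Jg_le g x)).2
  have h2 := dot_cs s x
  have h3 := sq_nn x
  unfold Hr
  have h4 : θ / (2 * n) * (s ⬝ᵥ x) ^ 2 ≤ θ / (2 * n) * ((s ⬝ᵥ s) * (x ⬝ᵥ x)) := by gcongr
  have hs : √(n:ℝ) * √n = n := Real.mul_self_sqrt hn'.le
  have hsp : 0 < √(n:ℝ) := Real.sqrt_pos.2 hn'
  generalize (x ⬝ᵥ x) = r at *
  generalize (s ⬝ᵥ s) = q at *
  generalize (s ⬝ᵥ x) ^ 2 = d at *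
  generalize G1 g = G at *
  generalize Jg n g x = J at *
  have h5 : -r ^ 2 / (4 * n) + (G / √n * r + θ / (2 * n) * (q * r)) ≤ 2 * G ^ 2 + θ ^ 2 * q ^ 2 / (2 * n) := by
    have e1 : G / √n * r ≤ r ^ 2 / (8 * n) + 2 * G ^ 2 := by
      have : 0 ≤ (r / √n - 4 * G) ^ 2 := sq_nonneg _
      have e : r ^ 2 / (8 * n) = (r / √n) ^ 2 / 8 := by rw [div_pow, pow_two (√(n:ℝ)), hs]; field_simp
      rw [e]
      have : G / √n * r = G * (r / √n) := by ring
      rw [this]; nlinarith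
    have e2 : θ / (2 * n) * (q * r) ≤ r ^ 2 / (8 * n) + θ ^ 2 * q ^ 2 / (2 * n) := by
      have : 0 ≤ (r - 2 * θ * q) ^ 2 / (8 * n) := by positivity
      have e : r ^ 2 / (8 * n) + θ ^ 2 * q ^ 2 / (2 * n) - θ / (2 * n) * (q * r) = (r - 2 * θ * q) ^ 2 / (8 * n) := by field_simp; ring
      linarith
    have e3 : -r ^ 2 / (4 * n) = -(2 * (r ^ 2 / (8 * n))) := by field_simp; ring
    linarith
  linarith

theorem Hr_meas (n : ℕ) (θ : ℝ) : Measurable (Function.uncurry fun (p : (Fin n → ℝ) × (Fin n × Fin n → ℝ)) x => Hr n θ p.1 p.2 x) := by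
  unfold Hr Function.uncurry
  have h := Jg_meas n
  have h2 : Measurable (fun q : ((Fin n → ℝ) × (Fin n × Fin n → ℝ)) × (Fin n → ℝ) => Jg n q.1.2 q.2) :=
    h.comp ((measurable_snd.comp measurable_fst).prodMk measurable_snd)
  unfold dotProduct
  fun_prop

theorem Hr_meas1 (n : ℕ) (θ : ℝ) (s g) : Measurable (fun x => Hr n θ s g x) :=
by
  unfold Hr dotProduct
  have := (Jg_meas n).comp (measurable_const (a := g) |>.prodMk measurable_id : Measurable fun x : Fin n → ℝ => (g, x))
  have h2 : Measurable (fun x => Jg n g x) := this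
  fun_prop

theorem Hr_exp_int {n : ℕ} (hn : 0 < n) {θ : ℝ} (hθ : 0 ≤ θ) (s g) (μ : Measure (Fin n → ℝ)) [IsFiniteMeasure μ] :
    Integrable (fun x => Real.exp (Hr n θ s g x)) μ := by
  refine Integrable.of_bound (Hr_meas1 n θ s g).exp.aestronglyMeasurable (Real.exp (2 * G1 g ^ 2 + θ ^ 2 * (s ⬝ᵥ s) ^ 2 / (2 * n))) (ae_of_all _ fun x => ?_)
  rw [Real.norm_eq_abs, abs_of_pos (Real.exp_pos _)]
  exact Real.exp_le_exp.2 (Hr_le hn hθ s g x)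

theorem Zr_pos {n : ℕ} (hn : 0 < n) {c θ : ℝ} (hθ : 0 ≤ θ) (s g) : 0 < Zr n c θ s g :=
  integral_exp_pos (Hr_exp_int hn hθ s g _)

/-- closed ball -/
def ball (n : ℕ) (R : ℝ) : Set (Fin n → ℝ) := {x | x ⬝ᵥ x ≤ R}

theorem ball_meas (n : ℕ) (R : ℝ) : MeasurableSet (ball n R) := measurableSet_le sq_meas measurable_const

/-- partition function on a ball -/
def ZrB (n : ℕ) (c θ R : ℝ) (s : Fin n → ℝ) (g : Fin n × Fin n → ℝ) : ℝ :=
  ∫ x in ball n R, Real.exp (Hr n θ s g x) ∂gaussPrior n (1 / c)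

theorem ZrB_le {n : ℕ} (hn : 0 < n) {c θ R : ℝ} (hθ : 0 ≤ θ) (s g) : ZrB n c θ R s g ≤ Zr n c θ s g :=
  setIntegral_le_integral (Hr_exp_int hn hθ s g _) (ae_of_all _ fun x => (Real.exp_pos _).le)

theorem ZrB_ge {n : ℕ} (hn : 0 < n) {c θ R : ℝ} (hc : 0 < c) (hθ : 0 ≤ θ) (hR : 2 * (n * (1 / c)) ≤ R) (s g) :
    1 / 2 * Real.exp (-((2 * (n * (1 / c))) ^ 2 / (4 * n) + G1 g / √n * (2 * (n * (1 / c))))) ≤ ZrB n c θ R s g := by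
  have hn' : (0:ℝ) < n := by exact_mod_cast hn
  have hp := prior_ball n (v := 1 / c) (by positivity) le_rfl (by positivity)
  set R0 := 2 * (n * (1 / c)) with hR0
  have hR0' : 0 < R0 := by positivity
  have h1 : ∫ x in ball n R0, Real.exp (-(R0 ^ 2 / (4 * n) + G1 g / √n * R0)) ∂gaussPrior n (1 / c) ≤ ZrB n c θ R0 s g := by
    refine setIntegral_mono_on (integrable_const _).integrableOn (Hr_exp_int hn hθ s g _) (ball_meas n R0) fun x hx => ?_
    refine Real.exp_le_exp.2 ?_
    have hx' : x ⬝ᵥ x ≤ R0 := hx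
    have h0 := sq_nn x
    have hJ := (abs_le.1 (Jg_le g x)).1
    have hG : G1 g / √n * (x ⬝ᵥ x) ≤ G1 g / √n * R0 := by
      have := G1_nn g; gcongr
    have hd : 0 ≤ θ / (2 * n) * (s ⬝ᵥ x) ^ 2 := by positivity
    have hq : (x ⬝ᵥ x) ^ 2 / (4 * n) ≤ R0 ^ 2 / (4 * n) := by gcongr
    unfold Hr
    rw [neg_div]; linarith
  have h2 : ZrB n c θ R0 s g ≤ ZrB n c θ R s g := by
    refine setIntegral_mono_set (Hr_exp_int hn hθ s g _).integrableOn (ae_of_all _ fun x => (Real.exp_pos _).le) ?_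
    exact Eventually.of_forall fun x hx => le_trans (show x ⬝ᵥ x ≤ R0 from hx) hR
  refine le_trans ?_ (h1.trans h2)
  rw [setIntegral_const, smul_eq_mul]
  exact mul_le_mul_of_nonneg_right hp (Real.exp_pos _).le

/-- dominating function for log-partition functions -/
def Dom (n : ℕ) (c θ : ℝ) (s : Fin n → ℝ) (g : Fin n × Fin n → ℝ) : ℝ :=
  (Real.log 2 + (2 * (n * (1 / c))) ^ 2 / (4 * n) + G1 g / √n * (2 * (n * (1 / c)))) + (2 * G1 g ^ 2 + θ ^ 2 * (s ⬝ᵥ s) ^ 2 / (2 * n))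

theorem logZrB_abs {n : ℕ} (hn : 0 < n) {c θ R : ℝ} (hc : 0 < c) (hθ : 0 ≤ θ) (hR : 2 * (n * (1 / c)) ≤ R) (s g) {Z : ℝ}
    (h1 : ZrB n c θ R s g ≤ Z) (h2 : Z ≤ Zr n c θ s g) : |Real.log Z| ≤ Dom n c θ s g := by
  have hn' : (0:ℝ) < n := by exact_mod_cast hn
  have h3 := (ZrB_ge hn hc hθ hR s g).trans h1
  have hp : 0 < 1 / 2 * Real.exp (-((2 * (n * (1 / c))) ^ 2 / (4 * n) + G1 g / √n * (2 * (n * (1 / c))))) := by positivity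
  have h4 := Real.log_le_log hp h3
  rw [Real.log_mul (by norm_num) (Real.exp_pos _).ne', Real.log_exp, one_div, Real.log_inv] at h4
  have h5 : Zr n c θ s g ≤ Real.exp (2 * G1 g ^ 2 + θ ^ 2 * (s ⬝ᵥ s) ^ 2 / (2 * n)) := by
    have : Zr n c θ s g ≤ ∫ x, Real.exp (2 * G1 g ^ 2 + θ ^ 2 * (s ⬝ᵥ s) ^ 2 / (2 * n)) ∂gaussPrior n (1 / c) :=
      integral_mono (Hr_exp_int hn hθ s g _) (integrable_const _) fun x => Real.exp_le_exp.2 (Hr_le hn hθ s g x)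
    simpa using this
  have h6 := Real.log_le_log (hp.trans_le h3) (h2.trans h5)
  rw [Real.log_exp] at h6
  have h7 : 0 ≤ Real.log 2 := Real.log_nonneg (by norm_num)
  have h8 := G1_nn g
  have h9 : 0 ≤ G1 g / √n * (2 * (n * (1 / c))) := by positivity
  have h10 : 0 ≤ (2 * (n * (1 / c))) ^ 2 / (4 * n) := by positivity
  have h11 : 0 ≤ 2 * G1 g ^ 2 + θ ^ 2 * (s ⬝ᵥ s) ^ 2 / (2 * n) := by positivity
  unfold Dom
  rw [abs_le]; constructor
  · linarith
  · linarith

theorem G1_int (n : ℕ) : Integrable (fun g => G1 g) (gpi (vk n)) :=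
  integrable_finsetSum _ fun p _ => (gpi_integrable_id (vk n) p).abs

theorem G1sq_int (n : ℕ) : Integrable (fun g => G1 g ^ 2) (gpi (vk n)) := by
  have h2 : Integrable (fun g : Fin n × Fin n → ℝ => ((Finset.univ : Finset (Fin n × Fin n)).card : ℝ) * ∑ p, |g p| ^ 2) (gpi (vk n)) := by
    refine Integrable.const_mul (integrable_finsetSum _ fun p _ => ?_) _
    simp_rw [sq_abs]
    exact gpi_integrable_pow (vk n) p 2
  refine Integrable.mono' h2 ((G1_int n).1.pow 2) (ae_of_all _ fun g => ?_)
  simp only [Pi.pow_apply, Real.norm_eq_abs, abs_pow, sq_abs]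
  have := sq_sum_le_card_mul_sum_sq (s := Finset.univ) (f := fun p => |g p|)
  simp only [sq_abs] at this; exact this

theorem Dom_int (n : ℕ) (c θ : ℝ) : Integrable (fun p : (Fin n → ℝ) × (Fin n × Fin n → ℝ) => Dom n c θ p.1 p.2) ((gaussPrior n 1).prod (gpi (vk n))) := by
  unfold Dom
  refine ((integrable_const _).add ?_).add (Integrable.add ?_ ?_)
  · exact (((G1_int n).div_const _).mul_const _).comp_snd (gaussPrior n 1)
  · exact ((G1sq_int n).const_mul _).comp_snd (gaussPrior n 1)
  · exact (((sqsq_int n 1).const_mul _).div_const _).comp_fst (gpi (vk n))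

theorem Dom_int1 (n : ℕ) (c θ : ℝ) (s) : Integrable (fun g => Dom n c θ s g) (gpi (vk n)) := by
  unfold Dom
  refine ((integrable_const _).add ?_).add (Integrable.add ?_ ?_)
  · exact (((G1_int n).div_const _).mul_const _)
  · exact ((G1sq_int n).const_mul _)
  · exact integrable_const _

theorem Zr_meas (n : ℕ) (c θ : ℝ) : Measurable (fun p : (Fin n → ℝ) × (Fin n × Fin n → ℝ) => Zr n c θ p.1 p.2) :=
  measurable_Z _ (Hr_meas n θ)

theorem ZrB_meas (n : ℕ) (c θ R : ℝ) : Measurable (fun p : (Fin n → ℝ) × (Fin n × Fin n → ℝ) => ZrB n c θ R p.1 p.2) :=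
  measurable_Z ((gaussPrior n (1/c)).restrict (ball n R)) (Hr_meas n θ)

theorem logZr_int {n : ℕ} (hn : 0 < n) {c θ : ℝ} (hc : 0 < c) (hθ : 0 ≤ θ) :
    Integrable (fun p : (Fin n → ℝ) × (Fin n × Fin n → ℝ) => Real.log (Zr n c θ p.1 p.2)) ((gaussPrior n 1).prod (gpi (vk n))) :=
  Integrable.mono' (Dom_int n c θ) (Zr_meas n c θ).log.aestronglyMeasurable
    (ae_of_all _ fun p => logZrB_abs hn hc hθ le_rfl p.1 p.2 (ZrB_le hn hθ _ _) le_rfl)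

/-- if the ball-restricted log partition functions are bounded then so is the full one -/
theorem logZr_limit {n : ℕ} (hn : 0 < n) {c θ : ℝ} (hc : 0 < c) (hθ : 0 ≤ θ) (s : Fin n → ℝ) (U : ℝ)
    (h : ∀ R, 2 * (n * (1 / c)) ≤ R → ∫ g, Real.log (ZrB n c θ R s g) ∂gpi (vk n) ≤ U) :
    ∫ g, Real.log (Zr n c θ s g) ∂gpi (vk n) ≤ U := by
  have ms : ∀ {f : (Fin n → ℝ) × (Fin n × Fin n → ℝ) → ℝ}, Measurable f → Measurable fun g => f (s, g) := fun hf =>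
    hf.comp (measurable_const.prodMk measurable_id)
  have lim : Tendsto (fun N : ℕ => ∫ g, Real.log (ZrB n c θ (2 * (n * (1 / c)) + N) s g) ∂gpi (vk n)) atTop (nhds (∫ g, Real.log (Zr n c θ s g) ∂gpi (vk n))) := by
    refine tendsto_integral_of_dominated_convergence (fun g => Dom n c θ s g) ?_ (Dom_int1 n c θ s) ?_ ?_
    · exact fun N => (ms (ZrB_meas n c θ _)).log.aestronglyMeasurable
    · exact fun N => ae_of_all _ fun g => logZrB_abs hn hc hθ (R := 2 * (n * (1 / c)) + N) (by simp) s g le_rfl (ZrB_le hn hθ s g)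
    · refine ae_of_all _ fun g => ?_
      refine Tendsto.log ?_ (Zr_pos hn hθ s g).ne'
      have hu : (⋃ N : ℕ, ball n (2 * (n * (1 / c)) + N)) = Set.univ := by
        refine Set.eq_univ_of_forall fun x => Set.mem_iUnion.2 ?_
        obtain ⟨N, hN⟩ := exists_nat_ge (x ⬝ᵥ x)
        refine ⟨N, ?_⟩
        show x ⬝ᵥ x ≤ _
        have : 0 ≤ 2 * ((n:ℝ) * (1 / c)) := by positivity
        linarith
      have := tendsto_setIntegral_of_monotone (μ := gaussPrior n (1 / c)) (f := fun x => Real.exp (Hr n θ s g x)) (s := fun N : ℕ => ball n (2 * (n * (1 / c)) + N)) (fun N => ball_meas n _) ?_ ?_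
      · rw [hu, setIntegral_univ] at this; exact this
      · intro N M hNM x hx
        refine le_trans (show x ⬝ᵥ x ≤ _ from hx) ?_
        have : (N:ℝ) ≤ M := by exact_mod_cast hNM
        linarith
      · exact (Hr_exp_int hn hθ s g _).integrableOn
  exact le_of_tendsto' lim fun N => h _ (by simp)

end

end

section

open MeasureTheory ProbabilityTheory Filter Matrix
open scoped NNReal ENNReal
noncomputable section
set_option linter.unusedSectionVars false

/-- one-dimensional Gaussian integral -/
theorem pdf_tilt (v : ℝ≥0) (hv : v ≠ 0) (β κ : ℝ) (hκ : κ * v < 1) (w : ℝ≥0) (hw : (w:ℝ) = v / (1 - κ * v)) (x : ℝ) :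
    gaussianPDFReal 0 v x * Real.exp (β * x + κ * x ^ 2 / 2) =
      ((√(1 - κ * v))⁻¹ * Real.exp (β ^ 2 * v / (2 * (1 - κ * v)))) * gaussianPDFReal (β * w) w x := by
  have hv' : 0 < (v:ℝ) := by positivity
  have hk : 0 < 1 - κ * v := by linarith
  unfold gaussianPDFReal
  rw [hw]
  have e1 : √(2 * Real.pi * (v / (1 - κ * v))) = √(2 * Real.pi * v) / √(1 - κ * v) := by
    rw [← mul_div_assoc, Real.sqrt_div' _ hk.le]
  rw [e1]
  have h1 : 0 < √(2 * Real.pi * v) := by positivity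
  have h2 : 0 < √(1 - κ * v) := Real.sqrt_pos.2 hk
  rw [mul_assoc, ← Real.exp_add, mul_mul_mul_comm, ← Real.exp_add]
  obtain ⟨d, hd⟩ : ∃ d, d = 1 - κ * (v:ℝ) := ⟨_, rfl⟩
  rw [← hd] at hk h2 ⊢
  have hκ' : κ = (1 - d) / v := by field_simp; linarith
  congr 1
  · field_simp
  · congr 1; rw [hκ']; field_simp; ring

theorem gint (v : ℝ≥0) (hv : v ≠ 0) (β κ : ℝ) (hκ : κ * v < 1) :
    Integrable (fun x => Real.exp (β * x + κ * x ^ 2 / 2)) (gaussianReal 0 v) ∧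
    ∫ x, Real.exp (β * x + κ * x ^ 2 / 2) ∂gaussianReal 0 v = (√(1 - κ * v))⁻¹ * Real.exp (β ^ 2 * v / (2 * (1 - κ * v))) := by
  have hv' : 0 < (v:ℝ) := by positivity
  have hk : 0 < 1 - κ * v := by linarith
  obtain ⟨w, hw⟩ : ∃ w : ℝ≥0, (w:ℝ) = v / (1 - κ * v) := ⟨⟨v / (1 - κ * v), by positivity⟩, rfl⟩
  have hw0 : w ≠ 0 := by
    intro h; rw [h] at hw
    have : 0 < (v:ℝ) / (1 - κ * v) := by positivity
    rw [← hw] at this; simp at this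
  constructor
  · rw [gaussianReal_of_var_ne_zero _ hv, integrable_withDensity_iff_integrable_smul' (measurable_gaussianPDF _ _) (ae_of_all _ fun x => gaussianPDF_lt_top)]
    simp only [toReal_gaussianPDF, smul_eq_mul]
    simp_rw [pdf_tilt v hv β κ hκ w hw]
    exact (integrable_gaussianPDFReal _ _).const_mul _
  · rw [integral_gaussianReal_eq_integral_smul hv]
    simp only [smul_eq_mul]
    simp_rw [pdf_tilt v hv β κ hκ w hw]
    rw [integral_const_mul, integral_gaussianPDFReal_eq_one _ hw0, mul_one]

/-- product Gaussian integral -/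
theorem gint_pi {n : ℕ} (v : ℝ) (hv : 0 < v) (β : Fin n → ℝ) (κ : ℝ) (hκ : κ * v < 1) :
    Integrable (fun x : Fin n → ℝ => Real.exp (β ⬝ᵥ x + κ * (x ⬝ᵥ x) / 2)) (gaussPrior n v) ∧
    ∫ x, Real.exp (β ⬝ᵥ x + κ * (x ⬝ᵥ x) / 2) ∂gaussPrior n v =
      (√(1 - κ * v))⁻¹ ^ n * Real.exp ((β ⬝ᵥ β) * v / (2 * (1 - κ * v))) := by
  have hv0 : Real.toNNReal v ≠ 0 := by simpa using hv
  have hc : ((Real.toNNReal v : ℝ≥0):ℝ) = v := Real.coe_toNNReal _ hv.le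
  have e : ∀ x : Fin n → ℝ, Real.exp (β ⬝ᵥ x + κ * (x ⬝ᵥ x) / 2) = ∏ i, Real.exp (β i * x i + κ * x i ^ 2 / 2) := by
    intro x
    rw [← Real.exp_sum]
    congr 1
    unfold dotProduct
    rw [Finset.sum_add_distrib, ← Finset.sum_div, ← Finset.mul_sum]
    simp only [pow_two]
  simp_rw [e]
  constructor
  · exact Integrable.fintype_prod (f := fun i y => Real.exp (β i * y + κ * y ^ 2 / 2)) fun i => (gint _ hv0 _ _ (by rw [hc]; exact hκ)).1
  · unfold gaussPrior
    rw [integral_fintype_prod_eq_prod (f := fun i y => Real.exp (β i * y + κ * y ^ 2 / 2))]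
    simp_rw [(gint _ hv0 _ _ (by rw [hc]; exact hκ)).2, hc]
    rw [Finset.prod_mul_distrib, ← Real.exp_sum, Finset.prod_const, Finset.card_univ, Fintype.card_fin]
    congr 2
    unfold dotProduct
    rw [Finset.sum_mul, Finset.sum_div]
    simp only [pow_two]

/-- rank one chi-square type integral -/
theorem gint_rank1 {n : ℕ} (v : ℝ) (hv : 0 < v) (x : Fin n → ℝ) (a : ℝ) (ha : 0 ≤ a) (h : 2 * a * (x ⬝ᵥ x) * v < 1) :
    Integrable (fun y : Fin n → ℝ => Real.exp (a * (x ⬝ᵥ y) ^ 2)) (gaussPrior n v) ∧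
    ∫ y, Real.exp (a * (x ⬝ᵥ y) ^ 2) ∂gaussPrior n v = (√(1 - 2 * a * (x ⬝ᵥ x) * v))⁻¹ := by
  have e0 : ∀ y : Fin n → ℝ, Real.exp (a * (x ⬝ᵥ y) ^ 2) = ∫ u, Real.exp (√(2 * a) * (x ⬝ᵥ y) * u) ∂gaussianReal 0 1 := by
    intro y
    have := (gint 1 one_ne_zero (√(2 * a) * (x ⬝ᵥ y)) 0 (by simp)).2
    simp only [zero_mul, zero_div, add_zero, NNReal.coe_one, sub_zero, Real.sqrt_one, inv_one, one_mul, mul_one] at this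
    rw [this, mul_pow, Real.sq_sqrt (by positivity)]
    congr 1; ring
  have e1 : ∀ u : ℝ, ∫ y, Real.exp (√(2 * a) * (x ⬝ᵥ y) * u) ∂gaussPrior n v = Real.exp (0 * u + (2 * a * (x ⬝ᵥ x) * v) * u ^ 2 / 2) := by
    intro u
    have := (gint_pi (n := n) v hv ((√(2 * a) * u) • x) 0 (by simp)).2
    simp only [zero_mul, zero_div, add_zero, sub_zero, Real.sqrt_one, inv_one, one_mul, mul_one, one_pow, smul_dotProduct, dotProduct_smul, smul_eq_mul, zero_add] at this ⊢
    convert this using 2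
    · ext y; congr 1; ring
    · have : √(2 * a) * √(2 * a) = 2 * a := Real.mul_self_sqrt (by positivity)
      linear_combination (-(u ^ 2 * (x ⬝ᵥ x) * v / 2)) * this
  have hI : Integrable (fun p : ℝ × (Fin n → ℝ) => Real.exp (√(2 * a) * (x ⬝ᵥ p.2) * p.1)) ((gaussianReal 0 1).prod (gaussPrior n v)) := by
    have hm : Measurable (fun p : ℝ × (Fin n → ℝ) => Real.exp (√(2 * a) * (x ⬝ᵥ p.2) * p.1)) := by
      unfold dotProduct; fun_prop
    refine (integrable_prod_iff hm.aestronglyMeasurable).2 ⟨ae_of_all _ fun u => ?_, ?_⟩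
    · have := (gint_pi (n := n) v hv ((√(2 * a) * u) • x) 0 (by simp)).1
      simp only [zero_mul, zero_div, add_zero, smul_dotProduct, smul_eq_mul] at this
      refine this.congr (ae_of_all _ fun y => ?_)
      simp only; congr 1; ring
    · simp only [Real.norm_eq_abs, Real.abs_exp]
      simp_rw [e1]
      exact (gint 1 one_ne_zero 0 (2 * a * (x ⬝ᵥ x) * v) (by simpa using h)).1
  constructor
  · simp_rw [e0]
    exact hI.integral_prod_right
  · simp_rw [e0]
    rw [integral_integral_swap (f := fun y u => Real.exp (√(2 * a) * (x ⬝ᵥ y) * u)) hI.swap]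
    simp_rw [e1]
    have := (gint 1 one_ne_zero 0 (2 * a * (x ⬝ᵥ x) * v) (by simpa using h)).2
    simpa using this

section gav
variable {X : Type*} [MeasurableSpace X]

theorem Gav_mul (ν : Measure X) [SFinite ν] (L f h : X → ℝ) :
    Gav ν L f * Gav ν L h = Gav (ν.prod ν) (fun q => L q.1 + L q.2) (fun q => f q.1 * h q.2) := by
  unfold Gav
  simp_rw [Real.exp_add]
  rw [div_mul_div_comm, ← integral_prod_mul, ← integral_prod_mul]
  congr 2; ext q; ring

theorem Gav_mono (ν : Measure X) {L f h : X → ℝ} (hf : Integrable (fun x => f x * Real.exp (L x)) ν)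
    (hh : Integrable (fun x => h x * Real.exp (L x)) ν) (hfh : ∀ᵐ x ∂ν, f x ≤ h x) : Gav ν L f ≤ Gav ν L h := by
  unfold Gav
  refine div_le_div_of_nonneg_right (integral_mono_ae hf hh ?_) (integral_nonneg fun x => (Real.exp_pos _).le)
  filter_upwards [hfh] with x hx
  exact mul_le_mul_of_nonneg_right hx (Real.exp_pos _).le

theorem Gav_nonneg (ν : Measure X) {L f : X → ℝ} (hf : ∀ x, 0 ≤ f x) : 0 ≤ Gav ν L f := by
  unfold Gav
  exact div_nonneg (integral_nonneg fun x => mul_nonneg (hf x) (Real.exp_pos _).le) (integral_nonneg fun x => (Real.exp_pos _).le)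

theorem Gav_const (ν : Measure X) {L : X → ℝ} (hp : 0 < ∫ x, Real.exp (L x) ∂ν) (a : ℝ) : Gav ν L (fun _ => a) = a := by
  unfold Gav; rw [integral_const_mul]; field_simp

theorem Gav_congr (ν : Measure X) {L f h : X → ℝ} (hfh : ∀ᵐ x ∂ν, f x = h x) : Gav ν L f = Gav ν L h := by
  unfold Gav
  congr 1
  refine integral_congr_ae ?_
  filter_upwards [hfh] with x hx
  simp only [hx]
end gav

/-- truncation to the ball -/
def Tb (n : ℕ) (R : ℝ) (x : Fin n → ℝ) : Fin n → ℝ := open Classical in if x ⬝ᵥ x ≤ R then x else 0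

theorem Tb_meas (n : ℕ) (R : ℝ) : Measurable (Tb n R) := by
  unfold Tb
  exact Measurable.ite (ball_meas n R) measurable_id measurable_const

theorem Tb_le {n : ℕ} {R : ℝ} (hR : 0 ≤ R) (x : Fin n → ℝ) : Tb n R x ⬝ᵥ Tb n R x ≤ R := by
  unfold Tb; split_ifs with h
  · exact h
  · simpa using hR

theorem Tb_eq {n : ℕ} {R : ℝ} {x : Fin n → ℝ} (hx : x ∈ ball n R) : Tb n R x = x := if_pos hx

end

end

section

open MeasureTheory ProbabilityTheory Filter Matrix
open scoped NNReal ENNReal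
noncomputable section
set_option linter.unusedSectionVars false

section rep
variable {X : Type*} [MeasurableSpace X] {K : Type*} [Fintype K] [DecidableEq K]

theorem pair_meas {L : X → ℝ} (hL : Measurable L) : Measurable (fun q : X × X => L q.1 + L q.2) := by fun_prop

theorem pair_bdd {L : X → ℝ} {B : ℝ} (hB : ∀ x, |L x| ≤ B) (q : X × X) : |L q.1 + L q.2| ≤ 2 * B := by
  refine (abs_add_le _ _).trans ?_
  have := hB q.1; have := hB q.2; linarith

instance prodNeZero (ν : Measure X) [SFinite ν] [NeZero ν] : NeZero (ν.prod ν) := by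
  constructor
  rw [Ne, ← Measure.measure_univ_eq_zero, ← Set.univ_prod_univ, Measure.prod_prod]
  simp [NeZero.ne ν]

theorem sum_Gav_sq (ν : Measure X) [IsFiniteMeasure ν] {L : X → ℝ} (hL : Measurable L) {BL : ℝ} (hBL : ∀ x, |L x| ≤ BL) {a : K → X → ℝ}
    (ha : ∀ k, Measurable (a k)) {B : ℝ} (hB : ∀ k x, |a k x| ≤ B) (w : K → ℝ) :
    ∑ k, w k * Gav ν L (a k) ^ 2 = Gav (ν.prod ν) (fun q => L q.1 + L q.2) (fun q => ∑ k, w k * a k q.1 * a k q.2) := by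
  rw [Gav_sum]
  · refine Finset.sum_congr rfl fun k _ => ?_
    rw [pow_two, Gav_mul, ← Gav_const_mul]
    simp only [mul_assoc]
  · intro k _
    refine integrable_mul_exp _ (B := |w k| * B * B) (by have := ha k; fun_prop) (pair_meas hL) ?_ (pair_bdd hBL)
    intro q
    rw [abs_mul, abs_mul]
    have h1 := hB k q.1; have h2 := hB k q.2
    have h3 := (abs_nonneg _).trans h1
    gcongr

theorem sum_Gav_sq_int (ν : Measure X) [IsFiniteMeasure ν] [NeZero ν] (v : K → ℝ≥0) {a : K → X → ℝ}
    (ha : ∀ k, Measurable (a k)) {B : ℝ} (hB : ∀ k x, |a k x| ≤ B) {p : K → ℝ} (hp : ∀ k, |p k| ≤ 1) (w : K → ℝ) :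
    ∑ k, w k * ∫ g, Gav ν (Lf v a p g) (a k) ^ 2 ∂gpi v =
      ∫ g, Gav (ν.prod ν) (fun q => Lf v a p g q.1 + Lf v a p g q.2) (fun q => ∑ k, w k * a k q.1 * a k q.2) ∂gpi v := by
  simp_rw [← integral_const_mul]
  rw [← integral_finsetSum]
  · refine integral_congr_ae (ae_of_all _ fun g => ?_)
    exact sum_Gav_sq ν (Lf_measurable' v ha p g) (Lf_bdd v hB hp g) ha hB w
  · intro k _
    refine Integrable.const_mul ?_ _
    refine Integrable.of_bound ((integrable_Gav ν v ha hB hp (ha k) (hB k)).1.pow 2) (B ^ 2) (ae_of_all _ fun g => ?_)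
    simp only [Real.norm_eq_abs, Pi.pow_apply, abs_pow]
    exact pow_le_pow_left₀ (abs_nonneg _) (Gav_abs_le ν (ha k) (Lf_measurable' v ha p g) (hB k) (Lf_bdd v hB hp g)) 2

end rep

/-- weighted prior restricted to a ball -/
def nuW (n : ℕ) (v R : ℝ) (w : (Fin n → ℝ) → ℝ) : Measure (Fin n → ℝ) :=
  ((gaussPrior n v).restrict (ball n R)).withDensity (fun x => ENNReal.ofReal (Real.exp (w (Tb n R x))))

theorem nuW_fin (n : ℕ) (v R : ℝ) {w : (Fin n → ℝ) → ℝ} (hw : Measurable w) {B : ℝ} (hB : ∀ x, |w (Tb n R x)| ≤ B) :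
    IsFiniteMeasure (nuW n v R w) :=
  isFiniteMeasure_withDensity_ofReal (integrable_exp_bdd _ (hw.comp (Tb_meas n R)) hB).2

theorem nuW_integral (n : ℕ) (v R : ℝ) {w : (Fin n → ℝ) → ℝ} (hw : Measurable w) (f : (Fin n → ℝ) → ℝ) :
    ∫ x, f x ∂nuW n v R w = ∫ x in ball n R, f x * Real.exp (w x) ∂gaussPrior n v := by
  unfold nuW
  rw [integral_withDensity_eq_integral_toReal_smul (by have := hw.comp (Tb_meas n R); exact (this.exp).ennreal_ofReal) (ae_of_all _ fun x => ENNReal.ofReal_lt_top)]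
  refine setIntegral_congr_fun (ball_meas n R) fun x hx => ?_
  simp only [ENNReal.toReal_ofReal (Real.exp_pos _).le, smul_eq_mul, Tb_eq hx]
  ring

theorem nuW_ae (n : ℕ) (v R : ℝ) (w : (Fin n → ℝ) → ℝ) : ∀ᵐ x ∂nuW n v R w, x ∈ ball n R :=
  (withDensity_absolutelyContinuous _ _).ae_le (ae_restrict_mem (ball_meas n R))

theorem nuW_ne (n : ℕ) {v R : ℝ} {w : (Fin n → ℝ) → ℝ} (hw : Measurable w)
    (hR : 0 < (gaussPrior n v).real (ball n R)) : NeZero (nuW n v R w) := by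
  constructor
  intro h
  have hm : Measurable (fun x => ENNReal.ofReal (Real.exp (w (Tb n R x)))) := ((hw.comp (Tb_meas n R)).exp).ennreal_ofReal
  unfold nuW at h
  rw [withDensity_eq_zero_iff hm.aemeasurable] at h
  have h2 : ∀ᵐ x ∂(gaussPrior n v).restrict (ball n R), False := by
    filter_upwards [h] with x hx
    simp only [Pi.zero_apply, ENNReal.ofReal_eq_zero] at hx
    exact absurd (Real.exp_pos _) (not_lt.2 hx)
  rw [ae_iff] at h2
  simp at h2
  rw [Measure.real, h2] at hR
  simp at hR

theorem gpi_inl {I J : Type*} [Fintype I] [Fintype J] (v1 : I → ℝ≥0) (v2 : J → ℝ≥0) (f : (I → ℝ) → ℝ) :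
    ∫ g, f (fun i => g (Sum.inl i)) ∂gpi (Sum.elim v1 v2) = ∫ g, f g ∂gpi v1 := by
  have h := measurePreserving_sumPiEquivProdPi (X := fun _ : I ⊕ J => ℝ) (fun k => gaussianReal 0 (Sum.elim v1 v2 k))
  have h2 := h.integral_comp (MeasurableEquiv.measurableEmbedding _) (fun p => f p.1)
  rw [integral_fun_fst] at h2
  simp only [probReal_univ, one_smul] at h2
  exact h2

theorem gpi_inr {I J : Type*} [Fintype I] [Fintype J] (v1 : I → ℝ≥0) (v2 : J → ℝ≥0) (f : (J → ℝ) → ℝ) :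
    ∫ g, f (fun i => g (Sum.inr i)) ∂gpi (Sum.elim v1 v2) = ∫ g, f g ∂gpi v2 := by
  have h := measurePreserving_sumPiEquivProdPi (X := fun _ : I ⊕ J => ℝ) (fun k => gaussianReal 0 (Sum.elim v1 v2 k))
  have h2 := h.integral_comp (MeasurableEquiv.measurableEmbedding _) (fun p => f p.2)
  rw [integral_fun_snd] at h2
  simp only [probReal_univ, one_smul] at h2
  exact h2

theorem coord_abs_le {n : ℕ} (x : Fin n → ℝ) (i : Fin n) : |x i| ≤ √(x ⬝ᵥ x) := by
  rw [← Real.sqrt_sq_eq_abs]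
  refine Real.sqrt_le_sqrt ?_
  have := coord_mul_le x i i
  rw [abs_mul_self] at this
  rw [pow_two]; exact this

/-- Guerra interpolation bound -/
theorem guerra {n : ℕ} (hn : 0 < n) {v R q : ℝ} (hR : 0 ≤ R) (hq : 0 ≤ q) {w : (Fin n → ℝ) → ℝ} (hw : Measurable w) {Bw : ℝ} (hBw : ∀ x, |w (Tb n R x)| ≤ Bw)
    (hP : 0 < (gaussPrior n v).real (ball n R)) :
    ∫ g, Real.log (∫ x in ball n R, Real.exp (-(x ⬝ᵥ x) ^ 2 / (4 * n) + Jg n g x + w x) ∂gaussPrior n v) ∂gpi (vk n) ≤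
      n * q ^ 2 / 4 + ∫ h, Real.log (∫ x in ball n R, Real.exp (√q * (h ⬝ᵥ x) - q * (x ⬝ᵥ x) / 2 + w x) ∂gaussPrior n v) ∂gpi (fun _ : Fin n => (1:ℝ≥0)) := by
  have hn' : (0:ℝ) < n := by exact_mod_cast hn
  set ν := nuW n v R w with hν
  haveI : IsFiniteMeasure ν := nuW_fin n v R hw hBw
  haveI : NeZero ν := nuW_ne n hw hP
  set vv : (Fin n × Fin n) ⊕ Fin n → ℝ≥0 := Sum.elim (vk n) (fun _ => 1) with hvv
  set a : (Fin n × Fin n) ⊕ Fin n → (Fin n → ℝ) → ℝ := Sum.elim (fun k x => ak n k (Tb n R x)) (fun i x => √q * Tb n R x i) with ha_def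
  have ha : ∀ k, Measurable (a k) := by
    rintro (k | i)
    · exact (ak_meas n k).comp (Tb_meas n R)
    · exact ((measurable_pi_apply i).comp (Tb_meas n R)).const_mul _
  have hB : ∀ k x, |a k x| ≤ R / √n + √q * √R := by
    have h1 : 0 ≤ R / √n := by positivity
    have h2 : 0 ≤ √q * √R := by positivity
    rintro (k | i) x
    · have := (ak_le k (Tb n R x)).trans (div_le_div_of_nonneg_right (Tb_le hR x) (Real.sqrt_nonneg _))
      simp only [a, Sum.elim_inl]; linarith
    · have := (coord_abs_le (Tb n R x) i).trans (Real.sqrt_le_sqrt (Tb_le hR x))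
      simp only [a, Sum.elim_inr, abs_mul, abs_of_nonneg (Real.sqrt_nonneg q)]
      have := mul_le_mul_of_nonneg_left this (Real.sqrt_nonneg q)
      linarith
  set p : ℝ → (Fin n × Fin n) ⊕ Fin n → ℝ := fun t => Sum.elim (fun _ => Real.sin t) (fun _ => Real.cos t) with hp_def
  set p' : ℝ → (Fin n × Fin n) ⊕ Fin n → ℝ := fun t => Sum.elim (fun _ => Real.cos t) (fun _ => -Real.sin t) with hp'_def
  have hp : ∀ t k, |p t k| ≤ 1 := by
    rintro t (k | i)
    · exact Real.abs_sin_le_one t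
    · exact Real.abs_cos_le_one t
  have hp' : ∀ t k, |p' t k| ≤ 1 := by
    rintro t (k | i)
    · exact Real.abs_cos_le_one t
    · simp only [p', Sum.elim_inr, abs_neg]; exact Real.abs_sin_le_one t
  have hd : ∀ t k, HasDerivAt (fun t => p t k) (p' t k) t := by
    rintro t (k | i)
    · exact Real.hasDerivAt_sin t
    · exact Real.hasDerivAt_cos t
  have hvk : ∀ k, vv k ≠ 0 := by
    rintro (k | i)
    · exact vk_ne n k
    · exact one_ne_zero
  have D := fun t => interp ν vv hvk ha hB hp hp' hd t
  set φ : ℝ → ℝ := fun t => ∫ g, Real.log (∫ x, Real.exp (Lf vv a (p t) g x) ∂ν) ∂gpi vv with hφ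
  have Dle : ∀ t, 0 ≤ Real.sin t * Real.cos t → (- ∑ k, p t k * p' t k * vv k * ∫ g, Gav ν (Lf vv a (p t) g) (a k) ^ 2 ∂gpi vv) ≤ Real.sin t * Real.cos t * (n * q ^ 2 / 2) := by
    intro t ht
    rw [sum_Gav_sq_int ν vv ha hB (hp t), neg_le]
    have key : ∀ x y, -(Real.sin t * Real.cos t * (n * q ^ 2 / 2)) ≤ ∑ k, p t k * p' t k * vv k * a k x * a k y := by
      intro x y
      rw [Fintype.sum_sum_type]
      simp only [p, p', vv, a, Sum.elim_inl, Sum.elim_inr]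
      have e1 : ∑ k, Real.sin t * Real.cos t * (vk n k) * ak n k (Tb n R x) * ak n k (Tb n R y) = Real.sin t * Real.cos t * ((Tb n R x ⬝ᵥ Tb n R y) ^ 2 / (2 * n)) := by
        rw [← ak_cov, Finset.mul_sum]; exact Finset.sum_congr rfl fun k _ => by ring
      have e2 : ∑ i, Real.cos t * -Real.sin t * ((1:ℝ≥0):ℝ) * (√q * Tb n R x i) * (√q * Tb n R y i) = -(Real.sin t * Real.cos t * (q * (Tb n R x ⬝ᵥ Tb n R y))) := by
        unfold dotProduct
        rw [Finset.mul_sum, Finset.mul_sum, ← Finset.sum_neg_distrib]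
        refine Finset.sum_congr rfl fun i _ => ?_
        have : √q * √q = q := Real.mul_self_sqrt hq
        push_cast
        linear_combination (-(Real.cos t * Real.sin t * Tb n R x i * Tb n R y i)) * this
      rw [e1, e2]
      have : (Tb n R x ⬝ᵥ Tb n R y) ^ 2 / (2 * n) - q * (Tb n R x ⬝ᵥ Tb n R y) + n * q ^ 2 / 2 = ((Tb n R x ⬝ᵥ Tb n R y) - n * q) ^ 2 / (2 * n) := by
        field_simp; ring
      have h3 : 0 ≤ Real.sin t * Real.cos t * (((Tb n R x ⬝ᵥ Tb n R y) - n * q) ^ 2 / (2 * n)) := by positivity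
      rw [← this] at h3
      linarith
    have hm : Measurable (fun q : (Fin n → ℝ) × (Fin n → ℝ) => ∑ k, p t k * p' t k * vv k * a k q.1 * a k q.2) := by fun_prop
    set BB := R / √n + √q * √R
    have hbd : ∀ q : (Fin n → ℝ) × (Fin n → ℝ), |∑ k, p t k * p' t k * vv k * a k q.1 * a k q.2| ≤ ∑ k, (vv k : ℝ) * BB * BB := by
      intro q
      refine (Finset.abs_sum_le_sum_abs _ _).trans (Finset.sum_le_sum fun k _ => ?_)
      rw [abs_mul, abs_mul, abs_mul, abs_mul]
      have h1 := hB k q.1; have h2 := hB k q.2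
      have h3 := (abs_nonneg _).trans h1
      have h4 := hp t k; have h5 := hp' t k
      have h6 : |(vv k:ℝ)| = vv k := abs_of_nonneg (vv k).2
      rw [h6]
      have h7 : |p t k| * |p' t k| ≤ 1 := mul_le_one₀ h4 (abs_nonneg _) h5
      have h8 : |p t k| * |p' t k| * (vv k:ℝ) ≤ vv k := by
        have := mul_le_mul_of_nonneg_right h7 (vv k).2; simpa using this
      gcongr
    have pt : ∀ g, -(Real.sin t * Real.cos t * (n * q ^ 2 / 2)) ≤ Gav (ν.prod ν) (fun q => Lf vv a (p t) g q.1 + Lf vv a (p t) g q.2) (fun q => ∑ k, p t k * p' t k * vv k * a k q.1 * a k q.2) := by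
      intro g
      have hLm := pair_meas (Lf_measurable' vv ha (p t) g)
      have hLb := pair_bdd (Lf_bdd vv hB (hp t) g)
      rw [← Gav_const (ν.prod ν) (Zpos (ν.prod ν) hLm hLb) (-(Real.sin t * Real.cos t * (n * q ^ 2 / 2)))]
      exact Gav_mono _ (integrable_mul_exp _ measurable_const hLm (fun _ => le_rfl) hLb) (integrable_mul_exp _ hm hLm hbd hLb) (ae_of_all _ fun q => key q.1 q.2)
    have hi : Integrable (fun g => Gav (ν.prod ν) (fun q => Lf vv a (p t) g q.1 + Lf vv a (p t) g q.2) (fun q => ∑ k, p t k * p' t k * vv k * a k q.1 * a k q.2)) (gpi vv) := by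
      refine Integrable.of_bound (Measurable.aestronglyMeasurable ?_) (∑ k, (vv k : ℝ) * BB * BB) (ae_of_all _ fun g => ?_)
      · refine measurable_Gav (ν.prod ν) (L := fun g q => Lf vv a (p t) g q.1 + Lf vv a (p t) g q.2) (f := fun _ q => ∑ k, p t k * p' t k * vv k * a k q.1 * a k q.2) ?_ ?_
        · have := Lf_measurable vv ha (p t)
          exact (this.comp (measurable_fst.prodMk (measurable_fst.comp measurable_snd))).add (this.comp (measurable_fst.prodMk (measurable_snd.comp measurable_snd)))
        · exact hm.comp measurable_snd
      · exact Gav_abs_le _ hm (pair_meas (Lf_measurable' vv ha (p t) g)) hbd (pair_bdd (Lf_bdd vv hB (hp t) g))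
    have := integral_mono (integrable_const _) hi pt
    simpa using this
  have anti : AntitoneOn (fun t => φ t - n * q ^ 2 / 4 * Real.sin t ^ 2) (Set.Icc 0 (Real.pi / 2)) := by
    have D2 : ∀ t, HasDerivAt (fun t => φ t - n * q ^ 2 / 4 * Real.sin t ^ 2) ((- ∑ k, p t k * p' t k * vv k * ∫ g, Gav ν (Lf vv a (p t) g) (a k) ^ 2 ∂gpi vv) - n * q ^ 2 / 4 * (2 * Real.sin t * Real.cos t)) t := by
      intro t
      have := ((Real.hasDerivAt_sin t).pow 2).const_mul (n * q ^ 2 / 4)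
      refine (D t).sub (this.congr_deriv ?_)
      simp
    refine antitoneOn_of_deriv_nonpos (convex_Icc _ _) (fun t _ => (D2 t).continuousAt.continuousWithinAt) (fun t _ => (D2 t).differentiableAt.differentiableWithinAt) ?_
    intro t ht
    rw [interior_Icc] at ht
    rw [(D2 t).deriv]
    have h0 : 0 ≤ Real.sin t * Real.cos t := mul_nonneg (Real.sin_nonneg_of_nonneg_of_le_pi ht.1.le (by linarith [ht.2, Real.pi_pos])) (Real.cos_nonneg_of_mem_Icc ⟨by linarith [ht.1, Real.pi_pos], ht.2.le⟩)
    have := Dle t h0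
    linarith
  have fin := anti (Set.left_mem_Icc.2 (by positivity)) (Set.right_mem_Icc.2 (by positivity)) (by positivity : (0:ℝ) ≤ Real.pi / 2)
  simp only [Real.sin_zero, Real.sin_pi_div_two] at fin
  have E1 : φ (Real.pi / 2) = ∫ g, Real.log (∫ x in ball n R, Real.exp (-(x ⬝ᵥ x) ^ 2 / (4 * n) + Jg n g x + w x) ∂gaussPrior n v) ∂gpi (vk n) := by
    rw [← gpi_inl (vk n) (fun _ : Fin n => (1:ℝ≥0)) (fun g => Real.log (∫ x in ball n R, Real.exp (-(x ⬝ᵥ x) ^ 2 / (4 * n) + Jg n g x + w x) ∂gaussPrior n v))]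
    refine integral_congr_ae (ae_of_all _ fun g => ?_)
    simp only
    congr 1
    rw [hν, nuW_integral n v R hw]
    refine setIntegral_congr_fun (ball_meas n R) fun x hx => ?_
    simp only [← Real.exp_add]
    congr 2
    unfold Lf
    rw [Fintype.sum_sum_type]
    simp only [p, vv, a, Sum.elim_inl, Sum.elim_inr, Tb_eq hx, Real.sin_pi_div_two, Real.cos_pi_div_two, Jg]
    have := ak_cov n x x
    rw [Finset.sum_sub_distrib]
    have e3 : ∑ k, 1 ^ 2 * (vk n k:ℝ) * ak n k x ^ 2 / 2 = (x ⬝ᵥ x) ^ 2 / (4 * n) := by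
      have : (x ⬝ᵥ x) ^ 2 / (4 * n) = ((x ⬝ᵥ x) ^ 2 / (2 * n)) / 2 := by field_simp; norm_num
      rw [this, ← ak_cov, Finset.sum_div]
      exact Finset.sum_congr rfl fun k _ => by ring
    rw [e3]
    simp
    ring
  have E2 : φ 0 = ∫ h, Real.log (∫ x in ball n R, Real.exp (√q * (h ⬝ᵥ x) - q * (x ⬝ᵥ x) / 2 + w x) ∂gaussPrior n v) ∂gpi (fun _ : Fin n => (1:ℝ≥0)) := by
    rw [← gpi_inr (vk n) (fun _ : Fin n => (1:ℝ≥0)) (fun h => Real.log (∫ x in ball n R, Real.exp (√q * (h ⬝ᵥ x) - q * (x ⬝ᵥ x) / 2 + w x) ∂gaussPrior n v))]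
    refine integral_congr_ae (ae_of_all _ fun g => ?_)
    simp only
    congr 1
    rw [hν, nuW_integral n v R hw]
    refine setIntegral_congr_fun (ball_meas n R) fun x hx => ?_
    simp only [← Real.exp_add]
    congr 2
    unfold Lf
    rw [Fintype.sum_sum_type]
    simp only [p, vv, a, Sum.elim_inl, Sum.elim_inr, Tb_eq hx, Real.sin_zero, Real.cos_zero]
    have : √q * √q = q := Real.mul_self_sqrt hq
    unfold dotProduct
    rw [Finset.mul_sum, Finset.mul_sum, Finset.sum_div, ← Finset.sum_sub_distrib]
    simp only [zero_mul, zero_pow two_ne_zero, zero_div, sub_zero, Finset.sum_const_zero, zero_add]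
    refine Finset.sum_congr rfl fun i _ => ?_
    push_cast
    linear_combination (-(x i ^ 2) / 2) * this
  rw [E1, E2] at fin
  linarith

end

end

section

open MeasureTheory ProbabilityTheory Filter Matrix
open scoped NNReal ENNReal
noncomputable section
set_option linter.unusedSectionVars false

theorem int4 {X : Type*} [MeasurableSpace X] (μ : Measure X) [IsProbabilityMeasure μ] {f g : X → ℝ} (hf : Integrable f μ) (hg : Integrable g μ) (a b : ℝ) :
    ∫ x, (a + f x - b + g x) ∂μ = a + ∫ x, f x ∂μ - b + ∫ x, g x ∂μ := by
  have e : ∀ x, a + f x - b + g x = (a - b) + (f x + g x) := fun x => by ring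
  simp_rw [e]
  have hfg : Integrable (fun x => f x + g x) μ := hf.add hg
  rw [integral_add (integrable_const _) hfg, integral_add hf hg]
  simp only [integral_const, probReal_univ, one_smul]; ring

theorem gint_full {n : ℕ} (hn : 0 < n) {c θ q : ℝ} (hc : 0 < c) (hθ : 0 ≤ θ) (hq : 0 ≤ q) (s h : Fin n → ℝ) (hD : θ * (s ⬝ᵥ s) / (n * (c + q)) < 1) :
    Integrable (fun x : Fin n → ℝ => Real.exp (√q * (h ⬝ᵥ x) - q * (x ⬝ᵥ x) / 2 + θ / (2 * n) * (s ⬝ᵥ x) ^ 2)) (gaussPrior n (1 / c)) ∧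
    Real.log (∫ x, Real.exp (√q * (h ⬝ᵥ x) - q * (x ⬝ᵥ x) / 2 + θ / (2 * n) * (s ⬝ᵥ x) ^ 2) ∂gaussPrior n (1 / c)) =
      -(n / 2 * Real.log (1 + q / c)) + q * (h ⬝ᵥ h) / (2 * (c + q)) - Real.log (1 - θ * (s ⬝ᵥ s) / (n * (c + q))) / 2 +
       q * θ / (n * (c + q) ^ 2 * (2 * (1 - θ * (s ⬝ᵥ s) / (n * (c + q))))) * (s ⬝ᵥ h) ^ 2 := by
  have hn' : (0:ℝ) < n := by exact_mod_cast hn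
  obtain ⟨D, hDdef⟩ : ∃ D, D = θ * (s ⬝ᵥ s) / (n * (c + q)) := ⟨_, rfl⟩
  rw [← hDdef] at hD ⊢
  have hcq : 0 < c + q := by linarith
  have hsn : √(θ / n) * √(θ / n) = θ / n := Real.mul_self_sqrt (by positivity)
  have hsq : √q * √q = q := Real.mul_self_sqrt hq
  obtain ⟨A, hA⟩ : ∃ A, A = (√(1 + q / c))⁻¹ ^ n * Real.exp (q * (h ⬝ᵥ h) / (2 * (c + q))) := ⟨_, rfl⟩
  have e0 : ∀ x : Fin n → ℝ, Real.exp (√q * (h ⬝ᵥ x) - q * (x ⬝ᵥ x) / 2 + θ / (2 * n) * (s ⬝ᵥ x) ^ 2) =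
      ∫ u, Real.exp ((√q • h + (√(θ / n) * u) • s) ⬝ᵥ x + (-q) * (x ⬝ᵥ x) / 2) ∂gaussianReal 0 1 := by
    intro x
    have := (gint 1 one_ne_zero (√(θ / n) * (s ⬝ᵥ x)) 0 (by simp)).2
    simp only [zero_mul, zero_div, add_zero, NNReal.coe_one, sub_zero, Real.sqrt_one, inv_one, one_mul, mul_one] at this
    rw [Real.exp_add, show θ / (2 * n) * (s ⬝ᵥ x) ^ 2 = (√(θ / n) * (s ⬝ᵥ x)) ^ 2 / 2 by
      rw [mul_pow, pow_two (√(θ / n)), hsn]; field_simp, ← this, ← integral_const_mul]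
    congr 1; ext u
    rw [← Real.exp_add, add_dotProduct, smul_dotProduct, smul_dotProduct, smul_eq_mul, smul_eq_mul]
    congr 1; ring
  have hk : (-q) * (1 / c) < 1 := by
    have : 0 ≤ q * (1 / c) := by positivity
    linarith
  have hvc : 0 < 1 / c := by positivity
  have e1 : ∀ u : ℝ, ∫ x, Real.exp ((√q • h + (√(θ / n) * u) • s) ⬝ᵥ x + (-q) * (x ⬝ᵥ x) / 2) ∂gaussPrior n (1 / c) =
      A * Real.exp ((√q * √(θ / n) * (s ⬝ᵥ h) / (c + q)) * u + D * u ^ 2 / 2) := by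
    intro u
    rw [(gint_pi (1 / c) hvc _ _ hk).2, hA, mul_assoc, ← Real.exp_add]
    congr 1
    · congr 3; ring
    · congr 1
      simp only [add_dotProduct, dotProduct_add, smul_dotProduct, dotProduct_smul, smul_eq_mul]
      rw [dotProduct_comm h s, hDdef]
      have h1 : 1 / c / (2 * (1 - -q * (1 / c))) = 1 / (2 * (c + q)) := by
        have : (1 - -q * (1 / c)) = (c + q) / c := by field_simp; ring
        rw [this]; field_simp
      rw [mul_div_assoc, h1]
      have h2 : θ * (s ⬝ᵥ s) / (n * (c + q)) = (θ / n) * (s ⬝ᵥ s) / (c + q) := by field_simp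
      rw [h2]
      rw [show 1 / (2 * (c + q)) = (c + q)⁻¹ / 2 by field_simp, show q * (h ⬝ᵥ h) / (2 * (c + q)) = q * (h ⬝ᵥ h) * (c + q)⁻¹ / 2 by field_simp]
      linear_combination ((h ⬝ᵥ h) * (c + q)⁻¹ / 2) * hsq + (u ^ 2 * (s ⬝ᵥ s) * (c + q)⁻¹ / 2) * hsn
  have hg := gint 1 one_ne_zero (√q * √(θ / n) * (s ⬝ᵥ h) / (c + q)) D (by simpa using hD)
  have hI : Integrable (fun p : ℝ × (Fin n → ℝ) => Real.exp ((√q • h + (√(θ / n) * p.1) • s) ⬝ᵥ p.2 + (-q) * (p.2 ⬝ᵥ p.2) / 2)) ((gaussianReal 0 1).prod (gaussPrior n (1 / c))) := by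
    have hm : Measurable (fun p : ℝ × (Fin n → ℝ) => Real.exp ((√q • h + (√(θ / n) * p.1) • s) ⬝ᵥ p.2 + (-q) * (p.2 ⬝ᵥ p.2) / 2)) := by
      simp only [dotProduct, Pi.add_apply, Pi.smul_apply, smul_eq_mul]; fun_prop
    refine (integrable_prod_iff hm.aestronglyMeasurable).2 ⟨ae_of_all _ fun u => ?_, ?_⟩
    · exact (gint_pi (1 / c) hvc (√q • h + (√(θ / n) * u) • s) (-q) hk).1
    · simp only [Real.norm_eq_abs, Real.abs_exp]
      simp_rw [e1]
      exact hg.1.const_mul _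
  constructor
  · simp_rw [e0]
    exact hI.integral_prod_right
  · simp_rw [e0]
    rw [integral_integral_swap (f := fun x u => Real.exp ((√q • h + (√(θ / n) * u) • s) ⬝ᵥ x + (-q) * (x ⬝ᵥ x) / 2)) hI.swap]
    simp_rw [e1]
    rw [integral_const_mul, hg.2, hA]
    have h1D : 0 < 1 - D := by linarith
    have hqc : 0 < 1 + q / c := by positivity
    have s1 : 0 < √(1 + q / c) := Real.sqrt_pos.2 hqc
    have s2 : 0 < √(1 - D) := Real.sqrt_pos.2 h1D
    simp only [NNReal.coe_one, mul_one]
    rw [Real.log_mul (by positivity) (by positivity), Real.log_mul (by positivity) (by positivity), Real.log_mul (by positivity) (by positivity), Real.log_exp, Real.log_exp, Real.log_pow, Real.log_inv, Real.log_inv, Real.log_sqrt hqc.le, Real.log_sqrt h1D.le]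
    have : (√q * √(θ / n) * (s ⬝ᵥ h) / (c + q)) ^ 2 / (2 * (1 - D)) = q * θ / (n * (c + q) ^ 2 * (2 * (1 - D))) * (s ⬝ᵥ h) ^ 2 := by
      rw [div_pow, mul_pow, mul_pow, Real.sq_sqrt hq, Real.sq_sqrt (by positivity)]
      field_simp
    rw [this]; ring

theorem gpi_one (n : ℕ) : gpi (fun _ : Fin n => (1:ℝ≥0)) = gaussPrior n 1 := by
  rw [gaussPrior_eq_gpi, Real.toNNReal_one]

theorem ball_pos {n : ℕ} (hn : 0 < n) {v R : ℝ} (hv : 0 < v) (hR : 2 * (n * v) ≤ R) : 0 < (gaussPrior n v).real (ball n R) := by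
  have hn' : (0:ℝ) < n := by exact_mod_cast hn
  have : 0 < 2 * (n * v) := by positivity
  have := prior_ball n hv hR (by linarith)
  have e : ball n R = {x | x ⬝ᵥ x ≤ R} := rfl
  rw [e]; linarith

theorem ubR {n : ℕ} (hn : 0 < n) {c θ q R : ℝ} (hc : 0 < c) (hθ : 0 ≤ θ) (hq : 0 ≤ q) (s : Fin n → ℝ) (hD : θ * (s ⬝ᵥ s) / (n * (c + q)) < 1)
    (hR : 2 * (n * (1 / c)) ≤ R) :
    ∫ g, Real.log (ZrB n c θ R s g) ∂gpi (vk n) ≤ n * q ^ 2 / 4 -(n / 2 * Real.log (1 + q / c)) + q * n / (2 * (c + q)) - Real.log (1 - θ * (s ⬝ᵥ s) / (n * (c + q))) / 2 +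
       q * θ / (n * (c + q) ^ 2 * (2 * (1 - θ * (s ⬝ᵥ s) / (n * (c + q))))) * (s ⬝ᵥ s) := by
  have hn' : (0:ℝ) < n := by exact_mod_cast hn
  have hvc : 0 < 1 / c := by positivity
  have hR0 : 0 ≤ R := le_trans (by positivity) hR
  have hP := ball_pos hn hvc hR
  set w : (Fin n → ℝ) → ℝ := fun x => θ / (2 * n) * (s ⬝ᵥ x) ^ 2 with hw_def
  have hw : Measurable w := by have := dot_meas s; fun_prop
  have hBw : ∀ x, |w (Tb n R x)| ≤ θ / (2 * n) * ((s ⬝ᵥ s) * R) := by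
    intro x
    have h1 := dot_cs s (Tb n R x)
    have h2 := mul_le_mul_of_nonneg_left (Tb_le hR0 x) (sq_nn s)
    rw [abs_of_nonneg (by positivity)]
    have : 0 ≤ θ / (2 * n) := by positivity
    exact mul_le_mul_of_nonneg_left (h1.trans h2) this
  have G := guerra hn (v := 1 / c) hR0 hq hw hBw hP
  have e : ∀ g, ZrB n c θ R s g = ∫ x in ball n R, Real.exp (-(x ⬝ᵥ x) ^ 2 / (4 * n) + Jg n g x + w x) ∂gaussPrior n (1 / c) := fun g => rfl
  simp_rw [e]
  refine G.trans ?_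
  haveI : IsFiniteMeasure (nuW n (1 / c) R w) := nuW_fin n (1 / c) R hw hBw
  haveI : NeZero (nuW n (1 / c) R w) := nuW_ne n hw hP
  have hI1 : Integrable (fun h => Real.log (∫ x in ball n R, Real.exp (√q * (h ⬝ᵥ x) - q * (x ⬝ᵥ x) / 2 + w x) ∂gaussPrior n (1 / c))) (gpi (fun _ : Fin n => (1:ℝ≥0))) := by
    have := integrable_logZ (nuW n (1 / c) R w) (fun _ : Fin n => (1:ℝ≥0)) (a := fun i x => √q * Tb n R x i) (fun i => ((measurable_pi_apply i).comp (Tb_meas n R)).const_mul _) (B := √q * √R) ?_ (p := fun _ => 1) (by simp)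
    · refine this.congr (ae_of_all _ fun g => ?_)
      simp only
      congr 1
      rw [nuW_integral n _ R hw]
      refine setIntegral_congr_fun (ball_meas n R) fun x hx => ?_
      simp only [← Real.exp_add]
      congr 2
      unfold Lf
      simp only [Tb_eq hx]
      have : √q * √q = q := Real.mul_self_sqrt hq
      unfold dotProduct
      rw [Finset.mul_sum, Finset.mul_sum, Finset.sum_div, ← Finset.sum_sub_distrib]
      refine Finset.sum_congr rfl fun i _ => ?_
      push_cast
      linear_combination (-(x i ^ 2) / 2) * this
    · intro i x
      rw [abs_mul, abs_of_nonneg (Real.sqrt_nonneg q)]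
      exact mul_le_mul_of_nonneg_left ((coord_abs_le (Tb n R x) i).trans (Real.sqrt_le_sqrt (Tb_le hR0 x))) (Real.sqrt_nonneg _)
  set C1 := q * θ / (n * (c + q) ^ 2 * (2 * (1 - θ * (s ⬝ᵥ s) / (n * (c + q))))) with hC1
  have i1 : Integrable (fun h : Fin n → ℝ => q * (h ⬝ᵥ h) / (2 * (c + q))) (gaussPrior n 1) := ((sq_int n 1).const_mul q).div_const _
  have i2 : Integrable (fun h : Fin n → ℝ => C1 * (s ⬝ᵥ h) ^ 2) (gaussPrior n 1) := by
    have := (dot2_int n 1 s s).const_mul C1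
    simpa only [pow_two] using this
  have hI2 : Integrable (fun h : Fin n → ℝ => -(n / 2 * Real.log (1 + q / c)) + q * (h ⬝ᵥ h) / (2 * (c + q)) - Real.log (1 - θ * (s ⬝ᵥ s) / (n * (c + q))) / 2 +
       C1 * (s ⬝ᵥ h) ^ 2) (gaussPrior n 1) :=
    (((integrable_const _).add i1).sub (integrable_const _)).add i2
  rw [gpi_one] at hI1 ⊢
  have hmono := integral_mono hI1 hI2 fun h => by
    have hf := gint_full hn hc hθ hq s h hD
    show _ ≤ _
    rw [← hf.2]
    refine Real.log_le_log ?_ (setIntegral_le_integral hf.1 (ae_of_all _ fun x => (Real.exp_pos _).le))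
    haveI : NeZero ((gaussPrior n (1 / c)).restrict (ball n R)) := by
      constructor; intro h0
      rw [Measure.restrict_eq_zero] at h0
      rw [Measure.real, h0] at hP; simp at hP
    exact integral_exp_pos hf.1.integrableOn
  rw [int4 _ i1 i2, integral_const_mul, integral_div, integral_const_mul, sq_mean n one_pos] at hmono
  have hm2 : ∫ a, (s ⬝ᵥ a) ^ 2 ∂gaussPrior n 1 = s ⬝ᵥ s := by
    have := mom2 n one_pos s s
    simpa [pow_two] using this
  rw [hm2] at hmono
  simp only [mul_one] at hmono
  linarith

theorem ub_fixed {n : ℕ} (hn : 0 < n) {c θ q : ℝ} (hc : 0 < c) (hθ : 0 ≤ θ) (hq : 0 ≤ q) (s : Fin n → ℝ) (hD : θ * (s ⬝ᵥ s) / (n * (c + q)) < 1) :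
    ∫ g, Real.log (Zr n c θ s g) ∂gpi (vk n) ≤ n * q ^ 2 / 4 -(n / 2 * Real.log (1 + q / c)) + q * n / (2 * (c + q)) - Real.log (1 - θ * (s ⬝ᵥ s) / (n * (c + q))) / 2 +
       q * θ / (n * (c + q) ^ 2 * (2 * (1 - θ * (s ⬝ᵥ s) / (n * (c + q))))) * (s ⬝ᵥ s) :=
  logZr_limit hn hc hθ s _ fun _ hR => ubR hn hc hθ hq s hD hR

end

end

section

open MeasureTheory ProbabilityTheory Filter Matrix
open scoped NNReal ENNReal
noncomputable section
set_option linter.unusedSectionVars false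

/-- replica-symmetric potential -/
def Ph (c w : ℝ) : ℝ := w ^ 2 / 4 - Real.log (1 + w / c) / 2 + w / (2 * (c + w))

theorem ub_point {n : ℕ} (hn : 0 < n) {c θ q0 ε : ℝ} (hc : 0 < c) (hθ : 0 ≤ θ) (hq0 : 0 ≤ q0) (hε : 0 < ε) (h : θ * (1 + ε) ≤ c + q0) (s : Fin n → ℝ) :
    ∫ g, Real.log (Zr n c θ s g) ∂gpi (vk n) ≤ n * Ph c q0 + n * ((q0 * θ / 2 + θ / (2 * c)) * |(s ⬝ᵥ s) / n - 1| + θ ^ 2 / 4 * ((s ⬝ᵥ s) / n - 1) ^ 2) + (1 / ε) * ((s ⬝ᵥ s) / n) + 1 / 2 := by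
  have hn' : (0:ℝ) < n := by exact_mod_cast hn
  obtain ⟨S, hS⟩ : ∃ S, S = (s ⬝ᵥ s) / n := ⟨_, rfl⟩
  have hS0 : 0 ≤ S := by rw [hS]; have := sq_nn s; positivity
  have hss : s ⬝ᵥ s = n * S := by rw [hS]; field_simp
  obtain ⟨e, he⟩ : ∃ e, e = |S - 1| := ⟨_, rfl⟩
  have he0 : 0 ≤ e := by rw [he]; positivity
  have he1 : S - 1 ≤ e := by rw [he]; exact le_abs_self _
  have he2 : (S - 1) ^ 2 = e ^ 2 := by rw [he, sq_abs]
  obtain ⟨q, hq⟩ : ∃ q, q = q0 + θ * e := ⟨_, rfl⟩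
  have hqq : 0 ≤ θ * e := by positivity
  have hq' : 0 ≤ q := by rw [hq]; positivity
  have hcq : 0 < c + q := by linarith
  have hk : θ * (S + ε) ≤ c + q := by rw [hq]; nlinarith
  have hSe : 0 < S + ε := by linarith
  obtain ⟨D, hD⟩ : ∃ D, D = θ * S / (c + q) := ⟨_, rfl⟩
  have hD0 : 0 ≤ D := by rw [hD]; positivity
  have hD1 : D ≤ S / (S + ε) := by
    rw [hD, div_le_div_iff₀ hcq hSe]; nlinarith
  have hD2 : ε / (S + ε) ≤ 1 - D := by
    have : ε / (S + ε) = 1 - S / (S + ε) := by field_simp; ring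
    linarith
  have hpos : 0 < ε / (S + ε) := by positivity
  have h1D : 0 < 1 - D := by linarith
  have hDe : θ * (s ⬝ᵥ s) / (n * (c + q)) = D := by rw [hss, hD]; field_simp
  have U := ub_fixed hn hc hθ hq' s (by rw [hDe]; linarith)
  rw [hDe] at U
  have t1 : -Real.log (1 - D) ≤ S / ε := by
    have h1 := Real.log_le_log hpos hD2
    rw [← inv_div, Real.log_inv] at h1
    have h2 := Real.log_le_sub_one_of_pos (show 0 < (S + ε) / ε by positivity)
    have h3 : (S + ε) / ε - 1 = S / ε := by field_simp; ring
    linarith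
  have t2 : q * θ / (n * (c + q) ^ 2 * (2 * (1 - D))) * (s ⬝ᵥ s) ≤ (S + ε) / (2 * ε) := by
    have e1 : q * θ / (n * (c + q) ^ 2 * (2 * (1 - D))) * (s ⬝ᵥ s) = (q / (c + q)) * D * (1 / (2 * (1 - D))) := by
      rw [hss]
      have : θ * S = D * (c + q) := by rw [hD]; field_simp
      field_simp
      linear_combination q * this
    rw [e1]
    have e2 : 1 / (2 * (1 - D)) ≤ (S + ε) / (2 * ε) := by
      rw [div_le_div_iff₀ (by positivity) (by positivity)]
      rw [div_le_iff₀ hSe] at hD2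
      nlinarith
    have e3 : q / (c + q) ≤ 1 := by rw [div_le_one hcq]; linarith
    have e4 : q / (c + q) * D ≤ 1 := mul_le_one₀ e3 hD0 (by linarith)
    have e5 : 0 ≤ 1 / (2 * (1 - D)) := by positivity
    calc _ ≤ 1 * (1 / (2 * (1 - D))) := by gcongr
      _ ≤ _ := by rw [one_mul]; exact e2
  have t3 : q ^ 2 / 4 - Real.log (1 + q / c) / 2 + q / (2 * (c + q)) ≤ Ph c q0 + (q0 * θ / 2 + θ / (2 * c)) * e + θ ^ 2 / 4 * e ^ 2 := by
    unfold Ph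
    have l : Real.log (1 + q0 / c) ≤ Real.log (1 + q / c) := by
      refine Real.log_le_log (by positivity) ?_
      have : q0 / c ≤ q / c := by gcongr; linarith
      linarith
    have m : q / (2 * (c + q)) ≤ q0 / (2 * (c + q0)) + θ / (2 * c) * e := by
      have hc0 : 0 < c + q0 := by linarith
      have e1 : q / (2 * (c + q)) - q0 / (2 * (c + q0)) = c * (θ * e) / (2 * ((c + q) * (c + q0))) := by
        rw [div_sub_div _ _ (by positivity) (by positivity), div_eq_div_iff (by positivity) (by positivity)]
        have : q = q0 + θ * e := hq
        rw [this]; ring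
      have e2 : c * (θ * e) / (2 * ((c + q) * (c + q0))) ≤ c * (θ * e) / (2 * (c * c)) := by
        gcongr <;> linarith
      have e3 : c * (θ * e) / (2 * (c * c)) = θ / (2 * c) * e := by field_simp
      linarith
    have : q ^ 2 / 4 = q0 ^ 2 / 4 + q0 * θ / 2 * e + θ ^ 2 / 4 * e ^ 2 := by rw [hq]; ring
    linarith
  rw [← hS, ← he, he2]
  have t4 := mul_le_mul_of_nonneg_left t3 hn'.le
  have t5 : (S + ε) / (2 * ε) = S / ε / 2 + 1 / 2 := by field_simp
  have t6 : 1 / ε * S = S / ε := by ring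
  have t7 : n * (q ^ 2 / 4 - Real.log (1 + q / c) / 2 + q / (2 * (c + q))) = n * q ^ 2 / 4 - n / 2 * Real.log (1 + q / c) + q * n / (2 * (c + q)) := by ring
  rw [t7] at t4
  rw [t6]
  linarith

theorem S_mean {n : ℕ} (hn : 0 < n) : Integrable (fun s : Fin n → ℝ => s ⬝ᵥ s / n) (gaussPrior n 1) ∧ ∫ s : Fin n → ℝ, s ⬝ᵥ s / n ∂gaussPrior n 1 = 1 := by
  have hn' : (n:ℝ) ≠ 0 := by exact_mod_cast hn.ne'
  refine ⟨(sq_int n 1).div_const _, ?_⟩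
  rw [integral_div, sq_mean n one_pos]; field_simp

theorem Fr_eq {n : ℕ} (hn : 0 < n) {c θ : ℝ} (hc : 0 < c) (hθ : 0 ≤ θ) :
    Fr n c θ = ∫ s, ∫ g, Real.log (Zr n c θ s g) ∂gpi (vk n) ∂gaussPrior n 1 := by
  unfold Fr
  exact integral_prod _ (logZr_int hn hc hθ)

theorem ub_asym {c θ q0 ε : ℝ} (hc : 0 < c) (hθ : 0 ≤ θ) (hq0 : 0 ≤ q0) (hε : 0 < ε) (h : θ * (1 + ε) ≤ c + q0) :
    ∃ C, ∀ n : ℕ, 0 < n → 1 / (n:ℝ) * Fr n c θ ≤ Ph c q0 + C / √n := by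
  set A := q0 * θ / 2 + θ / (2 * c) with hA
  have hA0 : 0 ≤ A := by positivity
  refine ⟨3 / 2 * A + (θ ^ 2 / 2 + 1 / ε + 1 / 2), fun n hn => ?_⟩
  have hn' : (0:ℝ) < n := by exact_mod_cast hn
  have hn1 : (1:ℝ) ≤ n := by exact_mod_cast hn
  obtain ⟨r, hr⟩ : ∃ r, r = √(n:ℝ) := ⟨_, rfl⟩
  have hr1 : 1 ≤ r := by rw [hr, Real.one_le_sqrt]; exact hn1
  have hrr : (n:ℝ) = r ^ 2 := by rw [hr, Real.sq_sqrt hn'.le]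
  rw [← hr]
  obtain ⟨hdi, hdm⟩ := dev_mean n hn one_pos
  obtain ⟨hsi, hsm⟩ := S_mean hn
  have hpt : ∀ s : Fin n → ℝ, ∫ g, Real.log (Zr n c θ s g) ∂gpi (vk n) ≤ (n * Ph c q0 + n * A / (2 * r) + 1 / 2) + ((n * A * r / 2 + n * θ ^ 2 / 4) * ((s ⬝ᵥ s) / n - 1) ^ 2 + (1 / ε) * ((s ⬝ᵥ s) / n)) := by
    intro s
    refine (ub_point hn hc hθ hq0 hε h s).trans ?_
    have h1 : |(s ⬝ᵥ s) / n - 1| ≤ r * ((s ⬝ᵥ s) / n - 1) ^ 2 / 2 + 1 / (2 * r) := by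
      rw [← sq_abs]
      generalize |(s ⬝ᵥ s) / n - 1| = e
      have : r * e ^ 2 / 2 + 1 / (2 * r) - e = (r * e - 1) ^ 2 / (2 * r) := by field_simp; ring
      have h2 : 0 ≤ (r * e - 1) ^ 2 / (2 * r) := by positivity
      linarith
    have h2 := mul_le_mul_of_nonneg_left h1 (by positivity : 0 ≤ n * A)
    have h3 : n * A * (r * ((s ⬝ᵥ s) / n - 1) ^ 2 / 2 + 1 / (2 * r)) = n * A * r / 2 * ((s ⬝ᵥ s) / n - 1) ^ 2 + n * A / (2 * r) := by ring
    rw [h3] at h2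
    rw [← hA]
    have h4 : n * (A * |(s ⬝ᵥ s) / n - 1| + θ ^ 2 / 4 * ((s ⬝ᵥ s) / n - 1) ^ 2) = n * A * |(s ⬝ᵥ s) / n - 1| + n * θ ^ 2 / 4 * ((s ⬝ᵥ s) / n - 1) ^ 2 := by ring
    have h5 : (n * A * r / 2 + n * θ ^ 2 / 4) * ((s ⬝ᵥ s) / n - 1) ^ 2 = n * A * r / 2 * ((s ⬝ᵥ s) / n - 1) ^ 2 + n * θ ^ 2 / 4 * ((s ⬝ᵥ s) / n - 1) ^ 2 := by ring
    linarith
  have i1 : Integrable (fun s : Fin n → ℝ => (n * A * r / 2 + n * θ ^ 2 / 4) * ((s ⬝ᵥ s) / n - 1) ^ 2) (gaussPrior n 1) := hdi.const_mul _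
  have i2 : Integrable (fun s : Fin n → ℝ => (1 / ε) * ((s ⬝ᵥ s) / n)) (gaussPrior n 1) := hsi.const_mul _
  have i3 : Integrable (fun s : Fin n → ℝ => (n * A * r / 2 + n * θ ^ 2 / 4) * ((s ⬝ᵥ s) / n - 1) ^ 2 + (1 / ε) * ((s ⬝ᵥ s) / n)) (gaussPrior n 1) := i1.add i2
  have hm := integral_mono (logZr_int hn hc hθ).integral_prod_left ((integrable_const _).add i3) hpt
  simp only [Pi.add_apply] at hm
  rw [integral_add (integrable_const _) i3, integral_add i1 i2, integral_const_mul, integral_const_mul, hdm, hsm] at hm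
  simp only [integral_const, probReal_univ, one_smul] at hm
  have hF : Fr n c θ ≤ n * Ph c q0 + n * A / (2 * r) + 1 / 2 + ((n * A * r / 2 + n * θ ^ 2 / 4) * (2 * 1 ^ 2 / n) + 1 / ε * 1) := by
    rw [Fr_eq hn hc hθ]; exact hm
  have h4 : 1 / (n:ℝ) * Fr n c θ ≤ 1 / (n:ℝ) * (n * Ph c q0 + n * A / (2 * r) + 1 / 2 + ((n * A * r / 2 + n * θ ^ 2 / 4) * (2 * 1 ^ 2 / n) + 1 / ε * 1)) := by gcongr
  refine h4.trans ?_
  have h5 : 1 / (n:ℝ) * (n * Ph c q0 + n * A / (2 * r) + 1 / 2 + ((n * A * r / 2 + n * θ ^ 2 / 4) * (2 * 1 ^ 2 / n) + 1 / ε * 1)) = Ph c q0 + 3 / 2 * A / r + (θ ^ 2 / 2 + 1 / ε + 1 / 2) / r ^ 2 := by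
    rw [hrr]; field_simp; ring
  rw [h5]
  have h6 : (θ ^ 2 / 2 + 1 / ε + 1 / 2) / r ^ 2 ≤ (θ ^ 2 / 2 + 1 / ε + 1 / 2) / r := by
    refine div_le_div_of_nonneg_left (by positivity) (by positivity) ?_
    nlinarith
  have h7 : (3 / 2 * A + (θ ^ 2 / 2 + 1 / ε + 1 / 2)) / r = 3 / 2 * A / r + (θ ^ 2 / 2 + 1 / ε + 1 / 2) / r := add_div _ _ _
  rw [h7]; linarith

/-- `limsup (1/n) Fr ≤ Φ(q0)` in ε-form -/
theorem ub_eps {c θ q0 : ℝ} (hc : 0 < c) (hθ : 0 ≤ θ) (hq0 : 0 ≤ q0) (h : θ < c + q0) {η : ℝ} (hη : 0 < η) :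
    ∀ᶠ n : ℕ in atTop, 1 / (n:ℝ) * Fr n c θ ≤ Ph c q0 + η := by
  obtain ⟨ε, hε, hε2⟩ : ∃ ε, 0 < ε ∧ θ * (1 + ε) ≤ c + q0 := by
    refine ⟨(c + q0 - θ) / (θ + 1), by have : 0 < c + q0 - θ := by linarith
                                       positivity, ?_⟩
    have : θ * ((c + q0 - θ) / (θ + 1)) ≤ c + q0 - θ := by
      rw [← mul_div_assoc, div_le_iff₀ (by positivity)]; nlinarith
    linarith
  obtain ⟨C, hC⟩ := ub_asym hc hθ hq0 hε hε2
  have hl : Tendsto (fun n : ℕ => C / √(n:ℝ)) atTop (nhds 0) := by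
    refine Tendsto.div_atTop tendsto_const_nhds ?_
    exact (Real.tendsto_sqrt_atTop).comp tendsto_natCast_atTop_atTop
  filter_upwards [hl.eventually (gt_mem_nhds hη), eventually_gt_atTop 0] with n h1 h2
  have := hC n h2; linarith

end

end

section

open MeasureTheory ProbabilityTheory Filter Matrix
open scoped NNReal ENNReal
noncomputable section
set_option linter.unusedSectionVars false

section sm
variable {X : Type*} [MeasurableSpace X] {K : Type*} [Fintype K] [DecidableEq K]

theorem int_mono2 {μ : Measure X} {f1 f2 g1 g2 : X → ℝ} (h1 : Integrable f1 μ) (h2 : Integrable f2 μ) (h3 : Integrable g1 μ) (h4 : Integrable g2 μ)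
    (h : ∀ x, f1 x + f2 x ≤ g1 x + g2 x) : ∫ x, f1 x ∂μ + ∫ x, f2 x ∂μ ≤ ∫ x, g1 x ∂μ + ∫ x, g2 x ∂μ := by
  rw [← integral_add h1 h2, ← integral_add h3 h4]
  exact integral_mono (h1.add h2) (h3.add h4) h

/-- Gibbs variational (Jensen) inequality, general integrability -/
theorem gibbs' (ν : Measure X) {L f : X → ℝ} (hp : 0 < ∫ x, Real.exp (L x) ∂ν) (h1 : Integrable (fun x => Real.exp (L x)) ν)
    (h2 : Integrable (fun x => f x * Real.exp (L x)) ν) (h3 : Integrable (fun x => Real.exp (f x + L x)) ν) :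
    Real.log (∫ x, Real.exp (L x) ∂ν) + Gav ν L f ≤ Real.log (∫ x, Real.exp (f x + L x) ∂ν) := by
  obtain ⟨m, hm⟩ : ∃ m, m = Gav ν L f := ⟨_, rfl⟩
  have hm2 : ∫ x, f x * Real.exp (L x) ∂ν = m * ∫ x, Real.exp (L x) ∂ν := by
    rw [hm]; unfold Gav; field_simp
  have i0 : Integrable (fun x => Real.exp m * ((1 - m) * Real.exp (L x) + f x * Real.exp (L x))) ν := ((h1.const_mul (1 - m)).add h2).const_mul _
  have key : ∫ x, Real.exp m * ((1 - m) * Real.exp (L x) + f x * Real.exp (L x)) ∂ν ≤ ∫ x, Real.exp (f x + L x) ∂ν := by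
    refine integral_mono i0 h3 fun x => ?_
    have e1 : Real.exp (f x + L x) = Real.exp m * (Real.exp (f x - m) * Real.exp (L x)) := by
      rw [← Real.exp_add, ← Real.exp_add]; congr 1; ring
    simp only
    rw [e1]
    have := Real.add_one_le_exp (f x - m)
    have hL := Real.exp_pos (L x)
    have hh := Real.exp_pos m
    refine mul_le_mul_of_nonneg_left ?_ hh.le
    nlinarith
  rw [integral_const_mul, integral_add (h1.const_mul (1 - m)) h2, integral_const_mul, hm2] at key
  have e2 : Real.exp m * ((1 - m) * ∫ x, Real.exp (L x) ∂ν + m * ∫ x, Real.exp (L x) ∂ν) = (∫ x, Real.exp (L x) ∂ν) * Real.exp m := by ring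
  have e3 : Real.exp m * ((1 - m) * (∫ x, Real.exp (L x) ∂ν) + m * ∫ x, Real.exp (L x) ∂ν) = (∫ x, Real.exp (L x) ∂ν) * Real.exp m := by ring
  rw [e3] at key
  have := Real.log_le_log (by positivity) key
  rw [Real.log_mul hp.ne' (Real.exp_pos _).ne', Real.log_exp] at this
  rw [← hm]; exact this

theorem gibbs (ν : Measure X) [IsFiniteMeasure ν] [NeZero ν] {L f : X → ℝ} (hL : Measurable L) (hf : Measurable f)
    {BL B : ℝ} (hBL : ∀ x, |L x| ≤ BL) (hB : ∀ x, |f x| ≤ B) :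
    Real.log (∫ x, Real.exp (L x) ∂ν) + Gav ν L f ≤ Real.log (∫ x, Real.exp (f x + L x) ∂ν) := by
  refine gibbs' ν (Zpos ν hL hBL) (integrable_exp_bdd ν hL hBL) (integrable_mul_exp ν hf hL hB hBL) ?_
  refine integrable_exp_bdd ν (hf.add hL) (BL := B + BL) fun x => ?_
  exact (abs_add_le _ _).trans (add_le_add (hB x) (hBL x))

theorem pair_mgf (v : K → ℝ≥0) (hv : ∀ k, v k ≠ 0) (a : K → X → ℝ) (p : ℝ) (x y : X) :
    Integrable (fun g => Real.exp (Lf v a (fun _ => p) g x + Lf v a (fun _ => p) g y)) (gpi v) ∧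
    ∫ g, Real.exp (Lf v a (fun _ => p) g x + Lf v a (fun _ => p) g y) ∂gpi v = Real.exp (p ^ 2 * ∑ k, v k * a k x * a k y) := by
  have e0 : ∀ g : K → ℝ, Real.exp (Lf v a (fun _ => p) g x + Lf v a (fun _ => p) g y) =
      ∏ k, (Real.exp ((p * (a k x + a k y)) * g k + 0 * (g k) ^ 2 / 2) * Real.exp (-(p ^ 2 * v k * ((a k x) ^ 2 + (a k y) ^ 2) / 2))) := by
    intro g
    simp_rw [← Real.exp_add]
    rw [← Real.exp_sum]
    unfold Lf
    rw [← Finset.sum_add_distrib]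
    congr 1
    refine Finset.sum_congr rfl fun k _ => by ring
  simp_rw [e0]
  have hk := fun k => gint (v k) (hv k) (p * (a k x + a k y)) 0 (by simp)
  constructor
  · unfold gpi
    exact Integrable.fintype_prod (f := fun k t => (Real.exp ((p * (a k x + a k y)) * t + 0 * t ^ 2 / 2) * Real.exp (-(p ^ 2 * v k * ((a k x) ^ 2 + (a k y) ^ 2) / 2)))) fun k => (hk k).1.mul_const _
  · unfold gpi
    rw [integral_fintype_prod_eq_prod (f := fun k t => (Real.exp ((p * (a k x + a k y)) * t + 0 * t ^ 2 / 2) * Real.exp (-(p ^ 2 * v k * ((a k x) ^ 2 + (a k y) ^ 2) / 2))))]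
    rw [Finset.mul_sum, Real.exp_sum]
    refine Finset.prod_congr rfl fun k _ => ?_
    rw [integral_mul_const, (hk k).2]
    simp only [zero_mul, sub_zero, Real.sqrt_one, inv_one, one_mul, mul_one]
    rw [← Real.exp_add]
    congr 1; ring

theorem pair_jensen (ν : Measure X) [IsFiniteMeasure ν] [NeZero ν] (v : K → ℝ≥0) (hv : ∀ k, v k ≠ 0) {a : K → X → ℝ}
    (ha : ∀ k, Measurable (a k)) {B : ℝ} (hB : ∀ k x, |a k x| ≤ B) {p : ℝ} (hp : |p| ≤ 1)
    (hQ : ∀ x y, 0 ≤ ∑ k, v k * a k x * a k y) {μ C : ℝ} (hμ : 1 < μ)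
    (hC : ∫ q : X × X, Real.exp (μ * ∑ k, v k * a k q.1 * a k q.2) ∂ν.prod ν ≤ C) :
    (μ - 1) * ∫ g, Gav (ν.prod ν) (fun q => Lf v a (fun _ => p) g q.1 + Lf v a (fun _ => p) g q.2) (fun q => ∑ k, v k * a k q.1 * a k q.2) ∂gpi v
      ≤ Real.log C - 2 * ∫ g, Real.log (∫ x, Real.exp (Lf v a (fun _ => p) g x) ∂ν) ∂gpi v := by
  have hp' : ∀ k : K, |(fun _ => p) k| ≤ 1 := fun _ => hp
  obtain ⟨Q, hQd⟩ : ∃ Q : X × X → ℝ, Q = fun q => ∑ k, v k * a k q.1 * a k q.2 := ⟨_, rfl⟩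
  have hQm : Measurable Q := by rw [hQd]; fun_prop
  have hQ0 : ∀ q, 0 ≤ Q q := fun q => by rw [hQd]; exact hQ _ _
  obtain ⟨BQ, hBQ⟩ : ∃ BQ, ∀ q, |Q q| ≤ BQ := by
    refine ⟨∑ k, (v k : ℝ) * B * B, fun q => ?_⟩
    rw [hQd]
    refine (Finset.abs_sum_le_sum_abs _ _).trans (Finset.sum_le_sum fun k _ => ?_)
    rw [abs_mul, abs_mul]
    have h1 := hB k q.1; have h2 := hB k q.2
    have h3 := (abs_nonneg _).trans h1
    have h6 : |(v k:ℝ)| = v k := abs_of_nonneg (v k).2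
    rw [h6]
    gcongr
  have hCp : 0 < C := by
    refine lt_of_lt_of_le ?_ hC
    refine Zpos (ν.prod ν) (L := fun q => μ * ∑ k, v k * a k q.1 * a k q.2) (by fun_prop) (BL := |μ| * BQ) fun q => ?_
    have := hBQ q
    rw [hQd] at this
    rw [abs_mul]; gcongr
  have hQd' : ∀ q : X × X, ∑ k, v k * a k q.1 * a k q.2 = Q q := fun q => by rw [hQd]
  simp only [hQd'] at hC ⊢
  obtain ⟨L, hLd⟩ : ∃ L : (K → ℝ) → X → ℝ, L = fun g => Lf v a (fun _ => p) g := ⟨_, rfl⟩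
  have hL2 : Measurable (Function.uncurry L) := by rw [hLd]; exact Lf_measurable v ha _
  have hLm : ∀ g, Measurable (L g) := fun g => by rw [hLd]; exact Lf_measurable' v ha _ g
  have hLb : ∀ g x, |L g x| ≤ Mf v B g := fun g x => by rw [hLd]; exact Lf_bdd v hB hp' g x
  have hmgf := pair_mgf v hv a p
  have hlZ := integrable_logZ ν v ha hB hp'
  have hLd' : ∀ g x, Lf v a (fun _ => p) g x = L g x := fun g x => by rw [hLd]
  simp only [hLd'] at hmgf hlZ ⊢
  have hPm : Measurable (Function.uncurry fun (g : K → ℝ) (q : X × X) => L g q.1 + L g q.2) :=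
    (hL2.comp (measurable_fst.prodMk (measurable_fst.comp measurable_snd))).add (hL2.comp (measurable_fst.prodMk (measurable_snd.comp measurable_snd)))
  -- W
  have hWm : Measurable (Function.uncurry fun (g : K → ℝ) (q : X × X) => (μ - 1) * Q q + (L g q.1 + L g q.2)) :=
    ((hQm.comp measurable_snd).const_mul _).add hPm
  have inner : ∀ q : X × X, ∫ g, Real.exp ((μ - 1) * Q q + (L g q.1 + L g q.2)) ∂gpi v = Real.exp ((μ - 1 + p ^ 2) * Q q) := by
    intro q
    simp_rw [Real.exp_add ((μ - 1) * Q q)]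
    rw [integral_const_mul, (hmgf q.1 q.2).2, ← Real.exp_add, ← hQd']
    congr 1; ring
  have hI : Integrable (fun r : (K → ℝ) × (X × X) => Real.exp ((μ - 1) * Q r.2 + (L r.1 r.2.1 + L r.1 r.2.2))) ((gpi v).prod (ν.prod ν)) := by
    have hWs : AEStronglyMeasurable (fun r : (K → ℝ) × (X × X) => Real.exp ((μ - 1) * Q r.2 + (L r.1 r.2.1 + L r.1 r.2.2))) ((gpi v).prod (ν.prod ν)) := hWm.exp.aestronglyMeasurable
    rw [integrable_prod_iff' hWs]
    constructor
    · refine ae_of_all _ fun q => ?_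
      simp_rw [Real.exp_add ((μ - 1) * Q q)]
      exact (hmgf q.1 q.2).1.const_mul _
    · simp only [Real.norm_eq_abs, abs_of_pos (Real.exp_pos _)]
      simp_rw [inner]
      refine integrable_exp_bdd _ (hQm.const_mul _) (BL := |μ - 1 + p ^ 2| * BQ) fun q => ?_
      rw [abs_mul]; have := hBQ q; gcongr
  have hEW : ∫ g, ∫ q, Real.exp ((μ - 1) * Q q + (L g q.1 + L g q.2)) ∂ν.prod ν ∂gpi v ≤ C := by
    rw [integral_integral_swap hI]
    simp_rw [inner]
    refine le_trans ?_ hC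
    refine integral_mono ?_ ?_ fun q => ?_
    · refine integrable_exp_bdd _ (hQm.const_mul _) (BL := |μ - 1 + p ^ 2| * BQ) fun q => ?_
      rw [abs_mul]; have := hBQ q; gcongr
    · refine integrable_exp_bdd _ (hQm.const_mul _) (BL := |μ| * BQ) fun q => ?_
      rw [abs_mul]; have := hBQ q; gcongr
    · refine Real.exp_le_exp.2 (mul_le_mul_of_nonneg_right ?_ (hQ0 q))
      have := (sq_le_one_iff_abs_le_one p).2 hp
      linarith
  have hpt : ∀ g, 2 * Real.log (∫ x, Real.exp (L g x) ∂ν) + (μ - 1) * Gav (ν.prod ν) (fun q => L g q.1 + L g q.2) Q ≤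
      (Real.log C - 1) + (1 / C) * ∫ q, Real.exp ((μ - 1) * Q q + (L g q.1 + L g q.2)) ∂ν.prod ν := by
    intro g
    have h1 := gibbs (ν.prod ν) (L := fun q => L g q.1 + L g q.2) (f := fun q => (μ - 1) * Q q) (pair_meas (hLm g)) (hQm.const_mul _)
      (pair_bdd (hLb g)) (B := |μ - 1| * BQ) (fun q => by rw [abs_mul]; have := hBQ q; gcongr)
    have h2 : ∫ q : X × X, Real.exp (L g q.1 + L g q.2) ∂ν.prod ν = (∫ x, Real.exp (L g x) ∂ν) * ∫ x, Real.exp (L g x) ∂ν := by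
      simp_rw [Real.exp_add]; rw [← integral_prod_mul]
    have hZ := Zpos ν (hLm g) (hLb g)
    rw [h2, Real.log_mul hZ.ne' hZ.ne', Gav_const_mul] at h1
    have hWp : 0 < ∫ q, Real.exp ((μ - 1) * Q q + (L g q.1 + L g q.2)) ∂ν.prod ν := by
      refine Zpos (ν.prod ν) (hWm.of_uncurry_left (x := g)) (BL := |μ - 1| * BQ + 2 * Mf v B g) fun q => ?_
      refine (abs_add_le _ _).trans (add_le_add ?_ (pair_bdd (hLb g) q))
      rw [abs_mul]; have := hBQ q; gcongr
    have h3 := Real.log_le_sub_one_of_pos (div_pos hWp hCp)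
    rw [Real.log_div hWp.ne' hCp.ne', div_eq_mul_one_div, mul_comm _ (1 / C)] at h3
    linarith
  have i1 : Integrable (fun g => (μ - 1) * Gav (ν.prod ν) (fun q => L g q.1 + L g q.2) Q) (gpi v) := by
    refine Integrable.const_mul ?_ _
    refine Integrable.of_bound (measurable_Gav (ν.prod ν) hPm (f := fun _ => Q) (hQm.comp measurable_snd)).aestronglyMeasurable BQ (ae_of_all _ fun g => ?_)
    exact Gav_abs_le _ hQm (pair_meas (hLm g)) hBQ (pair_bdd (hLb g))
  have i2 : Integrable (fun g => 2 * Real.log (∫ x, Real.exp (L g x) ∂ν)) (gpi v) := hlZ.const_mul _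
  have i3 : Integrable (fun g => (1 / C) * ∫ q, Real.exp ((μ - 1) * Q q + (L g q.1 + L g q.2)) ∂ν.prod ν) (gpi v) :=
    hI.integral_prod_left.const_mul _
  have := int_mono2 i2 i1 (integrable_const (Real.log C - 1)) i3 hpt
  rw [integral_const_mul, integral_const_mul, integral_const_mul, integral_const] at this
  haveI hpm : IsProbabilityMeasure (gpi v) := by unfold gpi; infer_instance
  simp only [probReal_univ, one_smul] at this
  have h5 : 1 / C * ∫ g, ∫ q, Real.exp ((μ - 1) * Q q + (L g q.1 + L g q.2)) ∂ν.prod ν ∂gpi v ≤ 1 := by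
    rw [one_div, inv_mul_le_iff₀ hCp, mul_one]; exact hEW
  linarith

theorem second_moment (ν : Measure X) [IsFiniteMeasure ν] [NeZero ν] (v : K → ℝ≥0) (hv : ∀ k, v k ≠ 0) {a : K → X → ℝ}
    (ha : ∀ k, Measurable (a k)) {B : ℝ} (hB : ∀ k x, |a k x| ≤ B)
    (hQ : ∀ x y, 0 ≤ ∑ k, v k * a k x * a k y) {μ C : ℝ} (hμ : 1 < μ)
    (hC : ∫ q : X × X, Real.exp (μ * ∑ k, v k * a k q.1 * a k q.2) ∂ν.prod ν ≤ C) :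
    (Real.log C - (Real.log C - 2 * Real.log (ν.real Set.univ)) * Real.exp (1 / (μ - 1))) / 2 ≤ ∫ g, Real.log (∫ x, Real.exp (Lf v a (fun _ => 1) g x) ∂ν) ∂gpi v ∧
    ∫ g, Gav (ν.prod ν) (fun q => Lf v a (fun _ => 1) g q.1 + Lf v a (fun _ => 1) g q.2) (fun q => ∑ k, v k * a k q.1 * a k q.2) ∂gpi v
      ≤ (Real.log C - 2 * Real.log (ν.real Set.univ)) * Real.exp (1 / (μ - 1)) / (μ - 1) := by
  have hμ1 : 0 < μ - 1 := by linarith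
  have PJ := fun t => pair_jensen ν v hv ha hB (Real.abs_sin_le_one t) hQ hμ hC
  have hp : ∀ (t : ℝ) (k : K), |(fun t _ => Real.sin t : ℝ → K → ℝ) t k| ≤ 1 := fun t k => Real.abs_sin_le_one t
  have D := fun t => interp ν v hv ha hB (p := fun t _ => Real.sin t) (p' := fun t _ => Real.cos t) hp
    (fun t k => Real.abs_cos_le_one t) (fun t k => Real.hasDerivAt_sin t) t
  obtain ⟨φ, hφ⟩ : ∃ φ : ℝ → ℝ, φ = fun t => ∫ g, Real.log (∫ x, Real.exp (Lf v a (fun _ => Real.sin t) g x) ∂ν) ∂gpi v := ⟨_, rfl⟩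
  obtain ⟨ψ, hψ⟩ : ∃ ψ : ℝ → ℝ, ψ = fun t => ∫ g, Gav (ν.prod ν) (fun q => Lf v a (fun _ => Real.sin t) g q.1 + Lf v a (fun _ => Real.sin t) g q.2) (fun q => ∑ k, v k * a k q.1 * a k q.2) ∂gpi v := ⟨_, rfl⟩
  have PJ' : ∀ t, (μ - 1) * ψ t ≤ Real.log C - 2 * φ t := fun t => by rw [hψ, hφ]; exact PJ t
  have D' : ∀ t, HasDerivAt φ (-(Real.sin t * Real.cos t * ψ t)) t := by
    intro t
    rw [hφ]
    refine (D t).congr_deriv ?_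
    rw [hψ]
    simp only
    rw [← sum_Gav_sq_int ν v ha hB (p := fun _ => Real.sin t) (fun k => Real.abs_sin_le_one t) (fun k => (v k:ℝ)), Finset.mul_sum]
    congr 1
    refine Finset.sum_congr rfl fun k _ => by ring
  have anti : AntitoneOn (fun t => (Real.log C - 2 * φ t) * Real.exp (-(Real.sin t ^ 2 / (μ - 1)))) (Set.Icc 0 (Real.pi / 2)) := by
    have D2 : ∀ t, HasDerivAt (fun t => (Real.log C - 2 * φ t) * Real.exp (-(Real.sin t ^ 2 / (μ - 1))))
        ((2 * (Real.sin t * Real.cos t * ψ t)) * Real.exp (-(Real.sin t ^ 2 / (μ - 1))) + (Real.log C - 2 * φ t) * (Real.exp (-(Real.sin t ^ 2 / (μ - 1))) * (-(2 * Real.sin t * Real.cos t / (μ - 1))))) t := by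
      intro t
      have h1 := (((Real.hasDerivAt_sin t).pow 2).div_const (μ - 1)).neg.exp
      have h2 := ((D' t).const_mul 2).const_sub (Real.log C)
      refine (h2.mul h1).congr_deriv ?_
      simp
    refine antitoneOn_of_deriv_nonpos (convex_Icc _ _) (fun t _ => (D2 t).continuousAt.continuousWithinAt) (fun t _ => (D2 t).differentiableAt.differentiableWithinAt) ?_
    intro t ht
    rw [interior_Icc] at ht
    rw [(D2 t).deriv]
    have h0 : 0 ≤ Real.sin t * Real.cos t := mul_nonneg (Real.sin_nonneg_of_nonneg_of_le_pi ht.1.le (by linarith [ht.2, Real.pi_pos])) (Real.cos_nonneg_of_mem_Icc ⟨by linarith [ht.1, Real.pi_pos], ht.2.le⟩)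
    have h1 : ψ t ≤ (Real.log C - 2 * φ t) / (μ - 1) := by rw [le_div_iff₀ hμ1]; linarith [PJ' t]
    have h2 := mul_le_mul_of_nonneg_left h1 (mul_nonneg (mul_nonneg zero_le_two h0) (Real.exp_pos (-(Real.sin t ^ 2 / (μ - 1)))).le)
    have e1 : (Real.log C - 2 * φ t) * (Real.exp (-(Real.sin t ^ 2 / (μ - 1))) * (-(2 * Real.sin t * Real.cos t / (μ - 1)))) = -(2 * (Real.sin t * Real.cos t) * Real.exp (-(Real.sin t ^ 2 / (μ - 1))) * ((Real.log C - 2 * φ t) / (μ - 1))) := by ring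
    rw [e1]; linarith
  have fin := anti (Set.left_mem_Icc.2 (by positivity)) (Set.right_mem_Icc.2 (by positivity)) (by positivity : (0:ℝ) ≤ Real.pi / 2)
  simp only [Real.sin_zero, Real.sin_pi_div_two] at fin
  have h0 : φ 0 = Real.log (ν.real Set.univ) := by
    rw [hφ]
    haveI : IsProbabilityMeasure (gpi v) := by unfold gpi; infer_instance
    simp [Lf]
  rw [h0] at fin
  have hψ1 := PJ' (Real.pi / 2)
  have e1 : φ (Real.pi / 2) = ∫ g, Real.log (∫ x, Real.exp (Lf v a (fun _ => 1) g x) ∂ν) ∂gpi v := by rw [hφ]; simp only [Real.sin_pi_div_two]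
  have e2 : ψ (Real.pi / 2) = ∫ g, Gav (ν.prod ν) (fun q => Lf v a (fun _ => 1) g q.1 + Lf v a (fun _ => 1) g q.2) (fun q => ∑ k, v k * a k q.1 * a k q.2) ∂gpi v := by rw [hψ]; simp only [Real.sin_pi_div_two]
  rw [← e1, ← e2]
  have h3 : Real.log C - 2 * φ (Real.pi / 2) ≤ (Real.log C - 2 * Real.log (ν.real Set.univ)) * Real.exp (1 / (μ - 1)) := by
    have : Real.exp (-(1 ^ 2 / (μ - 1))) = (Real.exp (1 / (μ - 1)))⁻¹ := by rw [← Real.exp_neg]; congr 1; ring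
    rw [this, ← div_eq_mul_inv, div_le_iff₀ (Real.exp_pos _)] at fin
    simpa using fin
  constructor
  · linarith
  · rw [le_div_iff₀ hμ1]; linarith

end sm
end

end

section

open MeasureTheory ProbabilityTheory Filter Matrix
open scoped NNReal ENNReal
noncomputable section
set_option linter.unusedSectionVars false

section sm
variable {X : Type*} [MeasurableSpace X] {K : Type*} [Fintype K] [DecidableEq K]

theorem single_mgf {X : Type*} (v : K → ℝ≥0) (hv : ∀ k, v k ≠ 0) (a : K → X → ℝ) (p : ℝ) (x : X) :
    Integrable (fun g => Real.exp (Lf v a (fun _ => p) g x)) (gpi v) ∧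
    ∫ g, Real.exp (Lf v a (fun _ => p) g x) ∂gpi v = 1 := by
  letI : MeasurableSpace (Option X) := ⊤
  have h := pair_mgf v hv (fun k (o : Option X) => o.elim 0 (a k)) p (some x) none
  have e1 : ∀ g, Lf v (fun k (o : Option X) => o.elim 0 (a k)) (fun _ => p) g none = 0 := fun g => by simp [Lf]
  have e2 : ∀ g, Lf v (fun k (o : Option X) => o.elim 0 (a k)) (fun _ => p) g (some x) = Lf v a (fun _ => p) g x := fun g => by simp [Lf]
  simp only [e1, e2, add_zero] at h
  simpa using h

theorem annealed1 (ν : Measure X) [IsFiniteMeasure ν] [NeZero ν] (v : K → ℝ≥0) (hv : ∀ k, v k ≠ 0) {a : K → X → ℝ}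
    (ha : ∀ k, Measurable (a k)) {B : ℝ} (hB : ∀ k x, |a k x| ≤ B) {p : ℝ} (hp : |p| ≤ 1)
    {f : X → ℝ} (hf : Measurable f) {Bf : ℝ} (hBf : ∀ x, |f x| ≤ Bf) {C : ℝ} (hC : ∫ x, Real.exp (f x) ∂ν ≤ C) :
    Integrable (fun g => Real.log (∫ x, Real.exp (f x + Lf v a (fun _ => p) g x) ∂ν)) (gpi v) ∧
    ∫ g, Real.log (∫ x, Real.exp (f x + Lf v a (fun _ => p) g x) ∂ν) ∂gpi v ≤ Real.log C := by
  have hp' : ∀ k : K, |(fun _ => p) k| ≤ 1 := fun _ => hp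
  have hCp : 0 < C := lt_of_lt_of_le (Zpos ν hf hBf) hC
  obtain ⟨L, hLd⟩ : ∃ L : (K → ℝ) → X → ℝ, L = fun g => Lf v a (fun _ => p) g := ⟨_, rfl⟩
  have hL2 : Measurable (Function.uncurry L) := by rw [hLd]; exact Lf_measurable v ha _
  have hLm : ∀ g, Measurable (L g) := fun g => by rw [hLd]; exact Lf_measurable' v ha _ g
  have hLb : ∀ g x, |L g x| ≤ Mf v B g := fun g x => by rw [hLd]; exact Lf_bdd v hB hp' g x
  have hmgf := single_mgf v hv a p
  have hLd' : ∀ g x, Lf v a (fun _ => p) g x = L g x := fun g x => by rw [hLd]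
  simp only [hLd'] at hmgf ⊢
  have hWm : Measurable (Function.uncurry fun (g : K → ℝ) (x : X) => f x + L g x) := (hf.comp measurable_snd).add hL2
  have hWb : ∀ g x, |f x + L g x| ≤ Bf + Mf v B g := fun g x => (abs_add_le _ _).trans (add_le_add (hBf x) (hLb g x))
  haveI hpm : IsProbabilityMeasure (gpi v) := by unfold gpi; infer_instance
  have i0 : Integrable (fun g => Real.log (∫ x, Real.exp (f x + L g x) ∂ν)) (gpi v) := by
    refine Integrable.mono' (((integrable_const Bf).add (Mf_integrable v B)).add (integrable_const |Real.log (ν.real Set.univ)|)) ?_ ?_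
    · exact (measurable_Z ν hWm).log.aestronglyMeasurable
    · exact ae_of_all _ fun g => logZ_abs_le ν (hWm.of_uncurry_left (x := g)) (hWb g)
  refine ⟨i0, ?_⟩
  have inner : ∀ x, ∫ g, Real.exp (f x + L g x) ∂gpi v = Real.exp (f x) := by
    intro x
    simp_rw [Real.exp_add (f x)]
    rw [integral_const_mul, (hmgf x).2, mul_one]
  have hI : Integrable (fun r : (K → ℝ) × X => Real.exp (f r.2 + L r.1 r.2)) ((gpi v).prod ν) := by
    have hWs : AEStronglyMeasurable (fun r : (K → ℝ) × X => Real.exp (f r.2 + L r.1 r.2)) ((gpi v).prod ν) := hWm.exp.aestronglyMeasurable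
    rw [integrable_prod_iff' hWs]
    constructor
    · refine ae_of_all _ fun q => ?_
      simp_rw [Real.exp_add (f q)]
      exact (hmgf q).1.const_mul _
    · simp only [Real.norm_eq_abs, abs_of_pos (Real.exp_pos _)]
      simp_rw [inner]
      exact integrable_exp_bdd _ hf hBf
  have hEW : ∫ g, ∫ x, Real.exp (f x + L g x) ∂ν ∂gpi v ≤ C := by
    rw [integral_integral_swap hI]
    simp_rw [inner]; exact hC
  have hpt : ∀ g, Real.log (∫ x, Real.exp (f x + L g x) ∂ν) + 0 ≤ (Real.log C - 1) + (1 / C) * ∫ x, Real.exp (f x + L g x) ∂ν := by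
    intro g
    have hWp := Zpos ν (hWm.of_uncurry_left (x := g)) (hWb g)
    have h3 := Real.log_le_sub_one_of_pos (div_pos hWp hCp)
    rw [Real.log_div hWp.ne' hCp.ne', div_eq_mul_one_div, mul_comm _ (1 / C)] at h3
    linarith
  have := int_mono2 i0 (integrable_const 0) (integrable_const (Real.log C - 1)) (hI.integral_prod_left.const_mul (1 / C)) hpt
  rw [integral_const_mul, integral_const, integral_const] at this
  simp only [probReal_univ, one_smul] at this
  have h5 : 1 / C * ∫ g, ∫ x, Real.exp (f x + L g x) ∂ν ∂gpi v ≤ 1 := by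
    rw [one_div, inv_mul_le_iff₀ hCp, mul_one]; exact hEW
  linarith
end sm

def w1 (n : ℕ) (τ : ℝ) (x : Fin n → ℝ) : ℝ := -(n * (x ⬝ᵥ x / n - τ) ^ 2)

def nu1 (n : ℕ) (τ r : ℝ) : Measure (Fin n → ℝ) := nuW n τ (n * r) (w1 n τ)

def a1 (n : ℕ) (r : ℝ) (k : Fin n × Fin n) (x : Fin n → ℝ) : ℝ := ak n k (Tb n (n * r) x)

def L1 (n : ℕ) (r : ℝ) (g : Fin n × Fin n → ℝ) (x : Fin n → ℝ) : ℝ := Lf (vk n) (a1 n r) (fun _ => 1) g x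

theorem w1_meas (n : ℕ) (τ : ℝ) : Measurable (w1 n τ) := by
  unfold w1; have := sq_meas (n := n); fun_prop

theorem a1_meas (n : ℕ) (r : ℝ) (k) : Measurable (a1 n r k) := (ak_meas n k).comp (Tb_meas n _)

theorem a1_bdd {n : ℕ} {r : ℝ} (hr : 0 ≤ r) (k) (x) : |a1 n r k x| ≤ n * r / √n :=
  (ak_le k (Tb n _ x)).trans (div_le_div_of_nonneg_right (Tb_le (by positivity) x) (Real.sqrt_nonneg _))

theorem del_bdd {n : ℕ} (hn : 0 < n) {r τ : ℝ} (hr : 0 ≤ r) (hτ : 0 ≤ τ) (x : Fin n → ℝ) :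
    |(Tb n (n * r) x ⬝ᵥ Tb n (n * r) x) / n - τ| ≤ r + τ := by
  have hn' : (0:ℝ) < n := by exact_mod_cast hn
  have h1 := Tb_le (n := n) (R := n * r) (by positivity) x
  have h2 := sq_nn (Tb n (n * r) x)
  have h3 : (Tb n (n * r) x ⬝ᵥ Tb n (n * r) x) / n ≤ r := by rw [div_le_iff₀ hn']; linarith
  have h4 : 0 ≤ (Tb n (n * r) x ⬝ᵥ Tb n (n * r) x) / n := by positivity
  rw [abs_le]; constructor <;> linarith

theorem w1_bdd {n : ℕ} (hn : 0 < n) {r τ : ℝ} (hr : 0 ≤ r) (hτ : 0 ≤ τ) (x : Fin n → ℝ) :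
    |w1 n τ (Tb n (n * r) x)| ≤ n * (r + τ) ^ 2 := by
  unfold w1
  rw [abs_neg, abs_mul, abs_pow, abs_of_nonneg (Nat.cast_nonneg n)]
  have := del_bdd hn hr hτ x
  gcongr

theorem L1_meas2 (n : ℕ) (r : ℝ) : Measurable (Function.uncurry (L1 n r)) := Lf_measurable _ (a1_meas n r) _
theorem L1_meas (n : ℕ) (r : ℝ) (g) : Measurable (L1 n r g) := Lf_measurable' _ (a1_meas n r) _ g
theorem L1_bdd {n : ℕ} {r : ℝ} (hr : 0 ≤ r) (g x) : |L1 n r g x| ≤ Mf (vk n) (n * r / √n) g :=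
  Lf_bdd _ (a1_bdd hr) (fun _ => by simp) g x

theorem L1_eq {n : ℕ} (hn : 0 < n) {r : ℝ} (g) {x : Fin n → ℝ} (hx : x ∈ ball n (n * r)) :
    L1 n r g x = -(x ⬝ᵥ x) ^ 2 / (4 * n) + Jg n g x := by
  have hn' : (0:ℝ) < n := by exact_mod_cast hn
  unfold L1 Lf a1 Jg
  simp only [Tb_eq hx]
  rw [Finset.sum_sub_distrib]
  have e3 : ∑ k, 1 ^ 2 * (vk n k:ℝ) * ak n k x ^ 2 / 2 = (x ⬝ᵥ x) ^ 2 / (4 * n) := by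
    have : (x ⬝ᵥ x) ^ 2 / (4 * n) = ((x ⬝ᵥ x) ^ 2 / (2 * n)) / 2 := by field_simp; norm_num
    rw [this, ← ak_cov, Finset.sum_div]
    exact Finset.sum_congr rfl fun k _ => by ring
  rw [e3]
  simp
  ring

/-- mass lower bound pointwise -/
theorem mass_pt {n : ℕ} (hn : 0 < n) {r τ M : ℝ} (hM : 0 < M) (hr : τ < r) (h : M ≤ n * (r - τ) ^ 2) (x : Fin n → ℝ) :
    Real.exp (-M) * (1 - n * (x ⬝ᵥ x / n - τ) ^ 2 / M) ≤ (ball n (n * r)).indicator (fun x => Real.exp (w1 n τ x)) x := by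
  have hn' : (0:ℝ) < n := by exact_mod_cast hn
  by_cases hx : n * (x ⬝ᵥ x / n - τ) ^ 2 ≤ M
  · have hb : x ∈ ball n (n * r) := by
      have h1 : (x ⬝ᵥ x / n - τ) ^ 2 ≤ (r - τ) ^ 2 := le_of_mul_le_mul_left (hx.trans h) hn'
      have h2 := abs_le_of_sq_le_sq' h1 (by linarith)
      have h3 : x ⬝ᵥ x / n ≤ r := by linarith [h2.2]
      rw [div_le_iff₀ hn'] at h3
      show x ⬝ᵥ x ≤ n * r
      linarith
    rw [Set.indicator_of_mem hb]
    have h4 : Real.exp (-M) ≤ Real.exp (w1 n τ x) := Real.exp_le_exp.2 (by unfold w1; linarith)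
    have h5 : 0 ≤ n * (x ⬝ᵥ x / n - τ) ^ 2 / M := by positivity
    have := Real.exp_pos (-M)
    nlinarith
  · push Not at hx
    have h5 : 1 < n * (x ⬝ᵥ x / n - τ) ^ 2 / M := by rw [lt_div_iff₀ hM]; linarith
    have h6 : 0 ≤ (ball n (n * r)).indicator (fun x => Real.exp (w1 n τ x)) x := Set.indicator_nonneg (fun x _ => (Real.exp_pos _).le) x
    have := Real.exp_pos (-M)
    nlinarith

theorem w1_exp_int (n : ℕ) (τ : ℝ) (μ : Measure (Fin n → ℝ)) [IsFiniteMeasure μ] : Integrable (fun x => Real.exp (w1 n τ x)) μ := by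
  refine integrable_bdd μ (w1_meas n τ).exp (B := 1) fun x => ?_
  rw [abs_of_pos (Real.exp_pos _)]
  refine Real.exp_le_one_iff.2 ?_
  unfold w1
  have : 0 ≤ (n:ℝ) * (x ⬝ᵥ x / n - τ) ^ 2 := by positivity
  linarith

theorem nu1_mass (n : ℕ) (τ r : ℝ) : (nu1 n τ r).real Set.univ = ∫ x in ball n (n * r), Real.exp (w1 n τ x) ∂gaussPrior n τ := by
  have := nuW_integral n τ (n * r) (w1_meas n τ) (fun _ => 1)
  unfold nu1
  simpa using this

theorem nu1_mass_ge {n : ℕ} (hn : 0 < n) {r τ : ℝ} (hτ : 0 < τ) (hr : τ < r) (h : 4 * τ ^ 2 ≤ n * (r - τ) ^ 2) :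
    Real.exp (-(4 * τ ^ 2)) / 2 ≤ (nu1 n τ r).real Set.univ := by
  have hn' : (0:ℝ) < n := by exact_mod_cast hn
  rw [nu1_mass, ← integral_indicator (ball_meas _ _)]
  obtain ⟨hdi, hdm⟩ := dev_mean n hn hτ
  have i1 : Integrable (fun x : Fin n → ℝ => Real.exp (-(4 * τ ^ 2)) * (1 - n * (x ⬝ᵥ x / n - τ) ^ 2 / (4 * τ ^ 2))) (gaussPrior n τ) :=
    ((integrable_const _).sub ((hdi.const_mul _).div_const _)).const_mul _
  have := integral_mono i1 ((w1_exp_int n τ (gaussPrior n τ)).indicator (ball_meas _ _)) (mass_pt hn (by positivity : 0 < 4 * τ ^ 2) hr h)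
  refine le_trans (le_of_eq ?_) this
  rw [integral_const_mul, integral_sub (integrable_const _) ((hdi.const_mul _).div_const _), integral_div, integral_const_mul, hdm]
  simp only [integral_const, probReal_univ, one_smul]
  field_simp; norm_num

theorem nu1_fin {n : ℕ} (hn : 0 < n) {r τ : ℝ} (hr : 0 ≤ r) (hτ : 0 ≤ τ) : IsFiniteMeasure (nu1 n τ r) :=
  nuW_fin n τ (n * r) (w1_meas n τ) (w1_bdd hn hr hτ)

theorem nu1_ne {n : ℕ} (hn : 0 < n) {r τ : ℝ} (hτ : 0 < τ) (hr : τ < r) (h : 4 * τ ^ 2 ≤ n * (r - τ) ^ 2) : NeZero (nu1 n τ r) := by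
  have := nu1_mass_ge hn hτ hr h
  constructor
  intro h0
  rw [h0] at this
  have := Real.exp_pos (-(4 * τ ^ 2))
  simp at *
  linarith

/-- integrals against nu1 of nonneg functions are dominated -/
theorem nu1_le (n : ℕ) (τ r : ℝ) {f h : (Fin n → ℝ) → ℝ} (hf : ∀ x, 0 ≤ f x) (hh : Integrable h (gaussPrior n τ)) (hh0 : ∀ x, 0 ≤ h x)
    (hle : ∀ x ∈ ball n (n * r), f x * Real.exp (w1 n τ x) ≤ h x) :
    ∫ x, f x ∂nu1 n τ r ≤ ∫ x, h x ∂gaussPrior n τ := by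
  unfold nu1
  rw [nuW_integral n τ _ (w1_meas n τ)]
  calc ∫ x in ball n (n * r), f x * Real.exp (w1 n τ x) ∂gaussPrior n τ ≤ ∫ x in ball n (n * r), h x ∂gaussPrior n τ := by
        refine integral_mono_of_nonneg (ae_of_all _ fun x => mul_nonneg (hf x) (Real.exp_pos _).le) hh.integrableOn ?_
        filter_upwards [ae_restrict_mem (ball_meas n (n * r))] with x hx
        exact hle x hx
    _ ≤ _ := setIntegral_le_integral hh (ae_of_all _ hh0)

theorem w1_nonpos (n : ℕ) (τ : ℝ) (x) : w1 n τ x ≤ 0 := by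
  unfold w1
  have : 0 ≤ (n:ℝ) * (x ⬝ᵥ x / n - τ) ^ 2 := by positivity
  linarith

theorem nu1_mass_le (n : ℕ) (τ r : ℝ) : (nu1 n τ r).real Set.univ ≤ 1 := by
  have := nu1_le n τ r (f := fun _ => 1) (h := fun _ => 1) (fun _ => zero_le_one) (integrable_const _) (fun _ => zero_le_one)
    (fun x _ => by rw [one_mul]; exact Real.exp_le_one_iff.2 (w1_nonpos n τ x))
  simpa using this

theorem a1_cov (n : ℕ) (r : ℝ) (x y) : ∑ k, (vk n k : ℝ) * a1 n r k x * a1 n r k y = (Tb n (n * r) x ⬝ᵥ Tb n (n * r) y) ^ 2 / (2 * n) := ak_cov n _ _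

theorem nu1_pair {n : ℕ} (hn : 0 < n) {r τ μ : ℝ} (hτ : 0 < τ) (hr : 0 < r) (hμ : 0 < μ) (h : μ * (r * τ) < 1) :
    ∫ q : (Fin n → ℝ) × (Fin n → ℝ), Real.exp (μ * ∑ k, vk n k * a1 n r k q.1 * a1 n r k q.2) ∂(nu1 n τ r).prod (nu1 n τ r) ≤ (√(1 - μ * (r * τ)))⁻¹ := by
  have hn' : (0:ℝ) < n := by exact_mod_cast hn
  haveI := nu1_fin hn hr.le hτ.le
  simp only [a1_cov]
  have hTm := Tb_meas n (n * r)
  have hm : Measurable (fun q : (Fin n → ℝ) × (Fin n → ℝ) => μ * ((Tb n (n * r) q.1 ⬝ᵥ Tb n (n * r) q.2) ^ 2 / (2 * n))) := by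
    unfold dotProduct; fun_prop
  have hb : ∀ q : (Fin n → ℝ) × (Fin n → ℝ), |μ * ((Tb n (n * r) q.1 ⬝ᵥ Tb n (n * r) q.2) ^ 2 / (2 * n))| ≤ μ * (((n * r) * (n * r)) / (2 * n)) := by
    intro q
    rw [abs_of_nonneg (by positivity)]
    have h1 := dot_cs (Tb n (n * r) q.1) (Tb n (n * r) q.2)
    have h2 := Tb_le (n := n) (R := n * r) (by positivity) q.1
    have h3 := Tb_le (n := n) (R := n * r) (by positivity) q.2
    have h4 := sq_nn (Tb n (n * r) q.1)
    have h5 := sq_nn (Tb n (n * r) q.2)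
    gcongr
    exact h1.trans (mul_le_mul h2 h3 h5 (by positivity))
  rw [integral_prod _ (integrable_exp_bdd _ hm hb)]
  have hC0 : 0 < 1 - μ * (r * τ) := by linarith
  have inner : ∀ x, ∫ y, Real.exp (μ * ((Tb n (n * r) x ⬝ᵥ Tb n (n * r) y) ^ 2 / (2 * n))) ∂nu1 n τ r ≤ (√(1 - μ * (r * τ)))⁻¹ := by
    intro x
    have h2 := Tb_le (n := n) (R := n * r) (by positivity) x
    have e2 : 2 * (μ / (2 * n)) * (Tb n (n * r) x ⬝ᵥ Tb n (n * r) x) * τ ≤ μ * (r * τ) := by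
      have : 2 * (μ / (2 * n)) * (Tb n (n * r) x ⬝ᵥ Tb n (n * r) x) * τ ≤ 2 * (μ / (2 * n)) * (n * r) * τ := by gcongr
      refine this.trans (le_of_eq ?_)
      field_simp
    obtain ⟨g1, g2⟩ := gint_rank1 τ hτ (Tb n (n * r) x) (μ / (2 * n)) (by positivity) (lt_of_le_of_lt e2 h)
    refine (nu1_le n τ r (h := fun y => Real.exp (μ / (2 * n) * (Tb n (n * r) x ⬝ᵥ y) ^ 2)) (fun y => (Real.exp_pos _).le) g1 (fun y => (Real.exp_pos _).le) ?_).trans ?_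
    · intro y hy
      rw [Tb_eq hy]
      have e3 : μ / (2 * n) * (Tb n (n * r) x ⬝ᵥ y) ^ 2 = μ * ((Tb n (n * r) x ⬝ᵥ y) ^ 2 / (2 * n)) := by ring
      rw [e3]
      have := Real.exp_le_one_iff.2 (w1_nonpos n τ y)
      exact mul_le_of_le_one_right (Real.exp_pos _).le this
    · rw [g2]
      gcongr
  have h6 : ∫ x, ∫ y, Real.exp (μ * ((Tb n (n * r) x ⬝ᵥ Tb n (n * r) y) ^ 2 / (2 * n))) ∂nu1 n τ r ∂nu1 n τ r ≤ ∫ x, (√(1 - μ * (r * τ)))⁻¹ ∂nu1 n τ r :=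
    integral_mono (integrable_exp_bdd _ hm hb).integral_prod_left (integrable_const _) inner
  refine h6.trans ?_
  rw [integral_const, smul_eq_mul]
  exact mul_le_of_le_one_left (by positivity) (nu1_mass_le n τ r)

/-- two-replica overlap `n⟨R12²⟩` -/
def rho1 (n : ℕ) (τ r : ℝ) (g : Fin n × Fin n → ℝ) : ℝ :=
  Gav ((nu1 n τ r).prod (nu1 n τ r)) (fun q => L1 n r g q.1 + L1 n r g q.2) (fun q => (Tb n (n * r) q.1 ⬝ᵥ Tb n (n * r) q.2) ^ 2 / n)

/-- `n⟨δ²⟩` -/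
def dd1 (n : ℕ) (τ r : ℝ) (g : Fin n × Fin n → ℝ) : ℝ :=
  Gav (nu1 n τ r) (L1 n r g) (fun x => n * ((Tb n (n * r) x ⬝ᵥ Tb n (n * r) x) / n - τ) ^ 2)

def Z1 (n : ℕ) (τ r : ℝ) (g : Fin n × Fin n → ℝ) : ℝ := ∫ x, Real.exp (L1 n r g x) ∂nu1 n τ r

theorem baseA {τ r : ℝ} (hτ : 0 < τ) (hr : τ < r) (hrτ : r * τ < 1) :
    ∃ K : ℝ, ∀ n : ℕ, 0 < n → 4 * τ ^ 2 ≤ n * (r - τ) ^ 2 →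
      -K ≤ ∫ g, Real.log (Z1 n τ r g) ∂gpi (vk n) ∧ ∫ g, rho1 n τ r g ∂gpi (vk n) ≤ K ∧ ∫ g, dd1 n τ r g ∂gpi (vk n) ≤ K := by
  have hr0 : 0 < r := hτ.trans hr
  obtain ⟨μ, hμ1, hμ2⟩ : ∃ μ, 1 < μ ∧ μ * (r * τ) < 1 := by
    have h0 : 0 < r * τ := by positivity
    refine ⟨(1 + 1 / (r * τ)) / 2, ?_, ?_⟩
    · have : 1 < 1 / (r * τ) := by rw [lt_div_iff₀ h0]; linarith
      linarith
    · have : (1 + 1 / (r * τ)) / 2 * (r * τ) = (r * τ + 1) / 2 := by field_simp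
      rw [this]; linarith
  obtain ⟨C, hC⟩ : ∃ C, C = (√(1 - μ * (r * τ)))⁻¹ := ⟨_, rfl⟩
  obtain ⟨E, hE⟩ : ∃ E, E = Real.exp (1 / (μ - 1)) := ⟨_, rfl⟩
  obtain ⟨m, hm⟩ : ∃ m, m = Real.log (Real.exp (-(4 * τ ^ 2)) / 2) := ⟨_, rfl⟩
  have hE0 : 0 < E := by rw [hE]; exact Real.exp_pos _
  have hμ0 : 0 < μ - 1 := by linarith
  obtain ⟨K1, hK1⟩ : ∃ K1, K1 = (Real.log C - (Real.log C - 2 * m) * E) / 2 := ⟨_, rfl⟩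
  obtain ⟨K2, hK2⟩ : ∃ K2, K2 = 2 * ((Real.log C - 2 * m) * E / (μ - 1)) := ⟨_, rfl⟩
  refine ⟨2 * |K1| + |K2|, fun n hn h => ?_⟩
  have hn' : (0:ℝ) < n := by exact_mod_cast hn
  haveI := nu1_fin hn hr0.le hτ.le
  haveI := nu1_ne hn hτ hr h
  have hp := nu1_pair hn hτ hr0 (by linarith) hμ2
  rw [← hC] at hp
  obtain ⟨s1, s2⟩ := second_moment (nu1 n τ r) (vk n) (vk_ne n) (a1_meas n r) (a1_bdd hr0.le) (fun x y => by rw [a1_cov]; positivity) hμ1 hp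
  rw [← hE] at s1 s2
  have hmass := Real.log_le_log (by positivity) (nu1_mass_ge hn hτ hr h)
  rw [← hm] at hmass
  have hZ : K1 ≤ ∫ g, Real.log (Z1 n τ r g) ∂gpi (vk n) := by
    refine le_trans ?_ s1
    rw [hK1]
    have : (Real.log C - 2 * Real.log ((nu1 n τ r).real Set.univ)) * E ≤ (Real.log C - 2 * m) * E := by gcongr
    linarith
  have a1 := le_abs_self K1
  have a2 := neg_abs_le K1
  have a3 := le_abs_self K2
  have a4 := abs_nonneg K1
  have a5 := abs_nonneg K2
  refine ⟨by linarith, ?_, ?_⟩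
  · have e : ∫ g, rho1 n τ r g ∂gpi (vk n) = 2 * ∫ g, Gav ((nu1 n τ r).prod (nu1 n τ r)) (fun q => Lf (vk n) (_root_.a1 n r) (fun _ => 1) g q.1 + Lf (vk n) (_root_.a1 n r) (fun _ => 1) g q.2) (fun q => ∑ k, vk n k * _root_.a1 n r k q.1 * _root_.a1 n r k q.2) ∂gpi (vk n) := by
      rw [← integral_const_mul]
      refine integral_congr_ae (ae_of_all _ fun g => ?_)
      simp only
      rw [← Gav_const_mul]
      unfold rho1
      refine Gav_congr _ (ae_of_all _ fun q => ?_)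
      rw [a1_cov]; field_simp
    rw [e]
    have : 2 * ((Real.log C - 2 * Real.log ((nu1 n τ r).real Set.univ)) * E / (μ - 1)) ≤ K2 := by
      rw [hK2]; gcongr
    linarith
  · have hdm : Measurable (fun x : Fin n → ℝ => 1 / 2 * (n * ((Tb n (n * r) x ⬝ᵥ Tb n (n * r) x) / n - τ) ^ 2)) := by
      have := sq_meas.comp (Tb_meas n (n * r))
      have h2 : Measurable (fun x : Fin n → ℝ => Tb n (n * r) x ⬝ᵥ Tb n (n * r) x) := this
      fun_prop
    have hdb : ∀ x : Fin n → ℝ, |1 / 2 * (n * ((Tb n (n * r) x ⬝ᵥ Tb n (n * r) x) / n - τ) ^ 2)| ≤ 1 / 2 * (n * (r + τ) ^ 2) := by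
      intro x
      rw [abs_of_nonneg (by positivity), ← sq_abs (_ / _ - _)]
      have := del_bdd hn hr0.le hτ.le x
      gcongr
    have hI1 : ∫ x, Real.exp (1 / 2 * (n * ((Tb n (n * r) x ⬝ᵥ Tb n (n * r) x) / n - τ) ^ 2)) ∂nu1 n τ r ≤ 1 := by
      refine (nu1_le n τ r (h := fun _ => 1) (fun x => (Real.exp_pos _).le) (integrable_const _) (fun _ => zero_le_one) ?_).trans ?_
      · intro x hx
        rw [Tb_eq hx, ← Real.exp_add]
        refine Real.exp_le_one_iff.2 ?_
        unfold w1
        have : 0 ≤ (n:ℝ) * (x ⬝ᵥ x / n - τ) ^ 2 := by positivity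
        linarith
      · simp
    obtain ⟨i1, i2⟩ := annealed1 (nu1 n τ r) (vk n) (vk_ne n) (a1_meas n r) (a1_bdd hr0.le) (p := 1) (by simp) hdm hdb hI1
    have hpt : ∀ g, Real.log (Z1 n τ r g) + 1 / 2 * dd1 n τ r g ≤ Real.log (∫ x, Real.exp (1 / 2 * (n * ((Tb n (n * r) x ⬝ᵥ Tb n (n * r) x) / n - τ) ^ 2) + Lf (vk n) (_root_.a1 n r) (fun _ => 1) g x) ∂nu1 n τ r) + 0 := by
      intro g
      have := gibbs (nu1 n τ r) (L1_meas n r g) hdm (L1_bdd hr0.le g) hdb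
      rw [Gav_const_mul] at this
      rw [add_zero]
      exact this
    have j1 : Integrable (fun g => Real.log (Z1 n τ r g)) (gpi (vk n)) := integrable_logZ (nu1 n τ r) (vk n) (a1_meas n r) (a1_bdd hr0.le) (p := fun _ => 1) (by simp)
    have j2 : Integrable (fun g => 1 / 2 * dd1 n τ r g) (gpi (vk n)) := by
      have := integrable_Gav (nu1 n τ r) (vk n) (a1_meas n r) (a1_bdd hr0.le) (p := fun _ => 1) (by simp) hdm hdb
      refine this.congr (ae_of_all _ fun g => ?_)
      simp only
      rw [dd1, ← Gav_const_mul]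
      rfl
    have := int_mono2 j1 j2 i1 (integrable_const 0) hpt
    rw [integral_const_mul, integral_const, smul_zero, add_zero] at this
    rw [Real.log_one] at i2
    linarith

/-- existence of a good radius -/
theorem radius {τ : ℝ} (hτ : 0 < τ) (hτ1 : τ < 1) : ∃ r, τ < r ∧ r * τ < 1 := ⟨1, hτ1, by linarith⟩

end

end

section

open MeasureTheory ProbabilityTheory Filter Matrix
open scoped NNReal ENNReal
noncomputable section
set_option linter.unusedSectionVars false

def gden (n : ℕ) (v : ℝ) (x : Fin n → ℝ) : ℝ := (√(2 * Real.pi * v))⁻¹ ^ n * Real.exp (-(x ⬝ᵥ x) / (2 * v))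

theorem gden_meas (n : ℕ) (v : ℝ) : Measurable (gden n v) := by
  unfold gden; have := sq_meas (n := n); fun_prop

theorem gden_nn (n : ℕ) (v : ℝ) (x) : 0 ≤ gden n v x := by unfold gden; positivity

theorem gden_prod (n : ℕ) {v : ℝ} (hv : 0 < v) (x : Fin n → ℝ) : gden n v x = ∏ i, gaussianPDFReal 0 v.toNNReal (x i) := by
  unfold gden gaussianPDFReal
  rw [Finset.prod_mul_distrib, Finset.prod_const, ← Real.exp_sum, Real.coe_toNNReal _ hv.le]
  simp only [Finset.card_univ, Fintype.card_fin, sub_zero]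
  congr 2
  rw [← Finset.sum_div, Finset.sum_neg_distrib]
  simp [dotProduct, sq]

theorem gauss_dens (n : ℕ) {v : ℝ} (hv : 0 < v) :
    gaussPrior n v = volume.withDensity fun x => ENNReal.ofReal (gden n v x) := by
  have hv0 : Real.toNNReal v ≠ 0 := by simpa using hv
  unfold gaussPrior
  refine Measure.pi_eq fun s hs => ?_
  rw [withDensity_apply _ (MeasurableSet.univ_pi hs)]
  have hI : Integrable (gden n v) := by
    have : Integrable (fun x : Fin n → ℝ => ∏ i, gaussianPDFReal 0 v.toNNReal (x i)) :=
      Integrable.fintype_prod (f := fun _ => gaussianPDFReal 0 v.toNNReal) fun i => integrable_gaussianPDFReal 0 _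
    exact this.congr (ae_of_all _ fun x => (gden_prod n hv x).symm)
  rw [← ofReal_integral_eq_lintegral_ofReal hI.integrableOn (ae_of_all _ fun x => gden_nn n v x)]
  simp_rw [gaussianReal_apply_eq_integral 0 hv0]
  rw [← ENNReal.ofReal_prod_of_nonneg (fun i _ => integral_nonneg fun x => gaussianPDFReal_nonneg _ _ _)]
  congr 1
  rw [← integral_indicator (MeasurableSet.univ_pi hs)]
  simp_rw [← integral_indicator (hs _)]
  rw [← integral_fintype_prod_volume_eq_prod]
  congr 1; ext x
  by_cases hx : x ∈ Set.univ.pi s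
  · rw [Set.indicator_of_mem hx, gden_prod n hv]
    refine Finset.prod_congr rfl fun i _ => ?_
    rw [Set.indicator_of_mem (hx i trivial)]
  · rw [Set.indicator_of_notMem hx]
    simp only [Set.mem_univ_pi, not_forall] at hx
    obtain ⟨i, hi⟩ := hx
    exact (Finset.prod_eq_zero (Finset.mem_univ i) (Set.indicator_of_notMem hi _)).symm

theorem gauss_int (n : ℕ) {v : ℝ} (hv : 0 < v) (f : (Fin n → ℝ) → ℝ) :
    ∫ x, f x ∂gaussPrior n v = ∫ x, gden n v x * f x := by
  rw [gauss_dens n hv, integral_withDensity_eq_integral_toReal_smul (gden_meas n v).ennreal_ofReal (ae_of_all _ fun x => ENNReal.ofReal_lt_top)]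
  simp only [ENNReal.toReal_ofReal (gden_nn n v _), smul_eq_mul]

theorem gauss_integrable (n : ℕ) {v : ℝ} (hv : 0 < v) (f : (Fin n → ℝ) → ℝ) :
    Integrable f (gaussPrior n v) ↔ Integrable fun x => gden n v x * f x := by
  rw [gauss_dens n hv, integrable_withDensity_iff_integrable_smul' (gden_meas n v).ennreal_ofReal (ae_of_all _ fun x => ENNReal.ofReal_lt_top)]
  simp only [ENNReal.toReal_ofReal (gden_nn n v _), smul_eq_mul]

end

end

section

open MeasureTheory ProbabilityTheory Filter Matrix
open scoped NNReal ENNReal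
noncomputable section
set_option linter.unusedSectionVars false

def Ev (n : ℕ) (c θ : ℝ) (s : Fin n → ℝ) (g : Fin n × Fin n → ℝ) (V : Fin n → ℝ) : ℝ :=
  -(V ⬝ᵥ V) ^ 2 / (4 * n) - c * (V ⬝ᵥ V) / 2 + Jg n g V + θ / (2 * n) * (s ⬝ᵥ V) ^ 2

theorem Jg_par (n : ℕ) (g) (V z : Fin n → ℝ) : Jg n g (V + z) + Jg n g (V - z) = 2 * Jg n g V + 2 * Jg n g z := by
  unfold Jg
  rw [Finset.mul_sum, Finset.mul_sum, ← Finset.sum_add_distrib, ← Finset.sum_add_distrib]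
  refine Finset.sum_congr rfl fun p _ => ?_
  unfold ak
  split_ifs <;> simp [Pi.add_apply, Pi.sub_apply] <;> ring

theorem shift_exponent {n : ℕ} (hn : 0 < n) {c c1 θ : ℝ} (hθ : 0 ≤ θ) (s g) (V z : Fin n → ℝ) (hV : V ⬝ᵥ V ≤ n * (c1 - c)) :
    Ev n c θ s g V + (-(z ⬝ᵥ z) ^ 2 / (4 * n) + Jg n g z) - (V ⬝ᵥ z) ^ 2 / n - c1 * (z ⬝ᵥ z) / 2 ≤
    ((Hr n θ s g (V + z) - c * ((V + z) ⬝ᵥ (V + z)) / 2) + (Hr n θ s g (V - z) - c * ((V - z) ⬝ᵥ (V - z)) / 2)) / 2 := by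
  have hn' : (0:ℝ) < n := by exact_mod_cast hn
  have hJ := Jg_par n g V z
  unfold Hr Ev
  have hz := sq_nn z
  have e1 : (V + z) ⬝ᵥ (V + z) = V ⬝ᵥ V + 2 * (V ⬝ᵥ z) + z ⬝ᵥ z := by
    simp only [add_dotProduct, dotProduct_add, dotProduct_comm z V]; ring
  have e2 : (V - z) ⬝ᵥ (V - z) = V ⬝ᵥ V - 2 * (V ⬝ᵥ z) + z ⬝ᵥ z := by
    simp only [sub_dotProduct, dotProduct_sub, dotProduct_comm z V]; ring
  rw [e1, e2, dotProduct_add, dotProduct_sub]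
  generalize V ⬝ᵥ V = a at *
  generalize z ⬝ᵥ z = b at *
  generalize V ⬝ᵥ z = d at *
  generalize s ⬝ᵥ V = e at *
  generalize s ⬝ᵥ z = f at *
  have h1 : 0 ≤ θ / (2 * n) * f ^ 2 := by positivity
  have h2 : a * b / (2 * n) ≤ (c1 - c) * b / 2 := by
    rw [div_le_div_iff₀ (by positivity) (by positivity)]
    nlinarith
  have h3 : ((-(a + 2 * d + b) ^ 2 / (4 * n)) + (-(a - 2 * d + b) ^ 2 / (4 * n))) / 2 = -a ^ 2 / (4 * n) - b ^ 2 / (4 * n) - a * b / (2 * n) - d ^ 2 / n := by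
    field_simp; ring
  have h4 : -b ^ 2 / (4 * (n:ℝ)) = -(b ^ 2 / (4 * n)) := by ring
  nlinarith

theorem amgm_exp (a b : ℝ) : Real.exp ((a + b) / 2) ≤ (Real.exp a + Real.exp b) / 2 := by
  have h1 : Real.exp ((a + b) / 2) = Real.exp (a / 2) * Real.exp (b / 2) := by rw [← Real.exp_add]; ring_nf
  have h2 : Real.exp a = Real.exp (a / 2) ^ 2 := by rw [sq, ← Real.exp_add]; ring_nf
  have h3 : Real.exp b = Real.exp (b / 2) ^ 2 := by rw [sq, ← Real.exp_add]; ring_nf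
  rw [h1, h2, h3]; nlinarith [sq_nonneg (Real.exp (a / 2) - Real.exp (b / 2))]

theorem shift_lb {n : ℕ} (hn : 0 < n) {c c1 θ r : ℝ} (hc : 0 < c) (hc1 : 0 < c1) (hr : 1 / c1 < r) (hθ : 0 ≤ θ)
    (hbig : 4 * (1 / c1) ^ 2 ≤ n * (r - 1 / c1) ^ 2) (s g) (V : Fin n → ℝ) (hV : V ⬝ᵥ V ≤ n * (c1 - c)) :
    n / 2 * Real.log (c / c1) + Ev n c θ s g V + Real.log (Z1 n (1 / c1) r g) -
      Gav (nu1 n (1 / c1) r) (L1 n r g) (fun z => (V ⬝ᵥ Tb n (n * r) z) ^ 2 / n) ≤ Real.log (Zr n c θ s g) := by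
  have hn' : (0:ℝ) < n := by exact_mod_cast hn
  have hτ : 0 < 1 / c1 := by positivity
  have hr0 : 0 ≤ r := by linarith
  have hcv : 0 < 1 / c := by positivity
  haveI hf1 := nu1_fin hn hr0 hτ.le
  haveI hf2 := nu1_ne hn hτ hr hbig
  obtain ⟨F, hF⟩ : ∃ F : (Fin n → ℝ) → ℝ, F = fun x => gden n (1 / c) x * Real.exp (Hr n θ s g x) := ⟨_, rfl⟩
  have hFi : Integrable F := by
    rw [hF]; rw [← gauss_integrable n hcv]
    haveI : IsProbabilityMeasure (gaussPrior n (1 / c)) := by unfold gaussPrior; infer_instance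
    exact Hr_exp_int hn hθ s g _
  have hZ : Zr n c θ s g = ∫ x, F x := by unfold Zr; rw [gauss_int n hcv, hF]
  have hZ1 : ∫ z, F (V + z) = Zr n c θ s g := by rw [hZ, integral_add_left_eq_self F V]
  have hZ2 : ∫ z, F (V - z) = Zr n c θ s g := by rw [hZ, integral_sub_left_eq_self F volume V]
  have i1 : Integrable fun z => F (V + z) := hFi.comp_add_left V
  have i2 : Integrable fun z => F (V - z) := hFi.comp_sub_left V
  obtain ⟨A, hA⟩ : ∃ A : ℝ, A = ((√(2 * Real.pi * (1 / c)))⁻¹ ^ n * ((√(2 * Real.pi * (1 / c1)))⁻¹ ^ n)⁻¹) * Real.exp (Ev n c θ s g V) := ⟨_, rfl⟩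
  obtain ⟨f, hf⟩ : ∃ f : (Fin n → ℝ) → ℝ, f = fun z => -1 * ((V ⬝ᵥ Tb n (n * r) z) ^ 2 / n) := ⟨_, rfl⟩
  have hfm : Measurable f := by
    rw [hf]
    have := (dot_meas V).comp (Tb_meas n (n * r))
    simp only [Function.comp_def] at this
    fun_prop
  have hfb : ∀ z, |f z| ≤ (V ⬝ᵥ V) * r := by
    intro z
    have h1 := dot_cs V (Tb n (n * r) z)
    have h2 := Tb_le (n := n) (R := n * r) (by positivity) z
    have h3 := sq_nn V
    rw [hf]
    simp only
    rw [abs_mul, abs_neg, abs_one, one_mul, abs_of_nonneg (by positivity), div_le_iff₀ hn']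
    calc _ ≤ _ := h1
      _ ≤ (V ⬝ᵥ V) * (n * r) := by gcongr
      _ = _ := by ring
  have hpt : ∀ z, A * (gden n (1 / c1) z * (ball n (n * r)).indicator (fun z => Real.exp (f z + L1 n r g z) * Real.exp (w1 n (1 / c1) z)) z) ≤
      (F (V + z) + F (V - z)) / 2 := by
    intro z
    by_cases hz : z ∈ ball n (n * r)
    · rw [Set.indicator_of_mem hz, L1_eq hn g hz, hf, hF]
      simp only [Tb_eq hz]
      have h1 := shift_exponent hn hθ s g V z hV
      have h2 := w1_nonpos n (1 / c1) z
      have h3 := amgm_exp (Hr n θ s g (V + z) - c * ((V + z) ⬝ᵥ (V + z)) / 2) (Hr n θ s g (V - z) - c * ((V - z) ⬝ᵥ (V - z)) / 2)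
      have h4 := Real.exp_le_exp.2 h1
      unfold gden
      have hk : 0 < (√(2 * Real.pi * (1 / c)))⁻¹ ^ n := by positivity
      have hk1 : 0 < (√(2 * Real.pi * (1 / c1)))⁻¹ ^ n := by positivity
      rw [hA]
      have ee : ∀ x : Fin n → ℝ, Real.exp (Hr n θ s g x - c * (x ⬝ᵥ x) / 2) = Real.exp (-(x ⬝ᵥ x) / (2 * (1 / c))) * Real.exp (Hr n θ s g x) := by
        intro x; rw [← Real.exp_add]; congr 1; field_simp; ring
      rw [ee, ee] at h3
      have e5 : Real.exp (Ev n c θ s g V) * (Real.exp (-(z ⬝ᵥ z) / (2 * (1 / c1))) * (Real.exp (-1 * ((V ⬝ᵥ z) ^ 2 / n) + (-(z ⬝ᵥ z) ^ 2 / (4 * n) + Jg n g z)) * Real.exp (w1 n (1 / c1) z)))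
          ≤ Real.exp (Ev n c θ s g V + (-(z ⬝ᵥ z) ^ 2 / (4 * n) + Jg n g z) - (V ⬝ᵥ z) ^ 2 / n - c1 * (z ⬝ᵥ z) / 2) := by
        rw [← Real.exp_add, ← Real.exp_add, ← Real.exp_add]
        refine Real.exp_le_exp.2 ?_
        have : -(z ⬝ᵥ z) / (2 * (1 / c1)) = - (c1 * (z ⬝ᵥ z) / 2) := by field_simp
        rw [this]; linarith
      generalize (√(2 * Real.pi * (1 / c)))⁻¹ ^ n = k at *
      generalize (√(2 * Real.pi * (1 / c1)))⁻¹ ^ n = k1 at *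
      have h6 := mul_le_mul_of_nonneg_left (e5.trans (h4.trans h3)) hk.le
      calc _ = k * (Real.exp (Ev n c θ s g V) * (Real.exp (-(z ⬝ᵥ z) / (2 * (1 / c1))) * (Real.exp (-1 * ((V ⬝ᵥ z) ^ 2 / n) + (-(z ⬝ᵥ z) ^ 2 / (4 * n) + Jg n g z)) * Real.exp (w1 n (1 / c1) z)))) := by
            rw [show k * k1⁻¹ * Real.exp (Ev n c θ s g V) = k * Real.exp (Ev n c θ s g V) * k1⁻¹ by ring]
            rw [mul_assoc (k * _), ← mul_assoc k1⁻¹, ← mul_assoc k1⁻¹, inv_mul_cancel₀ hk1.ne', one_mul, mul_assoc]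
        _ ≤ _ := h6
        _ = _ := by ring
    · rw [Set.indicator_of_notMem hz, mul_zero, mul_zero]
      have : ∀ x, 0 ≤ F x := fun x => by rw [hF]; exact mul_nonneg (gden_nn _ _ _) (Real.exp_pos _).le
      have := this (V + z); have := ‹∀ x, 0 ≤ F x› (V - z)
      linarith
  have hinteg : ∫ z, A * (gden n (1 / c1) z * (ball n (n * r)).indicator (fun z => Real.exp (f z + L1 n r g z) * Real.exp (w1 n (1 / c1) z)) z) =
      A * ∫ z, Real.exp (f z + L1 n r g z) ∂nu1 n (1 / c1) r := by
    rw [integral_const_mul, ← gauss_int n hτ, integral_indicator (ball_meas _ _)]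
    unfold nu1
    rw [nuW_integral _ _ _ (w1_meas n _)]
  have hA0 : 0 < A := by rw [hA]; positivity
  have hint2 : ∫ z, (F (V + z) + F (V - z)) / 2 = Zr n c θ s g := by
    rw [integral_div, integral_add i1 i2, hZ1, hZ2]; ring
  have hle : A * ∫ z, Real.exp (f z + L1 n r g z) ∂nu1 n (1 / c1) r ≤ Zr n c θ s g := by
    rw [← hinteg, ← hint2]
    refine integral_mono_of_nonneg (ae_of_all _ fun z => ?_) ((i1.add i2).div_const 2) (ae_of_all _ hpt)
    exact mul_nonneg hA0.le (mul_nonneg (gden_nn _ _ _) (Set.indicator_nonneg (fun x _ => by positivity) _))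
  have hB : 0 < ∫ z, Real.exp (f z + L1 n r g z) ∂nu1 n (1 / c1) r :=
    Zpos _ (hfm.add (L1_meas n r g)) (BL := (V ⬝ᵥ V) * r + Mf (vk n) (n * r / √n) g) fun x => (abs_add_le _ _).trans (add_le_add (hfb x) (L1_bdd hr0 g x))
  have hlog := Real.log_le_log (by positivity) hle
  rw [Real.log_mul hA0.ne' hB.ne'] at hlog
  have hg := gibbs (nu1 n (1 / c1) r) (L1_meas n r g) hfm (L1_bdd hr0 g) hfb
  rw [hf, Gav_const_mul, ← hf] at hg
  have hlA : Real.log A = n / 2 * Real.log (c / c1) + Ev n c θ s g V := by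
    rw [hA, Real.log_mul (by positivity) (by positivity), Real.log_exp, Real.log_mul (by positivity) (by positivity), Real.log_inv, Real.log_pow, Real.log_pow,
      Real.log_inv, Real.log_inv, Real.log_sqrt (by positivity), Real.log_sqrt (by positivity), Real.log_mul (x := 2 * Real.pi) (y := 1 / c) (by positivity) (by positivity), Real.log_mul (x := 2 * Real.pi) (y := 1 / c1) (by positivity) (by positivity),
      Real.log_div hc.ne' hc1.ne', Real.log_div one_ne_zero hc.ne', Real.log_div one_ne_zero hc1.ne']
    simp; ring
  unfold Z1
  linarith
end

end

section

open MeasureTheory ProbabilityTheory Filter Matrix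
open scoped NNReal ENNReal
noncomputable section
set_option linter.unusedSectionVars false

def muG (n : ℕ) (τ : ℝ) (g : Fin n × Fin n → ℝ) : Measure (Fin n → ℝ) :=
  (nu1 n τ 1).withDensity fun x => ENNReal.ofReal (Real.exp (L1 n 1 g x) / Z1 n τ 1 g)

theorem Z1_pos {n : ℕ} (hn : 0 < n) {τ : ℝ} (hτ : 0 < τ) (hτ1 : τ < 1) (h : 4 * τ ^ 2 ≤ n * (1 - τ) ^ 2) (g) : 0 < Z1 n τ 1 g := by
  haveI := nu1_fin hn zero_le_one hτ.le
  haveI := nu1_ne hn hτ hτ1 h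
  exact Zpos _ (L1_meas n 1 g) (L1_bdd zero_le_one g)

theorem Z1_nn (n : ℕ) (τ : ℝ) (g) : 0 ≤ Z1 n τ 1 g := integral_nonneg fun x => (Real.exp_pos _).le

theorem muG_int (n : ℕ) (τ : ℝ) (g) (f : (Fin n → ℝ) → ℝ) : ∫ x, f x ∂muG n τ g = Gav (nu1 n τ 1) (L1 n 1 g) f := by
  unfold muG
  have hm : Measurable fun x => Real.exp (L1 n 1 g x) / Z1 n τ 1 g := (L1_meas n 1 g).exp.div_const _
  rw [integral_withDensity_eq_integral_toReal_smul hm.ennreal_ofReal (ae_of_all _ fun x => ENNReal.ofReal_lt_top)]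
  have : ∀ x, (ENNReal.ofReal (Real.exp (L1 n 1 g x) / Z1 n τ 1 g)).toReal • f x = (f x * Real.exp (L1 n 1 g x)) / Z1 n τ 1 g := fun x => by
    rw [ENNReal.toReal_ofReal (div_nonneg (Real.exp_pos _).le (Z1_nn n τ g)), smul_eq_mul]; ring
  simp_rw [this]
  rw [integral_div]; rfl

theorem muG_prob {n : ℕ} (hn : 0 < n) {τ : ℝ} (hτ : 0 < τ) (hτ1 : τ < 1) (h : 4 * τ ^ 2 ≤ n * (1 - τ) ^ 2) (g) : IsProbabilityMeasure (muG n τ g) := by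
  haveI := nu1_fin hn zero_le_one hτ.le
  have hfin : IsFiniteMeasure (muG n τ g) := by
    refine isFiniteMeasure_withDensity_ofReal ?_
    exact ((integrable_exp_bdd (nu1 n τ 1) (L1_meas n 1 g) (L1_bdd zero_le_one g)).div_const _).2
  have h1 := muG_int n τ g fun _ => 1
  rw [Gav_const _ (Z1_pos hn hτ hτ1 h g)] at h1
  simp only [integral_const, smul_eq_mul, mul_one] at h1
  constructor
  rw [measureReal_def] at h1
  rw [← ENNReal.toReal_eq_one_iff]; exact h1

theorem muG_ae (n : ℕ) (τ : ℝ) (g) : ∀ᵐ x : Fin n → ℝ ∂muG n τ g, x ⬝ᵥ x ≤ n := by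
  have h1 : ∀ᵐ x ∂nu1 n τ 1, x ∈ ball n (n * 1) := nuW_ae n τ (n * 1) (w1 n τ)
  refine (withDensity_absolutelyContinuous _ _).ae_le ?_
  filter_upwards [h1] with x hx
  have : x ⬝ᵥ x ≤ n * 1 := hx
  linarith

theorem muG_dd (n : ℕ) (τ : ℝ) (g) : ∫ x : Fin n → ℝ, n * (x ⬝ᵥ x / n - τ) ^ 2 ∂muG n τ g = dd1 n τ 1 g := by
  rw [muG_int]; unfold dd1
  refine Gav_congr _ ?_
  have h1 : ∀ᵐ x ∂nu1 n τ 1, x ∈ ball n (n * 1) := nuW_ae n τ (n * 1) (w1 n τ)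
  filter_upwards [h1] with x hx
  rw [Tb_eq hx]

theorem muG_rho {n : ℕ} (hn : 0 < n) {τ : ℝ} (hτ : 0 < τ) (g) :
    ∫ x, ∫ y, (x ⬝ᵥ y) ^ 2 / n ∂muG n τ g ∂muG n τ g = rho1 n τ 1 g := by
  haveI := nu1_fin hn zero_le_one hτ.le
  have h1 : ∀ᵐ x ∂nu1 n τ 1, x ∈ ball n (n * 1) := nuW_ae n τ (n * 1) (w1 n τ)
  simp_rw [muG_int]
  have e1 : Gav (nu1 n τ 1) (L1 n 1 g) (fun x => Gav (nu1 n τ 1) (L1 n 1 g) fun y => (x ⬝ᵥ y) ^ 2 / n) =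
      Gav (nu1 n τ 1) (L1 n 1 g) (fun x => Gav (nu1 n τ 1) (L1 n 1 g) fun y => (Tb n (n * 1) x ⬝ᵥ Tb n (n * 1) y) ^ 2 / n) := by
    refine Gav_congr _ ?_
    filter_upwards [h1] with x hx
    refine Gav_congr _ ?_
    filter_upwards [h1] with y hy
    rw [Tb_eq hx, Tb_eq hy]
  rw [e1]
  unfold rho1
  obtain ⟨f, hf⟩ : ∃ f : (Fin n → ℝ) × (Fin n → ℝ) → ℝ, f = fun q => (Tb n (n * 1) q.1 ⬝ᵥ Tb n (n * 1) q.2) ^ 2 / n := ⟨_, rfl⟩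
  have hfm : Measurable f := by
    rw [hf]
    have h2 : Measurable fun q : (Fin n → ℝ) × (Fin n → ℝ) => Tb n (n * 1) q.1 := (Tb_meas n (n * 1)).comp measurable_fst
    have h3 : Measurable fun q : (Fin n → ℝ) × (Fin n → ℝ) => Tb n (n * 1) q.2 := (Tb_meas n (n * 1)).comp measurable_snd
    unfold dotProduct
    have h2' := fun i => measurable_pi_iff.1 h2 i
    have h3' := fun i => measurable_pi_iff.1 h3 i
    fun_prop
  have hn' : (0:ℝ) < n := by exact_mod_cast hn
  have hfb : ∀ q, |f q| ≤ n := by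
    intro q
    rw [hf]; simp only
    rw [abs_of_nonneg (by positivity), div_le_iff₀ hn']
    have h1 := dot_cs (Tb n (n * 1) q.1) (Tb n (n * 1) q.2)
    have h2 := Tb_le (n := n) (R := n * 1) (by positivity) q.1
    have h3 := Tb_le (n := n) (R := n * 1) (by positivity) q.2
    have h4 := sq_nn (Tb n (n * 1) q.1)
    have h5 := sq_nn (Tb n (n * 1) q.2)
    nlinarith
  have ef : ∀ x y, (Tb n (n * 1) x ⬝ᵥ Tb n (n * 1) y) ^ 2 / n = f (x, y) := fun x y => by rw [hf]
  simp only [ef]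
  unfold Gav
  have i1 : Integrable (fun q : (Fin n → ℝ) × (Fin n → ℝ) => f q * Real.exp (L1 n 1 g q.1 + L1 n 1 g q.2)) ((nu1 n τ 1).prod (nu1 n τ 1)) :=
    integrable_mul_exp _ hfm (pair_meas (L1_meas n 1 g)) hfb (pair_bdd (L1_bdd zero_le_one g))
  rw [integral_prod _ i1]
  simp_rw [Real.exp_add]
  rw [integral_prod_mul (fun x => Real.exp (L1 n 1 g x)) (fun x => Real.exp (L1 n 1 g x)), ← div_div]
  congr 1
  rw [← integral_div]
  congr 1; ext x
  rw [div_mul_eq_mul_div]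
  congr 1
  rw [← integral_mul_const]
  congr 1; ext y; ring

theorem logZ1_int {n : ℕ} (hn : 0 < n) {τ : ℝ} (hτ : 0 < τ) (hτ1 : τ < 1) (h : 4 * τ ^ 2 ≤ n * (1 - τ) ^ 2) :
    Integrable (fun g => Real.log (Z1 n τ 1 g)) (gpi (vk n)) := by
  haveI := nu1_fin hn zero_le_one hτ.le
  haveI := nu1_ne hn hτ hτ1 h
  exact integrable_logZ (nu1 n τ 1) (vk n) (a1_meas n 1) (a1_bdd zero_le_one) (fun _ => by simp)

theorem dd1_int {n : ℕ} (hn : 0 < n) {τ : ℝ} (hτ : 0 < τ) (hτ1 : τ < 1) (h : 4 * τ ^ 2 ≤ n * (1 - τ) ^ 2) :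
    Integrable (fun g => dd1 n τ 1 g) (gpi (vk n)) := by
  haveI := nu1_fin hn zero_le_one hτ.le
  haveI := nu1_ne hn hτ hτ1 h
  refine integrable_Gav (nu1 n τ 1) (vk n) (a1_meas n 1) (a1_bdd zero_le_one) (fun _ => by simp) (Bf := n * (1 + τ) ^ 2) ?_ ?_
  · have := (sq_meas (n := n)).comp (Tb_meas n (n * 1))
    simp only [Function.comp_def] at this
    fun_prop
  · intro x
    have := del_bdd hn zero_le_one hτ.le x
    rw [abs_mul, abs_pow, abs_of_nonneg (Nat.cast_nonneg n)]
    gcongr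

theorem rho1_int {n : ℕ} (hn : 0 < n) {τ : ℝ} (hτ : 0 < τ) (hτ1 : τ < 1) (h : 4 * τ ^ 2 ≤ n * (1 - τ) ^ 2) :
    Integrable (fun g => rho1 n τ 1 g) (gpi (vk n)) := by
  haveI := nu1_fin hn zero_le_one hτ.le
  haveI := nu1_ne hn hτ hτ1 h
  have hn' : (0:ℝ) < n := by exact_mod_cast hn
  have h2 : Measurable fun q : (Fin n → ℝ) × (Fin n → ℝ) => Tb n (n * 1) q.1 := (Tb_meas n (n * 1)).comp measurable_fst
  have h3 : Measurable fun q : (Fin n → ℝ) × (Fin n → ℝ) => Tb n (n * 1) q.2 := (Tb_meas n (n * 1)).comp measurable_snd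
  have h2' := fun i => measurable_pi_iff.1 h2 i
  have h3' := fun i => measurable_pi_iff.1 h3 i
  have hfm : Measurable fun q : (Fin n → ℝ) × (Fin n → ℝ) => (Tb n (n * 1) q.1 ⬝ᵥ Tb n (n * 1) q.2) ^ 2 / n := by
    unfold dotProduct
    fun_prop
  have hfb : ∀ q : (Fin n → ℝ) × (Fin n → ℝ), |(Tb n (n * 1) q.1 ⬝ᵥ Tb n (n * 1) q.2) ^ 2 / n| ≤ n := by
    intro q
    rw [abs_of_nonneg (by positivity), div_le_iff₀ hn']
    have h1 := dot_cs (Tb n (n * 1) q.1) (Tb n (n * 1) q.2)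
    have h2 := Tb_le (n := n) (R := n * 1) (by positivity) q.1
    have h3 := Tb_le (n := n) (R := n * 1) (by positivity) q.2
    have h4 := sq_nn (Tb n (n * 1) q.1)
    have h5 := sq_nn (Tb n (n * 1) q.2)
    nlinarith
  have hLm : Measurable (Function.uncurry fun (g : Fin n × Fin n → ℝ) (q : (Fin n → ℝ) × (Fin n → ℝ)) => L1 n 1 g q.1 + L1 n 1 g q.2) := by
    have := L1_meas2 n 1
    exact (this.comp (measurable_fst.prodMk (measurable_fst.comp measurable_snd))).add (this.comp (measurable_fst.prodMk (measurable_snd.comp measurable_snd)))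
  refine Integrable.of_bound (measurable_Gav _ hLm (f := fun _ => fun q : (Fin n → ℝ) × (Fin n → ℝ) => (Tb n (n * 1) q.1 ⬝ᵥ Tb n (n * 1) q.2) ^ 2 / n) (hfm.comp measurable_snd)).aestronglyMeasurable n ?_
  exact ae_of_all _ fun g => Gav_abs_le _ hfm (pair_meas (L1_meas n 1 g)) hfb (pair_bdd (L1_bdd zero_le_one g))

theorem big_ev {τ : ℝ} (hτ1 : τ < 1) : ∀ᶠ n : ℕ in atTop, 0 < n ∧ 4 * τ ^ 2 ≤ n * (1 - τ) ^ 2 := by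
  have hp : 0 < (1 - τ) ^ 2 := by have : 0 < 1 - τ := by linarith
                                  positivity
  filter_upwards [eventually_gt_atTop 0, eventually_ge_atTop ⌈4 * τ ^ 2 / (1 - τ) ^ 2⌉₊] with n h1 h2
  refine ⟨h1, ?_⟩
  have := Nat.le_of_ceil_le h2
  rwa [div_le_iff₀ hp] at this

theorem Fr_eq' {n : ℕ} (hn : 0 < n) {c θ : ℝ} (hc : 0 < c) (hθ : 0 ≤ θ) :
    Fr n c θ = ∫ g, ∫ s, Real.log (Zr n c θ s g) ∂gaussPrior n 1 ∂gpi (vk n) := by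
  unfold Fr
  exact integral_prod_symm _ (logZr_int hn hc hθ)

/-- master step: a pointwise-in-g lower bound gives a lower bound on Fr -/
theorem Fr_lower {n : ℕ} (hn : 0 < n) {c θ : ℝ} (hc : 0 < c) (hθ : 0 ≤ θ) (h : (Fin n × Fin n → ℝ) → ℝ) (hi : Integrable h (gpi (vk n)))
    (hle : ∀ g, Integrable (fun s => Real.log (Zr n c θ s g)) (gaussPrior n 1) → h g ≤ ∫ s, Real.log (Zr n c θ s g) ∂gaussPrior n 1) :
    ∫ g, h g ∂gpi (vk n) ≤ Fr n c θ := by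
  rw [Fr_eq' hn hc hθ]
  have hI := logZr_int hn hc hθ
  refine integral_mono_ae hi hI.integral_prod_right ?_
  filter_upwards [hI.prod_left_ae] with g hg
  exact hle g hg

theorem lbA {c θ : ℝ} (hc : 1 < c) (hθ : 0 ≤ θ) {η : ℝ} (hη : 0 < η) : ∀ᶠ n : ℕ in atTop, -η ≤ 1 / (n:ℝ) * Fr n c θ := by
  have hc0 : 0 < c := by linarith
  have hτ : 0 < 1 / c := by positivity
  have hτ1 : 1 / c < 1 := by rw [div_lt_one hc0]; exact hc
  obtain ⟨K, hK⟩ := baseA hτ hτ1 (by linarith)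
  filter_upwards [big_ev hτ1, eventually_ge_atTop ⌈|K| / η⌉₊] with n ⟨hn, hb⟩ hn2
  have hn' : (0:ℝ) < n := by exact_mod_cast hn
  have h1 := (hK n hn hb).1
  have h2 : ∫ g, Real.log (Z1 n (1 / c) 1 g) ∂gpi (vk n) ≤ Fr n c θ := by
    refine Fr_lower hn hc0 hθ _ (logZ1_int hn hτ hτ1 hb) fun g hg => ?_
    have hpt : ∀ s, Real.log (Z1 n (1 / c) 1 g) ≤ Real.log (Zr n c θ s g) := by
      intro s
      have := shift_lb hn hc0 hc0 hτ1 hθ hb s g 0 (by simp)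
      have e : Ev n c θ s g 0 = 0 := by simp [Ev, Jg, ak]
      have e2 : Gav (nu1 n (1 / c) 1) (L1 n 1 g) (fun z => ((0 : Fin n → ℝ) ⬝ᵥ Tb n (n * 1) z) ^ 2 / n) = 0 := by simp [Gav]
      rw [e, e2, div_self hc0.ne', Real.log_one] at this
      linarith
    have := integral_mono (integrable_const _) hg hpt
    simpa using this
  have h3 := Nat.le_of_ceil_le hn2
  rw [div_le_iff₀ hη] at h3
  have h4 := le_abs_self K
  rw [one_div, ← div_eq_inv_mul, le_div_iff₀ hn']
  linarith
end

end

section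

open MeasureTheory ProbabilityTheory Filter Matrix
open scoped NNReal ENNReal
noncomputable section
set_option linter.unusedSectionVars false

def ch (n : ℕ) (x : Fin n → ℝ) : ℝ := max (1 - x ⬝ᵥ x / n) 0

theorem ch_nn (n : ℕ) (x) : 0 ≤ ch n x := le_max_right _ _

theorem ch_le (n : ℕ) (x) : ch n x ≤ 1 := by
  unfold ch
  have := sq_nn x
  refine max_le ?_ zero_le_one
  have : 0 ≤ x ⬝ᵥ x / n := by positivity
  linarith

theorem cont_dot {n : ℕ} (s : Fin n → ℝ) : Continuous fun x : Fin n → ℝ => s ⬝ᵥ x := by unfold dotProduct; fun_prop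
theorem cont_sq {n : ℕ} : Continuous fun x : Fin n → ℝ => x ⬝ᵥ x := by unfold dotProduct; fun_prop
theorem cont_ch (n : ℕ) : Continuous (ch n) := by unfold ch; have := cont_sq (n := n); fun_prop
theorem cont_Jg (n : ℕ) (g) : Continuous (Jg n g) := by
  have : Jg n g = fun x => (1/2) * ∑ i, ∑ j, wg n g i j * x i * x j := by ext x; exact Jg_eq n g x
  rw [this]; fun_prop

theorem hasDerivAt_phi (t : ℝ) : HasDerivAt (fun t : ℝ => max t 0 ^ 2) (2 * max t 0) t := by
  rcases lt_trichotomy t 0 with h | h | h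
  · rw [max_eq_right h.le, mul_zero]
    refine (hasDerivAt_const t (0:ℝ)).congr_of_eventuallyEq ?_
    filter_upwards [gt_mem_nhds h] with y hy
    rw [max_eq_right (le_of_lt hy)]; simp
  · subst h
    rw [max_self, mul_zero, hasDerivAt_iff_isLittleO_nhds_zero]
    simp only [zero_add, max_self, smul_zero, sub_zero]
    norm_num
    have : (fun h : ℝ => max h 0 ^ 2) =O[nhds 0] fun h : ℝ => h ^ 2 := by
      refine Asymptotics.IsBigO.of_bound 1 (Eventually.of_forall fun y => ?_)
      rw [one_mul, Real.norm_eq_abs, Real.norm_eq_abs, abs_pow, abs_pow, sq_abs, sq_abs]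
      rcases le_total y 0 with h | h
      · rw [max_eq_right h]; nlinarith [sq_nonneg y]
      · rw [max_eq_left h]
    refine this.trans_isLittleO ?_
    have := Asymptotics.isLittleO_pow_id (𝕜 := ℝ) (n := 2) (by norm_num)
    simpa using this
  · rw [max_eq_left h.le]
    have h1 : HasDerivAt (fun t : ℝ => t ^ 2) (2 * t) t := by simpa using hasDerivAt_pow 2 t
    refine h1.congr_of_eventuallyEq ?_
    filter_upwards [lt_mem_nhds h] with y hy
    rw [max_eq_left (le_of_lt hy)]

theorem hd_coord {n : ℕ} (x : Fin n → ℝ) (i a : Fin n) (t : ℝ) :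
    HasDerivAt (fun t => Function.update x i t a) (if a = i then 1 else 0) t := by
  by_cases h : a = i
  · subst h; simp only [Function.update_self, if_true]; exact hasDerivAt_id' t
  · simp only [h, if_false, Function.update_of_ne h, ne_eq, not_false_eq_true]; exact hasDerivAt_const _ _

theorem hd_sq {n : ℕ} (x : Fin n → ℝ) (i : Fin n) (t : ℝ) :
    HasDerivAt (fun t => Function.update x i t ⬝ᵥ Function.update x i t) (2 * Function.update x i t i) t := by
  unfold dotProduct
  have := HasDerivAt.fun_sum (u := Finset.univ) fun a _ => (hd_coord x i a t).mul (hd_coord x i a t)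
  refine this.congr_deriv ?_
  simp [ite_mul, mul_ite, Finset.sum_add_distrib]; ring

theorem hd_Jg {n : ℕ} (g) (x : Fin n → ℝ) (i : Fin n) (t : ℝ) :
    HasDerivAt (fun t => Jg n g (Function.update x i t)) (∑ j, wg n g i j * Function.update x i t j) t := by
  simp only [Jg_eq]
  have := (HasDerivAt.fun_sum (u := Finset.univ) fun a _ => HasDerivAt.fun_sum (u := Finset.univ) fun b _ =>
    ((hd_coord x i a t).const_mul (wg n g a b)).mul (hd_coord x i b t)).const_mul (1/2)
  refine this.congr_deriv ?_
  simp only [mul_ite, mul_one, mul_zero, ite_mul, zero_mul, Finset.sum_add_distrib]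
  rw [Finset.sum_comm]
  simp only [Finset.sum_ite_eq', Finset.mem_univ, if_true]
  have : ∀ a, wg n g a i = wg n g i a := fun a => wg_symm n g a i
  simp only [this]; ring

def Hh (n : ℕ) (τ : ℝ) (g : Fin n × Fin n → ℝ) (x : Fin n → ℝ) : ℝ := -(x ⬝ᵥ x) ^ 2 / (4 * n) + Jg n g x - n * (x ⬝ᵥ x / n - τ) ^ 2

theorem cont_Hh (n : ℕ) (τ : ℝ) (g) : Continuous (Hh n τ g) := by
  unfold Hh; have := cont_sq (n := n); have := cont_Jg n g; fun_prop

theorem hd_Hh {n : ℕ} (hn : 0 < n) (τ : ℝ) (g) (x : Fin n → ℝ) (i : Fin n) (t : ℝ) :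
    HasDerivAt (fun t => Hh n τ g (Function.update x i t))
      (-(Function.update x i t ⬝ᵥ Function.update x i t) / n * Function.update x i t i + (∑ j, wg n g i j * Function.update x i t j)
        - 4 * (Function.update x i t ⬝ᵥ Function.update x i t / n - τ) * Function.update x i t i) t := by
  unfold Hh
  have hn' : (n:ℝ) ≠ 0 := by exact_mod_cast hn.ne'
  have h1 := hd_sq x i t
  have h2 := hd_Jg g x i t
  have := (((h1.pow 2).neg.div_const (4 * (n:ℝ))).add h2).sub ((((h1.div_const (n:ℝ)).sub_const τ).pow 2).const_mul (n:ℝ))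
  refine this.congr_deriv ?_
  generalize (Function.update x i t ⬝ᵥ Function.update x i t) = A
  generalize (∑ j, wg n g i j * Function.update x i t j) = B
  generalize Function.update x i t i = D
  norm_num
  field_simp
  ring

theorem ball_compact (n : ℕ) (R : ℝ) : IsCompact (ball n R) := by
  refine Metric.isCompact_of_isClosed_isBounded ?_ ?_
  · exact isClosed_le cont_sq continuous_const
  · refine (Metric.isBounded_iff_subset_closedBall 0).2 ⟨√R, fun x hx => ?_⟩
    rw [mem_closedBall_zero_iff, pi_norm_le_iff_of_nonneg (Real.sqrt_nonneg _)]
    intro i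
    rw [Real.norm_eq_abs]
    refine Real.abs_le_sqrt ?_
    have h1 : x ⬝ᵥ x ≤ R := hx
    have h2 : x i * x i ≤ x ⬝ᵥ x := Finset.single_le_sum (f := fun i => x i * x i) (fun j _ => mul_self_nonneg _) (Finset.mem_univ i)
    nlinarith

theorem ch_zero {n : ℕ} (hn : 0 < n) {x : Fin n → ℝ} (hx : x ∉ ball n (n * 1)) : ch n x = 0 := by
  have hn' : (0:ℝ) < n := by exact_mod_cast hn
  have : ¬ x ⬝ᵥ x ≤ n * 1 := hx
  unfold ch
  refine max_eq_right ?_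
  have : 1 ≤ x ⬝ᵥ x / n := by rw [le_div_iff₀ hn']; linarith
  linarith

theorem cs_int {n : ℕ} {f : (Fin n → ℝ) → ℝ} (hf : Continuous f) (h0 : ∀ x ∉ ball n (n * 1), f x = 0) (v : ℝ) : Integrable f (gaussPrior n v) :=
  hf.integrable_of_hasCompactSupport (HasCompactSupport.intro (ball_compact n (n * 1)) h0)

theorem conv_mu {n : ℕ} (hn : 0 < n) {τ : ℝ} (hτ : 0 < τ) (hτ1 : τ < 1) (hb : 4 * τ ^ 2 ≤ n * (1 - τ) ^ 2) (g) (h : (Fin n → ℝ) → ℝ) (h0 : ∀ x ∉ ball n (n * 1), h x = 0) :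
    ∫ x, h x * Real.exp (Hh n τ g x) ∂gaussPrior n τ = (∫ x, h x ∂muG n τ g) * Z1 n τ 1 g := by
  rw [muG_int]
  unfold Gav
  rw [show (∫ x, Real.exp (L1 n 1 g x) ∂nu1 n τ 1) = Z1 n τ 1 g from rfl, div_mul_cancel₀ _ (Z1_pos hn hτ hτ1 hb g).ne']
  unfold nu1
  rw [nuW_integral n τ _ (w1_meas n τ), ← setIntegral_eq_integral_of_forall_compl_eq_zero (s := ball n (n * 1))]
  · refine setIntegral_congr_fun (ball_meas _ _) fun x hx => ?_
    beta_reduce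
    rw [L1_eq hn g hx, mul_assoc, ← Real.exp_add]
    unfold Hh w1
    ring_nf
  · intro x hx; rw [h0 x hx, zero_mul]

def Wv (n : ℕ) (g : Fin n × Fin n → ℝ) (v x : Fin n → ℝ) : ℝ := ∑ i, v i * ∑ j, wg n g i j * x j

theorem ibp {n : ℕ} (hn : 0 < n) {τ : ℝ} (hτ : 0 < τ) (hτ1 : τ < 1) (hb : 4 * τ ^ 2 ≤ n * (1 - τ) ^ 2) (g) (s v : Fin n → ℝ) :
    ∫ x, (v ⬝ᵥ x) * (ch n x ^ 2 * (s ⬝ᵥ x)) ∂muG n τ g = τ * ∫ x, (-(4 / n) * ch n x * (v ⬝ᵥ x) * (s ⬝ᵥ x) + ch n x ^ 2 * (v ⬝ᵥ s) +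
      ch n x ^ 2 * (s ⬝ᵥ x) * (-(x ⬝ᵥ x) / n * (v ⬝ᵥ x) + Wv n g v x - 4 * (x ⬝ᵥ x / n - τ) * (v ⬝ᵥ x))) ∂muG n τ g := by
  have hn' : (n:ℝ) ≠ 0 := by exact_mod_cast hn.ne'
  have c1 := cont_dot s
  have c2 := cont_sq (n := n)
  have c3 := cont_ch n
  have c4 := cont_Hh n τ g
  have z0 : ∀ x ∉ ball n (n * 1), ch n x = 0 := fun x hx => ch_zero hn hx
  have key := stein_dot n hτ v (fun x => ch n x ^ 2 * (s ⬝ᵥ x) * Real.exp (Hh n τ g x))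
    (fun i x => (-(4 / n) * ch n x * x i * (s ⬝ᵥ x) + ch n x ^ 2 * s i +
      ch n x ^ 2 * (s ⬝ᵥ x) * (-(x ⬝ᵥ x) / n * x i + (∑ j, wg n g i j * x j) - 4 * (x ⬝ᵥ x / n - τ) * x i)) * Real.exp (Hh n τ g x)) ?_ ?_ ?_ ?_
  · have hz := (Z1_pos hn hτ hτ1 hb g).ne'
    have e1 : ∀ x, (v ⬝ᵥ x) * (ch n x ^ 2 * (s ⬝ᵥ x) * Real.exp (Hh n τ g x)) = ((v ⬝ᵥ x) * (ch n x ^ 2 * (s ⬝ᵥ x))) * Real.exp (Hh n τ g x) := fun x => by ring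
    have e2 : ∀ x : Fin n → ℝ, ∑ i, v i * ((-(4 / n) * ch n x * x i * (s ⬝ᵥ x) + ch n x ^ 2 * s i +
      ch n x ^ 2 * (s ⬝ᵥ x) * (-(x ⬝ᵥ x) / n * x i + (∑ j, wg n g i j * x j) - 4 * (x ⬝ᵥ x / n - τ) * x i)) * Real.exp (Hh n τ g x)) =
      (-(4 / n) * ch n x * (v ⬝ᵥ x) * (s ⬝ᵥ x) + ch n x ^ 2 * (v ⬝ᵥ s) +
      ch n x ^ 2 * (s ⬝ᵥ x) * (-(x ⬝ᵥ x) / n * (v ⬝ᵥ x) + Wv n g v x - 4 * (x ⬝ᵥ x / n - τ) * (v ⬝ᵥ x))) * Real.exp (Hh n τ g x) := by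
      intro x
      have f1 : v ⬝ᵥ x = ∑ i, v i * x i := rfl
      have f2 : v ⬝ᵥ s = ∑ i, v i * s i := rfl
      rw [f1, f2]; unfold Wv
      simp only [Finset.mul_sum, Finset.sum_mul, ← Finset.sum_add_distrib, ← Finset.sum_sub_distrib]
      refine Finset.sum_congr rfl fun i _ => ?_
      simp only [← Finset.mul_sum]
      have f3 : ∑ j, v i * (wg n g i j * x j) = v i * ∑ j, (wg n g i j * x j) := by rw [Finset.mul_sum]
      ring
    simp only [e1, e2] at key
    rw [conv_mu hn hτ hτ1 hb g _ (fun x hx => by rw [z0 x hx]; ring), conv_mu hn hτ hτ1 hb g _ (fun x hx => by rw [z0 x hx]; ring), ← mul_assoc] at key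
    exact mul_right_cancel₀ hz key
  · intro i x t
    have h1 := hd_sq x i t
    have h2 := hasDerivAt_dot_update s x i t
    have h3 := hd_Hh hn τ g x i t
    have h4 : HasDerivAt (fun t => ch n (Function.update x i t) ^ 2) (2 * ch n (Function.update x i t) * (-(2 * Function.update x i t i / n))) t := by
      have := (hasDerivAt_phi (1 - Function.update x i t ⬝ᵥ Function.update x i t / n)).comp t ((h1.div_const (n:ℝ)).const_sub 1)
      exact this
    refine ((h4.fun_mul h2).fun_mul h3.exp).congr_deriv ?_
    ring
  · refine cs_int (by fun_prop) (fun x hx => by rw [z0 x hx]; ring) _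
  · intro i
    refine cs_int (by fun_prop) (fun x hx => by rw [z0 x hx]; ring) _
  · intro i
    refine cs_int (by fun_prop) (fun x hx => by rw [z0 x hx]; ring) _
end

end

section

open MeasureTheory ProbabilityTheory Filter Matrix
open scoped NNReal ENNReal
noncomputable section
set_option linter.unusedSectionVars false

theorem cint {n : ℕ} (hn : 0 < n) {τ : ℝ} (hτ : 0 < τ) (hτ1 : τ < 1) (hb : 4 * τ ^ 2 ≤ n * (1 - τ) ^ 2) (g)
    {f : (Fin n → ℝ) → ℝ} (hf : Continuous f) : Integrable f (muG n τ g) := by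
  haveI hp := muG_prob hn hτ hτ1 hb g
  obtain ⟨C, hC⟩ := (ball_compact n n).exists_bound_of_continuousOn hf.continuousOn
  refine Integrable.of_bound hf.aestronglyMeasurable C ?_
  filter_upwards [muG_ae n τ g] with x hx
  exact hC x hx

theorem Qb {n : ℕ} (hn : 0 < n) {τ : ℝ} (hτ : 0 < τ) (hτ1 : τ < 1) (hb : 4 * τ ^ 2 ≤ n * (1 - τ) ^ 2) (g) (u : Fin n → ℝ) :
    0 ≤ rho1 n τ 1 g ∧ ∫ x, (u ⬝ᵥ x) ^ 2 ∂muG n τ g ≤ (u ⬝ᵥ u) * (√n * (1 + rho1 n τ 1 g)) := by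
  haveI hp := muG_prob hn hτ hτ1 hb g
  have hn' : (0:ℝ) < n := by exact_mod_cast hn
  have ci := fun (f : (Fin n → ℝ) → ℝ) (hf : Continuous f) => cint hn hτ hτ1 hb g hf
  obtain ⟨M, hM⟩ : ∃ M : Fin n → Fin n → ℝ, M = fun i j => ∫ x, x i * x j ∂muG n τ g := ⟨_, rfl⟩
  have hMi : ∀ i j, ∫ x, x i * x j ∂muG n τ g = M i j := fun i j => by rw [hM]
  have e1 : ∫ x, (u ⬝ᵥ x) ^ 2 ∂muG n τ g = ∑ i, ∑ j, u i * u j * M i j := by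
    have : ∀ x : Fin n → ℝ, (u ⬝ᵥ x) ^ 2 = ∑ i, ∑ j, u i * u j * (x i * x j) := fun x => by
      unfold dotProduct
      rw [sq, Finset.sum_mul_sum]
      refine Finset.sum_congr rfl fun i _ => Finset.sum_congr rfl fun j _ => by ring
    simp_rw [this]
    rw [integral_finsetSum _ fun i _ => ci _ (by fun_prop)]
    refine Finset.sum_congr rfl fun i _ => ?_
    rw [integral_finsetSum _ fun i _ => ci _ (by fun_prop)]
    refine Finset.sum_congr rfl fun j _ => ?_
    rw [integral_const_mul, hMi]
  have e2 : n * rho1 n τ 1 g = ∑ i, ∑ j, M i j ^ 2 := by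
    rw [← muG_rho hn hτ g]
    have h1 : ∀ x : Fin n → ℝ, ∫ y, (x ⬝ᵥ y) ^ 2 / n ∂muG n τ g = ∑ i, ∑ j, M i j / n * (x i * x j) := fun x => by
      have : ∀ y : Fin n → ℝ, (x ⬝ᵥ y) ^ 2 / n = ∑ i, ∑ j, (x i * x j / n) * (y i * y j) := fun y => by
        unfold dotProduct
        rw [sq, Finset.sum_mul_sum, Finset.sum_div]
        refine Finset.sum_congr rfl fun i _ => ?_
        rw [Finset.sum_div]
        refine Finset.sum_congr rfl fun j _ => by ring
      simp_rw [this]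
      rw [integral_finsetSum _ fun i _ => ci _ (by fun_prop)]
      refine Finset.sum_congr rfl fun i _ => ?_
      rw [integral_finsetSum _ fun i _ => ci _ (by fun_prop)]
      refine Finset.sum_congr rfl fun j _ => ?_
      rw [integral_const_mul, hMi]; ring
    simp_rw [h1]
    rw [integral_finsetSum _ fun i _ => ci _ (by fun_prop), Finset.mul_sum]
    refine Finset.sum_congr rfl fun i _ => ?_
    rw [integral_finsetSum _ fun i _ => ci _ (by fun_prop), Finset.mul_sum]
    refine Finset.sum_congr rfl fun j _ => ?_
    rw [integral_const_mul, hMi]; field_simp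
  have e3 : (∑ i, ∑ j, u i * u j * M i j) ^ 2 ≤ (u ⬝ᵥ u) ^ 2 * (n * rho1 n τ 1 g) := by
    rw [e2]
    have := Finset.sum_mul_sq_le_sq_mul_sq (Finset.univ : Finset (Fin n × Fin n)) (fun p => u p.1 * u p.2) (fun p => M p.1 p.2)
    simp only [Fintype.sum_prod_type] at this
    refine this.trans (le_of_eq ?_)
    congr 1
    unfold dotProduct
    rw [sq (∑ i, _), Finset.sum_mul_sum]
    refine Finset.sum_congr rfl fun i _ => Finset.sum_congr rfl fun j _ => by ring
  have hρ : 0 ≤ rho1 n τ 1 g := by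
    have : 0 ≤ n * rho1 n τ 1 g := by rw [e2]; positivity
    exact nonneg_of_mul_nonneg_right this hn'
  refine ⟨hρ, ?_⟩
  rw [e1]
  have hU := sq_nn u
  refine (abs_le_of_sq_le_sq' ?_ (by positivity)).2
  refine e3.trans ?_
  rw [mul_pow, mul_pow, Real.sq_sqrt hn'.le]
  gcongr
  nlinarith

end

end

section

open MeasureTheory ProbabilityTheory Filter Matrix
open scoped NNReal ENNReal
noncomputable section
set_option linter.unusedSectionVars false

def uv (n : ℕ) (τ : ℝ) (g : Fin n × Fin n → ℝ) (s : Fin n → ℝ) : Fin n → ℝ :=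
  fun i => ∫ x : Fin n → ℝ, ch n x ^ 2 * (s ⬝ᵥ x) * x i ∂muG n τ g

def Xs (n : ℕ) (τ : ℝ) (g : Fin n × Fin n → ℝ) (s : Fin n → ℝ) : ℝ :=
  ∫ x : Fin n → ℝ, ch n x ^ 2 * (s ⬝ᵥ x) ^ 2 / n ∂muG n τ g

def As (n : ℕ) (τ : ℝ) (g : Fin n × Fin n → ℝ) : ℝ := ∫ x : Fin n → ℝ, ch n x ^ 2 ∂muG n τ g

def ms (n : ℕ) (τ : ℝ) (g : Fin n × Fin n → ℝ) : ℝ := ∫ x : Fin n → ℝ, ch n x ^ 2 * (x ⬝ᵥ x / n) ∂muG n τ g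

def ds (n : ℕ) (τ : ℝ) (g : Fin n × Fin n → ℝ) (s : Fin n → ℝ) : ℝ :=
  ∫ x : Fin n → ℝ, (x ⬝ᵥ x / n - τ) ^ 2 * (s ⬝ᵥ x) ^ 2 ∂muG n τ g

def E1 (n : ℕ) (τ : ℝ) (g : Fin n × Fin n → ℝ) (s : Fin n → ℝ) : ℝ :=
  ∫ x : Fin n → ℝ, ch n x ^ 2 * (x ⬝ᵥ x / n - τ) * (s ⬝ᵥ x) * (uv n τ g s ⬝ᵥ x) ∂muG n τ g

def E2 (n : ℕ) (τ : ℝ) (g : Fin n × Fin n → ℝ) (s : Fin n → ℝ) : ℝ :=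
  ∫ x : Fin n → ℝ, ch n x * (s ⬝ᵥ x) * (uv n τ g s ⬝ᵥ x) ∂muG n τ g


theorem uv_dot {n : ℕ} (hn : 0 < n) {τ : ℝ} (hτ : 0 < τ) (hτ1 : τ < 1) (hb : 4 * τ ^ 2 ≤ n * (1 - τ) ^ 2) (g : Fin n × Fin n → ℝ) (s : Fin n → ℝ) (v : Fin n → ℝ) : v ⬝ᵥ uv n τ g s = ∫ x, (v ⬝ᵥ x) * (ch n x ^ 2 * (s ⬝ᵥ x)) ∂muG n τ g := by
  have c1 := cont_dot s
  have c3 := cont_ch n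
  have e : ∀ x : Fin n → ℝ, (v ⬝ᵥ x) * (ch n x ^ 2 * (s ⬝ᵥ x)) = ∑ i, v i * (ch n x ^ 2 * (s ⬝ᵥ x) * x i) := fun x => by
    have : v ⬝ᵥ x = ∑ i, v i * x i := rfl
    rw [this, Finset.sum_mul]
    refine Finset.sum_congr rfl fun i _ => by ring
  simp_rw [e]
  rw [integral_finsetSum _ fun i _ => cint hn hτ hτ1 hb g (by fun_prop)]
  simp_rw [integral_const_mul]
  rfl

theorem uv_s {n : ℕ} (hn : 0 < n) {τ : ℝ} (hτ : 0 < τ) (hτ1 : τ < 1) (hb : 4 * τ ^ 2 ≤ n * (1 - τ) ^ 2) (g : Fin n × Fin n → ℝ) (s : Fin n → ℝ) : s ⬝ᵥ uv n τ g s = n * Xs n τ g s := by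
  have hn' : (n:ℝ) ≠ 0 := by exact_mod_cast hn.ne'
  rw [uv_dot hn hτ hτ1 hb]; unfold Xs
  rw [← integral_const_mul]
  refine integral_congr_ae (ae_of_all _ fun x => ?_)
  simp only; field_simp

theorem J_id {n : ℕ} (hn : 0 < n) {τ : ℝ} (hτ : 0 < τ) (hτ1 : τ < 1) (hb : 4 * τ ^ 2 ≤ n * (1 - τ) ^ 2) (g : Fin n × Fin n → ℝ) (s : Fin n → ℝ) : τ * (2 * Jg n g (uv n τ g s)) = (1 + τ ^ 2) * (uv n τ g s ⬝ᵥ uv n τ g s) - τ * As n τ g * (n * Xs n τ g s)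
    + τ * (5 * E1 n τ g s + 4 / n * E2 n τ g s) := by
  have hn' : (n:ℝ) ≠ 0 := by exact_mod_cast hn.ne'
  haveI hp := muG_prob hn hτ hτ1 hb g
  have hX := uv_s hn hτ hτ1 hb g s
  obtain ⟨u, hu⟩ : ∃ u, u = uv n τ g s := ⟨_, rfl⟩
  have c1 := cont_dot s
  have c2 := cont_sq (n := n)
  have c3 := cont_ch n
  have c4 := cont_dot u
  have ci := fun (f : (Fin n → ℝ) → ℝ) (hf : Continuous f) => cint hn hτ hτ1 hb g hf
  have cW : Continuous fun x => Wv n g u x := by unfold Wv; fun_prop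
  have hW : ∫ x, ch n x ^ 2 * (s ⬝ᵥ x) * Wv n g u x ∂muG n τ g = 2 * Jg n g u := by
    have e : ∀ x : Fin n → ℝ, ch n x ^ 2 * (s ⬝ᵥ x) * Wv n g u x = ((fun j => ∑ i, u i * wg n g i j) ⬝ᵥ x) * (ch n x ^ 2 * (s ⬝ᵥ x)) := fun x => by
      rw [mul_comm]; congr 1
      unfold Wv dotProduct
      simp_rw [Finset.mul_sum, Finset.sum_mul]
      rw [Finset.sum_comm]
      refine Finset.sum_congr rfl fun i _ => Finset.sum_congr rfl fun j _ => by ring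
    simp_rw [e]
    rw [← uv_dot hn hτ hτ1 hb, ← hu, Jg_eq]
    unfold dotProduct
    simp_rw [Finset.sum_mul]
    rw [Finset.sum_comm, ← mul_assoc]
    norm_num
    refine Finset.sum_congr rfl fun i _ => Finset.sum_congr rfl fun j _ => by ring
  have key := ibp hn hτ hτ1 hb g s u
  rw [← uv_dot hn hτ hτ1 hb, ← hu] at key
  have e : ∀ x : Fin n → ℝ, (-(4 / n) * ch n x * (u ⬝ᵥ x) * (s ⬝ᵥ x) + ch n x ^ 2 * (u ⬝ᵥ s) +
      ch n x ^ 2 * (s ⬝ᵥ x) * (-(x ⬝ᵥ x) / n * (u ⬝ᵥ x) + Wv n g u x - 4 * (x ⬝ᵥ x / n - τ) * (u ⬝ᵥ x))) =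
      (-(4 / n)) * (ch n x * (s ⬝ᵥ x) * (u ⬝ᵥ x)) + (u ⬝ᵥ s) * ch n x ^ 2 + ch n x ^ 2 * (s ⬝ᵥ x) * Wv n g u x
       + (-τ) * ((u ⬝ᵥ x) * (ch n x ^ 2 * (s ⬝ᵥ x))) + (-5) * (ch n x ^ 2 * (x ⬝ᵥ x / n - τ) * (s ⬝ᵥ x) * (u ⬝ᵥ x)) := fun x => by ring
  simp_rw [e] at key
  rw [integral_add (ci _ (by fun_prop)) (ci _ (by fun_prop)), integral_add (ci _ (by fun_prop)) (ci _ (by fun_prop)),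
    integral_add (ci _ (by fun_prop)) (ci _ (by fun_prop)), integral_add (ci _ (by fun_prop)) (ci _ (by fun_prop)),
    integral_const_mul, integral_const_mul, integral_const_mul, integral_const_mul, hW, ← uv_dot hn hτ hτ1 hb, ← hu] at key
  have f1 : ∫ x, ch n x * (s ⬝ᵥ x) * (u ⬝ᵥ x) ∂muG n τ g = E2 n τ g s := by rw [hu]; rfl
  have f2 : ∫ x : Fin n → ℝ, ch n x ^ 2 * (x ⬝ᵥ x / n - τ) * (s ⬝ᵥ x) * (u ⬝ᵥ x) ∂muG n τ g = E1 n τ g s := by rw [hu]; rfl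
  have f3 : ∫ x : Fin n → ℝ, ch n x ^ 2 ∂muG n τ g = As n τ g := rfl
  rw [f1, f2, f3] at key
  rw [← hu] at hX ⊢
  have hX' : u ⬝ᵥ s = n * Xs n τ g s := by rw [dotProduct_comm]; exact hX
  rw [hX'] at key
  linear_combination -key

/-- weighted AM-GM under the Gibbs measure -/
theorem amgm_mu {n : ℕ} (hn : 0 < n) {τ : ℝ} (hτ : 0 < τ) (hτ1 : τ < 1) (hb : 4 * τ ^ 2 ≤ n * (1 - τ) ^ 2) (g : Fin n × Fin n → ℝ) {f h : (Fin n → ℝ) → ℝ} (hf : Continuous f) (hh : Continuous h) {β : ℝ} (hβ : 0 < β) :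
    |∫ x, f x * h x ∂muG n τ g| ≤ 1 / 2 * (β * ∫ x, f x ^ 2 ∂muG n τ g + 1 / β * ∫ x, h x ^ 2 ∂muG n τ g) := by
  have ci := fun (f : (Fin n → ℝ) → ℝ) (hf : Continuous f) => cint hn hτ hτ1 hb g hf
  refine (abs_integral_le_integral_abs).trans ?_
  have h2 : ∫ x, |f x * h x| ∂muG n τ g ≤ ∫ x, (1 / 2 * (β * f x ^ 2) + 1 / 2 * (1 / β * h x ^ 2)) ∂muG n τ g := by
    refine integral_mono (ci _ (by fun_prop)) (ci _ (by fun_prop)) fun x => ?_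
    simp only
    have h0 : 0 ≤ 1 / β * (β * |f x| - |h x|) ^ 2 := by positivity
    have h1 : 1 / β * (β * |f x| - |h x|) ^ 2 = β * f x ^ 2 - 2 * (|f x| * |h x|) + 1 / β * h x ^ 2 := by
      rw [← sq_abs (f x), ← sq_abs (h x)]
      field_simp; ring
    rw [abs_mul]
    linarith
  refine h2.trans (le_of_eq ?_)
  rw [integral_add (ci _ (by fun_prop)) (ci _ (by fun_prop))]
  simp_rw [integral_const_mul]
  ring

theorem E1_le {n : ℕ} (hn : 0 < n) {τ : ℝ} (hτ : 0 < τ) (hτ1 : τ < 1) (hb : 4 * τ ^ 2 ≤ n * (1 - τ) ^ 2) (g : Fin n × Fin n → ℝ) (s : Fin n → ℝ) {β : ℝ} (hβ : 0 < β) : |E1 n τ g s| ≤ 1 / 2 * (β * ds n τ g s + 1 / β *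
    ((uv n τ g s ⬝ᵥ uv n τ g s) * (√n * (1 + rho1 n τ 1 g)))) := by
  have c1 := cont_dot s
  have c2 := cont_sq (n := n)
  have c3 := cont_ch n
  have c4 := cont_dot (uv n τ g s)
  have h := amgm_mu hn hτ hτ1 hb g (f := fun x => (x ⬝ᵥ x / n - τ) * (s ⬝ᵥ x)) (h := fun x => ch n x ^ 2 * (uv n τ g s ⬝ᵥ x)) (by fun_prop) (by fun_prop) hβ
  have e : E1 n τ g s = ∫ x : Fin n → ℝ, (x ⬝ᵥ x / n - τ) * (s ⬝ᵥ x) * (ch n x ^ 2 * (uv n τ g s ⬝ᵥ x)) ∂muG n τ g := by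
    unfold E1; refine integral_congr_ae (ae_of_all _ fun x => ?_); simp only; ring
  rw [e]
  refine h.trans ?_
  have h1 : ∫ x : Fin n → ℝ, ((x ⬝ᵥ x / n - τ) * (s ⬝ᵥ x)) ^ 2 ∂muG n τ g = ds n τ g s := by
    unfold ds; refine integral_congr_ae (ae_of_all _ fun x => ?_); simp only; ring
  have h2 : ∫ x, (ch n x ^ 2 * (uv n τ g s ⬝ᵥ x)) ^ 2 ∂muG n τ g ≤ (uv n τ g s ⬝ᵥ uv n τ g s) * (√n * (1 + rho1 n τ 1 g)) := by
    refine le_trans ?_ (Qb hn hτ hτ1 hb g _).2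
    refine integral_mono (cint hn hτ hτ1 hb g (by fun_prop)) (cint hn hτ hτ1 hb g (by fun_prop)) fun x => ?_
    simp only
    rw [mul_pow]
    have : (ch n x ^ 2) ^ 2 ≤ 1 := pow_le_one₀ (by positivity) (pow_le_one₀ (ch_nn n x) (ch_le n x))
    nlinarith [sq_nonneg (uv n τ g s ⬝ᵥ x)]
  rw [h1]
  gcongr

theorem E2_le {n : ℕ} (hn : 0 < n) {τ : ℝ} (hτ : 0 < τ) (hτ1 : τ < 1) (hb : 4 * τ ^ 2 ≤ n * (1 - τ) ^ 2) (g : Fin n × Fin n → ℝ) (s : Fin n → ℝ) {β : ℝ} (hβ : 0 < β) : |E2 n τ g s| ≤ 1 / 2 * (β * ((uv n τ g s ⬝ᵥ uv n τ g s) * (√n * (1 + rho1 n τ 1 g)))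
     + 1 / β * ((s ⬝ᵥ s) * (√n * (1 + rho1 n τ 1 g)))) := by
  have c1 := cont_dot s
  have c3 := cont_ch n
  have c4 := cont_dot (uv n τ g s)
  have h := amgm_mu hn hτ hτ1 hb g (f := fun x => (uv n τ g s ⬝ᵥ x)) (h := fun x => ch n x * (s ⬝ᵥ x)) (by fun_prop) (by fun_prop) hβ
  have e : E2 n τ g s = ∫ x : Fin n → ℝ, (uv n τ g s ⬝ᵥ x) * (ch n x * (s ⬝ᵥ x)) ∂muG n τ g := by
    unfold E2; refine integral_congr_ae (ae_of_all _ fun x => ?_); simp only; ring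
  rw [e]
  refine h.trans ?_
  have h1 := (Qb hn hτ hτ1 hb g (uv n τ g s)).2
  have h2 : ∫ x, (ch n x * (s ⬝ᵥ x)) ^ 2 ∂muG n τ g ≤ (s ⬝ᵥ s) * (√n * (1 + rho1 n τ 1 g)) := by
    refine le_trans ?_ (Qb hn hτ hτ1 hb g _).2
    refine integral_mono (cint hn hτ hτ1 hb g (by fun_prop)) (cint hn hτ hτ1 hb g (by fun_prop)) fun x => ?_
    simp only
    rw [mul_pow]
    have : ch n x ^ 2 ≤ 1 := pow_le_one₀ (ch_nn n x) (ch_le n x)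
    nlinarith [sq_nonneg (s ⬝ᵥ x)]
  gcongr

theorem ms_As {n : ℕ} (hn : 0 < n) {τ : ℝ} (hτ : 0 < τ) (hτ1 : τ < 1) (hb : 4 * τ ^ 2 ≤ n * (1 - τ) ^ 2) (g : Fin n × Fin n → ℝ) : (ms n τ g - τ * As n τ g) ^ 2 * n ≤ dd1 n τ 1 g := by
  haveI hp := muG_prob hn hτ hτ1 hb g
  have hn' : (0:ℝ) < n := by exact_mod_cast hn
  have c2 := cont_sq (n := n)
  have c3 := cont_ch n
  have ci := fun (f : (Fin n → ℝ) → ℝ) (hf : Continuous f) => cint hn hτ hτ1 hb g hf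
  have e : ms n τ g - τ * As n τ g = ∫ x : Fin n → ℝ, ch n x ^ 2 * (x ⬝ᵥ x / n - τ) ∂muG n τ g := by
    unfold ms As
    rw [← integral_const_mul, ← integral_sub (ci _ (by fun_prop)) (ci _ (by fun_prop))]
    refine integral_congr_ae (ae_of_all _ fun x => ?_); simp only; ring
  rw [e, ← muG_dd, integral_const_mul]
  obtain ⟨a, ha⟩ : ∃ a, a = ∫ x : Fin n → ℝ, ch n x ^ 2 * (x ⬝ᵥ x / n - τ) ∂muG n τ g := ⟨_, rfl⟩
  rw [← ha]
  have h1 : ∫ x : Fin n → ℝ, (2 * a * (ch n x ^ 2 * (x ⬝ᵥ x / n - τ)) - a ^ 2) ∂muG n τ g ≤ ∫ x : Fin n → ℝ, (x ⬝ᵥ x / n - τ) ^ 2 ∂muG n τ g := by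
    refine integral_mono (ci _ (by fun_prop)) (ci _ (by fun_prop)) fun x => ?_
    simp only
    have h3 : (ch n x ^ 2) ^ 2 ≤ 1 := pow_le_one₀ (by positivity) (pow_le_one₀ (ch_nn n x) (ch_le n x))
    nlinarith [sq_nonneg (a - ch n x ^ 2 * (x ⬝ᵥ x / n - τ)), mul_nonneg (sub_nonneg.2 h3) (sq_nonneg (x ⬝ᵥ x / n - τ))]
  rw [integral_sub (ci _ (by fun_prop)) (integrable_const _), integral_const_mul, ← ha] at h1
  simp at h1
  nlinarith

theorem As_near {n : ℕ} (hn : 0 < n) {τ : ℝ} (hτ : 0 < τ) (hτ1 : τ < 1) (hb : 4 * τ ^ 2 ≤ n * (1 - τ) ^ 2) (g : Fin n × Fin n → ℝ) : |As n τ g - (1 - τ) ^ 2| * √n ≤ 1 + dd1 n τ 1 g := by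
  haveI hp := muG_prob hn hτ hτ1 hb g
  have hn' : (0:ℝ) < n := by exact_mod_cast hn
  have c2 := cont_sq (n := n)
  have c3 := cont_ch n
  have ci := fun (f : (Fin n → ℝ) → ℝ) (hf : Continuous f) => cint hn hτ hτ1 hb g hf
  have e : As n τ g - (1 - τ) ^ 2 = ∫ x : Fin n → ℝ, (ch n x ^ 2 - (1 - τ) ^ 2) ∂muG n τ g := by
    unfold As
    rw [integral_sub (ci _ (by fun_prop)) (integrable_const _)]; simp
  have hs := Real.sq_sqrt hn'.le
  have hs0 : 0 < √n := Real.sqrt_pos.2 hn'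
  rw [e, ← muG_dd]
  rw [mul_comm]
  have h1 : |∫ x : Fin n → ℝ, (ch n x ^ 2 - (1 - τ) ^ 2) ∂muG n τ g| ≤ ∫ x : Fin n → ℝ, |ch n x ^ 2 - (1 - τ) ^ 2| ∂muG n τ g := abs_integral_le_integral_abs
  refine (mul_le_mul_of_nonneg_left h1 hs0.le).trans ?_
  rw [← integral_const_mul]
  have h2 : (1:ℝ) + ∫ x : Fin n → ℝ, n * (x ⬝ᵥ x / n - τ) ^ 2 ∂muG n τ g = ∫ x : Fin n → ℝ, (1 + n * (x ⬝ᵥ x / n - τ) ^ 2) ∂muG n τ g := by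
    rw [integral_add (integrable_const _) (ci _ (by fun_prop))]; simp
  rw [h2]
  refine integral_mono (ci _ (by fun_prop)) (ci _ (by fun_prop)) fun x => ?_
  simp only
  have h3 : |ch n x ^ 2 - (1 - τ) ^ 2| ≤ 2 * |x ⬝ᵥ x / n - τ| := by
    have a1 : |ch n x - (1 - τ)| ≤ |x ⬝ᵥ x / n - τ| := by
      unfold ch
      have := abs_max_sub_max_le_abs (1 - x ⬝ᵥ x / n) (1 - τ) 0
      rw [max_eq_left (a := 1 - τ) (by linarith)] at this
      refine this.trans (le_of_eq ?_)
      rw [abs_sub_comm]; congr 1; ring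
    have a2 : |ch n x + (1 - τ)| ≤ 2 := by
      have := ch_nn n x; have := ch_le n x
      rw [abs_le]; constructor <;> linarith
    have : ch n x ^ 2 - (1 - τ) ^ 2 = (ch n x + (1 - τ)) * (ch n x - (1 - τ)) := by ring
    rw [this, abs_mul]
    gcongr
  have h4 : (√n * |x ⬝ᵥ x / n - τ|) ^ 2 = n * (x ⬝ᵥ x / n - τ) ^ 2 := by rw [mul_pow, hs, sq_abs]
  nlinarith [sq_nonneg (√n * |x ⬝ᵥ x / n - τ| - 1)]

end

end

section

open MeasureTheory ProbabilityTheory Filter Matrix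
open scoped NNReal ENNReal
noncomputable section
set_option linter.unusedSectionVars false

theorem good_core {n N e S U X y F1 F2 d r x0 : ℝ} (hN : 0 < N) (he : 0 < e) (he1 : e ≤ 1) (h1 : e ^ 2 * N = 1) (h2 : N ^ 2 = n)
    (hS : 0 < S) (hU : 0 < U) (hr : 1 ≤ r) (hd : 0 ≤ d) (hx0 : 0 < x0) (hX : x0 ≤ X) (hXU : n * X ^ 2 ≤ S * U)
    (hF1 : ∀ β, 0 < β → |F1| ≤ 1 / 2 * (β * d + 1 / β * (U * (N * r))))
    (hF2 : ∀ β, 0 < β → |F2| ≤ 1 / 2 * (β * (U * (N * r)) + 1 / β * (n * S * (N * r)))) :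
    -(e * U * ((1 / x0 + 7 * (1 + 1 / x0 ^ 2)) * (S ^ 2 + n * y ^ 2 + d + S * r))) ≤ n * X * y + (5 * F1 + 4 / n * F2) := by
  have hn : 0 < n := by rw [← h2]; positivity
  have hen : e ^ 4 * n = 1 := by rw [← h2]; linear_combination (e ^ 2 * N + 1) * h1
  have hX0 : 0 < X := lt_of_lt_of_le hx0 hX
  have a0 : n * x0 ^ 2 ≤ S * U := by
    refine le_trans ?_ hXU; gcongr
  have hy : e ^ 2 * (n * y ^ 2) * e ^ 2 = y ^ 2 := by linear_combination y ^ 2 * hen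
  -- first term
  have b1 : n * X * |y| ≤ e * U * (1 / x0 * (S ^ 2 + n * y ^ 2)) := by
    have c1 : n * X * x0 ≤ S * U := by
      refine le_trans ?_ hXU
      nlinarith [mul_le_mul_of_nonneg_left hX (by positivity : 0 ≤ n * X)]
    have c2 : n * X ≤ S * U / x0 := by rw [le_div_iff₀ hx0]; exact c1
    have c3 : S * |y| ≤ e * (S ^ 2 + n * y ^ 2) := by
      have d1 : (e ^ 2 * N) * (S * |y|) ≤ e ^ 2 * ((S ^ 2 + (N * |y|) ^ 2)) := by
        nlinarith [sq_nonneg (S - N * |y|), sq_nonneg e, mul_nonneg (sq_nonneg e) (sq_nonneg (S - N * |y|)), mul_nonneg (sq_nonneg e) (sq_nonneg S), mul_nonneg (sq_nonneg e) (sq_nonneg (N * |y|))]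
      rw [h1, one_mul, mul_pow, h2, sq_abs] at d1
      refine d1.trans ?_
      have : e ^ 2 ≤ e := pow_le_of_le_one he.le he1 two_ne_zero
      gcongr
    calc n * X * |y| ≤ S * U / x0 * |y| := by gcongr
      _ = U / x0 * (S * |y|) := by ring
      _ ≤ U / x0 * (e * (S ^ 2 + n * y ^ 2)) := by gcongr
      _ = _ := by ring
  have b2 : |F1| ≤ e * U * ((1 + 1 / x0 ^ 2) * (d + S * r)) := by
    have c1 := hF1 (e * U) (by positivity)
    have c2 : 1 / (e * U) * (U * (N * r)) ≤ e * U * (S * r / x0 ^ 2) := by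
      have d1 : 1 / (e * U) * (U * (N * r)) = e * (n * x0 ^ 2) * r / x0 ^ 2 := by
        have : N = n * e ^ 2 := by rw [← h2]; linear_combination (-N) * h1
        rw [this]
        field_simp
      rw [d1]
      have : e * (n * x0 ^ 2) * r / x0 ^ 2 ≤ e * (S * U) * r / x0 ^ 2 := by gcongr
      refine this.trans (le_of_eq (by ring))
    have c3 : 0 ≤ e * U * d := by positivity
    have c4 : 0 ≤ e * U * (S * r) := by positivity
    have c5 : 0 ≤ e * U * (S * r / x0 ^ 2) := by positivity
    have c6 : 0 ≤ e * U * (d / x0 ^ 2) := by positivity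
    have : e * U * ((1 + 1 / x0 ^ 2) * (d + S * r)) = e * U * d + e * U * (S * r) + e * U * (S * r / x0 ^ 2) + e * U * (d / x0 ^ 2) := by ring
    rw [this]
    nlinarith
  have b3 : 4 / n * |F2| ≤ 2 * (e * U * ((1 + 1 / x0 ^ 2) * (S * r))) := by
    have c1 := hF2 S hS
    have hNn : N / n = e ^ 2 := by
      rw [div_eq_iff hn.ne', ← h2]; linear_combination (-N) * h1
    have c2 : 4 / n * |F2| ≤ 2 * (e ^ 2 * U * S * r + e ^ 2 * (n * r)) := by
      calc 4 / n * |F2| ≤ 4 / n * (1 / 2 * (S * (U * (N * r)) + 1 / S * (n * S * (N * r)))) := by gcongr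
        _ = 2 * ((N / n) * U * S * r + (N / n) * (n * r)) := by field_simp; ring
        _ = _ := by rw [hNn]
    refine c2.trans ?_
    have c3 : n * r ≤ S * U * r / x0 ^ 2 := by
      rw [le_div_iff₀ (by positivity)]
      nlinarith [mul_le_mul_of_nonneg_right a0 (by linarith : 0 ≤ r)]
    have : e ^ 2 ≤ e := pow_le_of_le_one he.le he1 two_ne_zero
    calc 2 * (e ^ 2 * U * S * r + e ^ 2 * (n * r)) ≤ 2 * (e * U * S * r + e * (S * U * r / x0 ^ 2)) := by gcongr
      _ = _ := by ring
  have hm1 : -(n * X * |y|) ≤ n * X * y := by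
    have := neg_abs_le y
    nlinarith [mul_le_mul_of_nonneg_left this (by positivity : 0 ≤ n * X)]
  have hm2 := neg_abs_le F1
  have hm3 : -(4 / n * |F2|) ≤ 4 / n * F2 := by
    have := neg_abs_le F2
    nlinarith [mul_le_mul_of_nonneg_left this (by positivity : 0 ≤ 4 / n)]
  have z1 : 0 ≤ e * U * (1 / x0 * (d + S * r)) := by positivity
  have z2 : 0 ≤ e * U * ((1 + 1 / x0 ^ 2) * (S ^ 2 + n * y ^ 2)) := by positivity
  have z3 : 0 ≤ e * U * ((1 + 1 / x0 ^ 2) * d) := by positivity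
  have z4 : 0 ≤ e * U * ((1 + 1 / x0 ^ 2) * (S * r)) := by positivity
  linarith
theorem e_y (e N y : ℝ) : (e ^ 2 * N) * |y| ≤ e ^ 2 * (1 + (N * |y|) ^ 2) := by
  rw [mul_assoc]
  refine mul_le_mul_of_nonneg_left ?_ (sq_nonneg e)
  nlinarith [sq_nonneg (N * |y| - 1), sq_nonneg (N * |y|)]

set_option maxHeartbeats 1000000 in
/-- Pointwise lower bound for the energy at an optimal shift. -/
theorem exists_V {c θ : ℝ} (hc : 0 < c) (hcθ : c < θ) (hθ : 1 < θ) :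
    ∃ K : ℝ, 0 ≤ K ∧ ∀ n : ℕ, ∀ e : ℝ, 0 < n → 0 < e → e ≤ 1 → e ^ 2 * √n = 1 → 4 * (1 / θ) ^ 2 ≤ n * (1 - 1 / θ) ^ 2 →
      ∀ (g : Fin n × Fin n → ℝ) (s : Fin n → ℝ), ∃ V : Fin n → ℝ, V ⬝ᵥ V ≤ n * (θ - c) ∧
        n * ((θ - c) * (θ + 1 / θ - c) / 2 - (θ - c) ^ 2 / 4) - n * (e * K * (1 + (s ⬝ᵥ s / n) ^ 2 + n * (θ * Xs n (1 / θ) g s - As n (1 / θ) g) ^ 2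
          + ds n (1 / θ) g s + (s ⬝ᵥ s / n) * (1 + rho1 n (1 / θ) 1 g) + dd1 n (1 / θ) 1 g)) ≤ Ev n c θ s g V := by
  have hθ0 : 0 < θ := by linarith
  obtain ⟨τ, hτd⟩ : ∃ τ, τ = 1 / θ := ⟨_, rfl⟩
  have hτθ : τ * θ = 1 := by rw [hτd]; field_simp
  have hτ : 0 < τ := by rw [hτd]; positivity
  have hτ1 : τ < 1 := by rw [hτd, div_lt_one hθ0]; exact hθ
  rw [← hτd]
  obtain ⟨G, hG⟩ : ∃ G, G = (θ - c) * (θ + τ - c) / 2 - (θ - c) ^ 2 / 4 := ⟨_, rfl⟩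
  rw [← hG]
  obtain ⟨χ0, hχ⟩ : ∃ χ0, χ0 = (1 - τ) ^ 2 := ⟨_, rfl⟩
  have hχ0 : 0 < χ0 := by
    rw [hχ]; have : 0 < 1 - τ := by linarith
    positivity
  obtain ⟨x0, hx⟩ : ∃ x0, x0 = χ0 * τ / 2 := ⟨_, rfl⟩
  have hx0 : 0 < x0 := by rw [hx]; positivity
  have hα : 0 < θ - c := by linarith
  obtain ⟨Ka, hKa⟩ : ∃ Ka, Ka = (θ - c) / 2 * (1 / x0 + 7 * (1 + 1 / x0 ^ 2)) := ⟨_, rfl⟩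
  obtain ⟨Kb, hKb⟩ : ∃ Kb, Kb = |G| * (2 / χ0) * 2 := ⟨_, rfl⟩
  have hKa0 : 0 ≤ Ka := by rw [hKa]; positivity
  have hKb0 : 0 ≤ Kb := by rw [hKb]; positivity
  refine ⟨Ka + Kb, by positivity, fun n e hn he he1 hen hb g s => ?_⟩
  have hn' : (0:ℝ) < n := by exact_mod_cast hn
  have hN : 0 < √(n:ℝ) := Real.sqrt_pos.2 hn'
  have hN2 : √(n:ℝ) ^ 2 = n := Real.sq_sqrt hn'.le
  have hd : 0 ≤ ds n τ g s := integral_nonneg fun x => by positivity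
  have hdd : 0 ≤ dd1 n τ 1 g := by rw [← muG_dd]; exact integral_nonneg fun x => by positivity
  have hρ := (Qb hn hτ hτ1 hb g 0).1
  have hSn := sq_nn s
  obtain ⟨S, hS⟩ : ∃ S, S = s ⬝ᵥ s / n := ⟨_, rfl⟩
  have hS0 : 0 ≤ S := by rw [hS]; positivity
  have hSs : s ⬝ᵥ s = n * S := by rw [hS]; field_simp
  have hX := uv_s hn hτ hτ1 hb g s
  have hJ := J_id hn hτ hτ1 hb g s
  have hE1 := fun β (hβ : 0 < β) => E1_le hn hτ hτ1 hb g s hβ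
  have hE2 := fun β (hβ : 0 < β) => E2_le hn hτ hτ1 hb g s hβ
  have hA := As_near hn hτ hτ1 hb g
  have hcs := dot_cs s (uv n τ g s)
  have hU0 := sq_nn (uv n τ g s)
  rw [← hS]
  rw [hX, hSs] at hcs
  simp only [hSs] at hE2
  rw [← hχ] at hA
  obtain ⟨u, hu⟩ : ∃ u, u = uv n τ g s := ⟨_, rfl⟩
  rw [← hu] at hX hJ hcs hU0
  simp only [← hu] at hE1 hE2
  obtain ⟨U, hUd⟩ : ∃ U, U = u ⬝ᵥ u := ⟨_, rfl⟩
  rw [← hUd] at hJ hcs hU0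
  simp only [← hUd] at hE1 hE2
  obtain ⟨r, hr⟩ : ∃ r, r = 1 + rho1 n τ 1 g := ⟨_, rfl⟩
  have hr1 : 1 ≤ r := by linarith
  rw [← hr]
  simp only [← hr] at hE1 hE2
  generalize ds n τ g s = d at *
  generalize dd1 n τ 1 g = D at *
  generalize Xs n τ g s = X at *
  generalize As n τ g = A at *
  generalize E1 n τ g s = F1 at *
  generalize E2 n τ g s = F2 at *
  obtain ⟨y, hy⟩ : ∃ y, y = θ * X - A := ⟨_, rfl⟩
  rw [← hy]
  have hW : 0 ≤ 1 + S ^ 2 + n * y ^ 2 + d + S * r + D := by positivity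
  by_cases hgood : x0 ≤ X
  · have hXp : 0 < X := lt_of_lt_of_le hx0 hgood
    have h1 : 0 < n * S * U := lt_of_lt_of_le (by positivity) hcs
    have hSp : 0 < S := by
      rcases hS0.lt_or_eq with h | h
      · exact h
      · rw [← h] at h1; simp at h1
    have hUp : 0 < U := by
      rcases hU0.lt_or_eq with h | h
      · exact h
      · rw [← h] at h1; simp at h1
    have hXU : n * X ^ 2 ≤ S * U := by
      have : n * (n * X ^ 2) ≤ n * (S * U) := by linarith
      exact le_of_mul_le_mul_left this hn'
    have core := good_core (y := y) hN he he1 hen hN2 hSp hUp hr1 hd hx0 hgood hXU hE1 hE2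
    obtain ⟨t, ht⟩ : ∃ t, t = √(n * (θ - c) / U) := ⟨_, rfl⟩
    have ht2 : t ^ 2 = n * (θ - c) / U := by rw [ht]; exact Real.sq_sqrt (by positivity)
    have ht2U : t ^ 2 * U = n * (θ - c) := by rw [ht2]; field_simp
    have hVV : (t • u) ⬝ᵥ (t • u) = n * (θ - c) := by
      rw [smul_dotProduct, dotProduct_smul, ← hUd, ← ht2U]; simp only [smul_eq_mul]; ring
    have hsV : s ⬝ᵥ (t • u) = t * (n * X) := by rw [dotProduct_smul, hX]; rfl
    have hJV : Jg n g (t • u) = t ^ 2 * Jg n g u := by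
      rw [Jg_eq, Jg_eq]; simp only [Pi.smul_apply, smul_eq_mul, Finset.mul_sum]
      refine Finset.sum_congr rfl fun i _ => Finset.sum_congr rfl fun j _ => by ring
    refine ⟨t • u, hVV.le, ?_⟩
    unfold Ev
    rw [hVV, hsV, hJV]
    have hJ2 : 2 * Jg n g u = (θ + τ) * U - A * (n * X) + (5 * F1 + 4 / n * F2) := by
      linear_combination θ * hJ - (2 * Jg n g u - τ * U + A * (n * X) - (5 * F1 + 4 / n * F2)) * hτθ
    have hJ3 : Jg n g u = ((θ + τ) * U - A * (n * X) + (5 * F1 + 4 / n * F2)) / 2 := by linarith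
    have eEv : -(n * (θ - c)) ^ 2 / (4 * n) - c * (n * (θ - c)) / 2 + t ^ 2 * Jg n g u + θ / (2 * n) * (t * (n * X)) ^ 2
        = n * G + t ^ 2 / 2 * (n * X * y + (5 * F1 + 4 / n * F2)) := by
      have e1 : -(n * (θ - c)) ^ 2 / (4 * (n:ℝ)) = - (n * (θ - c) ^ 2 / 4) := by field_simp
      have e2 : θ / (2 * n) * (t * (n * X)) ^ 2 = t ^ 2 / 2 * (n * X * (θ * X)) := by field_simp
      rw [e1, e2, hJ3, hG, hy]
      linear_combination ((θ + τ) / 2) * ht2U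
    rw [eEv]
    have m1 := mul_le_mul_of_nonneg_left core (by positivity : 0 ≤ t ^ 2 / 2)
    have m2 : t ^ 2 / 2 * -(e * U * ((1 / x0 + 7 * (1 + 1 / x0 ^ 2)) * (S ^ 2 + n * y ^ 2 + d + S * r))) = -(n * (e * Ka * (S ^ 2 + n * y ^ 2 + d + S * r))) := by
      rw [hKa]; linear_combination (-(1 / 2) * e * ((1 / x0 + 7 * (1 + 1 / x0 ^ 2)) * (S ^ 2 + n * y ^ 2 + d + S * r))) * ht2U
    rw [m2] at m1
    have m3 : n * (e * Ka * (S ^ 2 + n * y ^ 2 + d + S * r)) ≤ n * (e * (Ka + Kb) * (1 + S ^ 2 + n * y ^ 2 + d + S * r + D)) := by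
      have q1 : S ^ 2 + n * y ^ 2 + d + S * r ≤ 1 + S ^ 2 + n * y ^ 2 + d + S * r + D := by linarith
      have q2 : e * Ka ≤ e * (Ka + Kb) := by gcongr; linarith
      have q3 : 0 ≤ S ^ 2 + n * y ^ 2 + d + S * r := by positivity
      have q4 : 0 ≤ e * (Ka + Kb) := by positivity
      exact mul_le_mul_of_nonneg_left (mul_le_mul q2 q1 q3 q4) hn'.le
    linarith
  · push Not at hgood
    refine ⟨0, by simp only [dotProduct_zero]; positivity, ?_⟩
    have e0 : Ev n c θ s g 0 = 0 := by simp [Ev, Jg, ak]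
    rw [e0]
    have h1 : χ0 / 2 ≤ |y| + |A - χ0| := by
      have : θ * X < χ0 / 2 := by
        have : θ * X < θ * x0 := by gcongr
        have h3 : θ * x0 = χ0 / 2 := by rw [hx]; linear_combination (χ0 / 2) * hτθ
        linarith
      have a1 := neg_abs_le y
      have a2 := neg_abs_le (A - χ0)
      linarith
    have h2 : |y| ≤ e * (1 + n * y ^ 2) := by
      have d1 := e_y e (√n) y
      rw [hen, one_mul, mul_pow, hN2, sq_abs] at d1
      refine d1.trans ?_
      have : e ^ 2 ≤ e := pow_le_of_le_one he.le he1 two_ne_zero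
      gcongr
    have h3 : |A - χ0| ≤ e * (1 + D) := by
      have d1 := mul_le_mul_of_nonneg_left hA (sq_nonneg e)
      have d2 : e ^ 2 * (|A - χ0| * √n) = |A - χ0| := by linear_combination |A - χ0| * hen
      rw [d2] at d1
      refine d1.trans ?_
      have : e ^ 2 ≤ e := pow_le_of_le_one he.le he1 two_ne_zero
      gcongr
    have h4 : 1 ≤ 2 / χ0 * (|y| + |A - χ0|) := by
      have := mul_le_mul_of_nonneg_left h1 (by positivity : 0 ≤ 2 / χ0)
      have h5 : 2 / χ0 * (χ0 / 2) = 1 := by field_simp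
      linarith
    have h6 : G ≤ e * (Ka + Kb) * (1 + S ^ 2 + n * y ^ 2 + d + S * r + D) := by
      calc G ≤ |G| * 1 := by rw [mul_one]; exact le_abs_self _
        _ ≤ |G| * (2 / χ0 * (|y| + |A - χ0|)) := by gcongr
        _ ≤ |G| * (2 / χ0 * (e * (1 + n * y ^ 2) + e * (1 + D))) := by gcongr
        _ = e * (|G| * (2 / χ0)) * (2 + n * y ^ 2 + D) := by ring
        _ ≤ e * (|G| * (2 / χ0)) * (2 * (1 + S ^ 2 + n * y ^ 2 + d + S * r + D)) := by
          gcongr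
          have q1 : 0 ≤ S * r := by positivity
          have q2 := sq_nonneg S
          have q3 := mul_nonneg hn'.le (sq_nonneg y)
          linarith
        _ = e * Kb * (1 + S ^ 2 + n * y ^ 2 + d + S * r + D) := by rw [hKb]; ring
        _ ≤ _ := by gcongr; linarith
    have := mul_le_mul_of_nonneg_left h6 hn'.le
    linarith
end

end

section

open MeasureTheory ProbabilityTheory Filter Matrix
open scoped NNReal ENNReal
noncomputable section
set_option linter.unusedSectionVars false

/-- Fubini for Gaussian `s` against a probability measure, with a quartic bound. -/
theorem fub {E : Type*} [MeasurableSpace E] (ν : Measure E) [IsProbabilityMeasure ν] {n : ℕ} (F : E → (Fin n → ℝ) → ℝ)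
    (hF : Measurable (Function.uncurry F)) (C : ℝ) (hb : ∀ᵐ x ∂ν, ∀ s, |F x s| ≤ C * (1 + (s ⬝ᵥ s) ^ 2)) :
    Integrable (fun s => ∫ x, F x s ∂ν) (gaussPrior n 1) ∧
      ∫ s, ∫ x, F x s ∂ν ∂gaussPrior n 1 = ∫ x, ∫ s, F x s ∂gaussPrior n 1 ∂ν := by
  have hI : Integrable (Function.uncurry F) (ν.prod (gaussPrior n 1)) := by
    have hB : Integrable (fun s : Fin n → ℝ => C * (1 + (s ⬝ᵥ s) ^ 2)) (gaussPrior n 1) := ((integrable_const (1:ℝ)).add (sqsq_int n 1)).const_mul C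
    have hB2 : Integrable (fun p : E × (Fin n → ℝ) => C * (1 + (p.2 ⬝ᵥ p.2) ^ 2)) (ν.prod (gaussPrior n 1)) := hB.comp_snd ν
    refine hB2.mono' hF.aestronglyMeasurable ?_
    have h2 : ∀ᵐ p ∂ν.prod (gaussPrior n 1), ∀ s, |F p.1 s| ≤ C * (1 + (s ⬝ᵥ s) ^ 2) := Measure.quasiMeasurePreserving_fst.ae hb
    filter_upwards [h2] with p hp
    exact hp p.2
  refine ⟨hI.integral_prod_right, ?_⟩
  exact (integral_integral_swap hI).symm

theorem dot_meas2 {n : ℕ} : Measurable fun p : (Fin n → ℝ) × (Fin n → ℝ) => p.1 ⬝ᵥ p.2 := by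
  unfold dotProduct; fun_prop

theorem ds_mean {n : ℕ} (hn : 0 < n) {τ : ℝ} (hτ : 0 < τ) (hτ1 : τ < 1) (hb : 4 * τ ^ 2 ≤ n * (1 - τ) ^ 2) (g : Fin n × Fin n → ℝ) :
    Integrable (fun s => ds n τ g s) (gaussPrior n 1) ∧ ∫ s, ds n τ g s ∂gaussPrior n 1 ≤ dd1 n τ 1 g := by
  haveI hp := muG_prob hn hτ hτ1 hb g
  have hn' : (0:ℝ) < n := by exact_mod_cast hn
  have c2 := cont_sq (n := n)
  have hfub := fub (muG n τ g) (fun x s => (x ⬝ᵥ x / n - τ) ^ 2 * (s ⬝ᵥ x) ^ 2) ?_ ((1 + τ) ^ 2 * n) ?_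
  · obtain ⟨h1, h2⟩ := hfub
    refine ⟨h1, ?_⟩
    have e : ∫ s, ds n τ g s ∂gaussPrior n 1 = ∫ x : Fin n → ℝ, (x ⬝ᵥ x / n - τ) ^ 2 * (x ⬝ᵥ x) ∂muG n τ g := by
      refine h2.trans ?_
      refine integral_congr_ae (ae_of_all _ fun x => ?_)
      simp only
      rw [integral_const_mul]
      have := mom2 n one_pos x x
      rw [one_mul] at this
      rw [← this]
      congr 2
      ext s
      rw [sq, dotProduct_comm s x]
    rw [e, ← muG_dd]
    refine integral_mono_ae (cint hn hτ hτ1 hb g (by fun_prop)) (cint hn hτ hτ1 hb g (by fun_prop)) ?_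
    filter_upwards [muG_ae n τ g] with x hx
    nlinarith [sq_nonneg (x ⬝ᵥ x / n - τ)]
  · have m1 : Measurable fun p : (Fin n → ℝ) × (Fin n → ℝ) => p.1 ⬝ᵥ p.1 := sq_meas.comp measurable_fst
    have m2 : Measurable fun p : (Fin n → ℝ) × (Fin n → ℝ) => p.2 ⬝ᵥ p.1 := by unfold dotProduct; fun_prop
    exact (((m1.div_const _).sub_const τ).pow_const 2).mul (m2.pow_const 2)
  · filter_upwards [muG_ae n τ g] with x hx s
    have a1 := sq_nn x
    have a2 := sq_nn s
    have a3 : 0 ≤ x ⬝ᵥ x / n := by positivity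
    have a4 : x ⬝ᵥ x / n ≤ 1 := by rw [div_le_one hn']; exact hx
    have a5 : (x ⬝ᵥ x / n - τ) ^ 2 ≤ (1 + τ) ^ 2 := by nlinarith
    have a6 : (s ⬝ᵥ x) ^ 2 ≤ n * (1 + (s ⬝ᵥ s) ^ 2) := by
      refine (dot_cs s x).trans ?_
      nlinarith [sq_nonneg (s ⬝ᵥ s - 1), mul_le_mul_of_nonneg_left hx a2]
    rw [abs_of_nonneg (by positivity), mul_assoc]
    gcongr

theorem Xs_mean {n : ℕ} (hn : 0 < n) {τ : ℝ} (hτ : 0 < τ) (hτ1 : τ < 1) (hb : 4 * τ ^ 2 ≤ n * (1 - τ) ^ 2) (g : Fin n × Fin n → ℝ) :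
    Integrable (fun s => Xs n τ g s) (gaussPrior n 1) ∧ ∫ s, Xs n τ g s ∂gaussPrior n 1 = ms n τ g := by
  haveI hp := muG_prob hn hτ hτ1 hb g
  have hn' : (0:ℝ) < n := by exact_mod_cast hn
  have hfub := fub (muG n τ g) (fun x s => ch n x ^ 2 * (s ⬝ᵥ x) ^ 2 / n) ?_ 1 ?_
  · obtain ⟨h1, h2⟩ := hfub
    refine ⟨h1, h2.trans ?_⟩
    refine integral_congr_ae (ae_of_all _ fun x => ?_)
    simp only
    rw [integral_div, integral_const_mul]
    have := mom2 n one_pos x x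
    rw [one_mul] at this
    rw [← this, mul_div_assoc]
    congr 3
    ext s
    rw [sq, dotProduct_comm s x]
  · have m1 : Measurable fun p : (Fin n → ℝ) × (Fin n → ℝ) => ch n p.1 := (cont_ch n).measurable.comp measurable_fst
    have m2 : Measurable fun p : (Fin n → ℝ) × (Fin n → ℝ) => p.2 ⬝ᵥ p.1 := by unfold dotProduct; fun_prop
    exact ((m1.pow_const 2).mul (m2.pow_const 2)).div_const _
  · filter_upwards [muG_ae n τ g] with x hx s
    have a2 := sq_nn s
    have a5 : ch n x ^ 2 ≤ 1 := pow_le_one₀ (ch_nn n x) (ch_le n x)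
    have a6 : (s ⬝ᵥ x) ^ 2 ≤ (1 + (s ⬝ᵥ s) ^ 2) * n := by
      refine (dot_cs s x).trans ?_
      nlinarith [sq_nonneg (s ⬝ᵥ s - 1), mul_le_mul_of_nonneg_left hx a2]
    rw [abs_of_nonneg (by positivity), div_le_iff₀ hn', mul_assoc]
    gcongr

theorem Xs_var {n : ℕ} (hn : 0 < n) {τ : ℝ} (hτ : 0 < τ) (hτ1 : τ < 1) (hb : 4 * τ ^ 2 ≤ n * (1 - τ) ^ 2) (g : Fin n × Fin n → ℝ) :
    Integrable (fun s => n * (Xs n τ g s - ms n τ g) ^ 2) (gaussPrior n 1) ∧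
      ∫ s, n * (Xs n τ g s - ms n τ g) ^ 2 ∂gaussPrior n 1 ≤ 2 * rho1 n τ 1 g := by
  haveI hp := muG_prob hn hτ hτ1 hb g
  have hn' : (0:ℝ) < n := by exact_mod_cast hn
  obtain ⟨hX1, hX2⟩ := Xs_mean hn hτ hτ1 hb g
  have mF : Measurable fun p : (Fin n → ℝ) × (Fin n → ℝ) => p.2 ⬝ᵥ p.1 := by unfold dotProduct; fun_prop
  have hfub := fub ((muG n τ g).prod (muG n τ g)) (fun (q : (Fin n → ℝ) × (Fin n → ℝ)) s => (ch n q.1 ^ 2 * (s ⬝ᵥ q.1) ^ 2 / n) * (ch n q.2 ^ 2 * (s ⬝ᵥ q.2) ^ 2 / n)) ?_ 1 ?_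
  · obtain ⟨h1, h2⟩ := hfub
    have e1 : ∀ s, ∫ q, (ch n q.1 ^ 2 * (s ⬝ᵥ q.1) ^ 2 / n) * (ch n q.2 ^ 2 * (s ⬝ᵥ q.2) ^ 2 / n) ∂(muG n τ g).prod (muG n τ g) = Xs n τ g s ^ 2 := fun s => by
      rw [integral_prod_mul (fun x => ch n x ^ 2 * (s ⬝ᵥ x) ^ 2 / n) (fun x => ch n x ^ 2 * (s ⬝ᵥ x) ^ 2 / n), sq]; rfl
    simp only [e1] at h1 h2
    have e2 : ∀ s, n * (Xs n τ g s - ms n τ g) ^ 2 = (n * Xs n τ g s ^ 2 - 2 * n * ms n τ g * Xs n τ g s) + n * ms n τ g ^ 2 := fun s => by ring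
    simp_rw [e2]
    have i1 : Integrable (fun s => n * Xs n τ g s ^ 2 - 2 * n * ms n τ g * Xs n τ g s) (gaussPrior n 1) := (h1.const_mul _).sub (hX1.const_mul _)
    refine ⟨i1.add (integrable_const _), ?_⟩
    rw [integral_add i1 (integrable_const _), integral_sub (h1.const_mul _) (hX1.const_mul _), integral_const_mul, integral_const_mul, hX2, h2]
    have e3 : ∀ q : (Fin n → ℝ) × (Fin n → ℝ), ∫ s, (ch n q.1 ^ 2 * (s ⬝ᵥ q.1) ^ 2 / n) * (ch n q.2 ^ 2 * (s ⬝ᵥ q.2) ^ 2 / n) ∂gaussPrior n 1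
        = (ch n q.1 ^ 2 * (q.1 ⬝ᵥ q.1 / n)) * (ch n q.2 ^ 2 * (q.2 ⬝ᵥ q.2 / n)) + 2 / n ^ 2 * ch n q.1 ^ 2 * ch n q.2 ^ 2 * (q.1 ⬝ᵥ q.2) ^ 2 := fun q => by
      have f : ∀ s : Fin n → ℝ, (ch n q.1 ^ 2 * (s ⬝ᵥ q.1) ^ 2 / n) * (ch n q.2 ^ 2 * (s ⬝ᵥ q.2) ^ 2 / n) = (ch n q.1 ^ 2 * ch n q.2 ^ 2 / n ^ 2) * ((q.1 ⬝ᵥ s) ^ 2 * (q.2 ⬝ᵥ s) ^ 2) := fun s => by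
        rw [dotProduct_comm s, dotProduct_comm s]; field_simp
      simp_rw [f]
      rw [integral_const_mul, mom22 n one_pos]
      field_simp
    simp_rw [e3]
    have hball : ∀ᵐ q : (Fin n → ℝ) × (Fin n → ℝ) ∂(muG n τ g).prod (muG n τ g), q.1 ⬝ᵥ q.1 ≤ n ∧ q.2 ⬝ᵥ q.2 ≤ n := by
      filter_upwards [Measure.quasiMeasurePreserving_fst.ae (muG_ae n τ g), Measure.quasiMeasurePreserving_snd.ae (muG_ae n τ g)] with q a b
      exact ⟨a, b⟩
    have ca := cont_ch n
    have cb := cont_sq (n := n)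
    have cc : Continuous fun q : (Fin n → ℝ) × (Fin n → ℝ) => q.1 ⬝ᵥ q.2 := by unfold dotProduct; fun_prop
    have cd : Continuous fun q : (Fin n → ℝ) × (Fin n → ℝ) => q.1 ⬝ᵥ q.1 := cb.comp continuous_fst
    have ce : Continuous fun q : (Fin n → ℝ) × (Fin n → ℝ) => q.2 ⬝ᵥ q.2 := cb.comp continuous_snd
    have ci2 : ∀ F : (Fin n → ℝ) × (Fin n → ℝ) → ℝ, Continuous F → Integrable F ((muG n τ g).prod (muG n τ g)) := fun F hF => by
      obtain ⟨C, hC⟩ := ((ball_compact n n).prod (ball_compact n n)).exists_bound_of_continuousOn hF.continuousOn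
      refine Integrable.of_bound hF.aestronglyMeasurable C ?_
      filter_upwards [hball] with q hq
      exact hC q hq
    rw [integral_add (ci2 _ (by fun_prop)) (ci2 _ (by fun_prop)),
      integral_prod_mul (fun x : Fin n → ℝ => ch n x ^ 2 * (x ⬝ᵥ x / n)) (fun x : Fin n → ℝ => ch n x ^ 2 * (x ⬝ᵥ x / n))]
    have e4 : ∫ x : Fin n → ℝ, ch n x ^ 2 * (x ⬝ᵥ x / n) ∂muG n τ g = ms n τ g := rfl
    rw [e4]
    have e5 : ∫ q : (Fin n → ℝ) × (Fin n → ℝ), 2 / n ^ 2 * ch n q.1 ^ 2 * ch n q.2 ^ 2 * (q.1 ⬝ᵥ q.2) ^ 2 ∂(muG n τ g).prod (muG n τ g) ≤ 2 / n * rho1 n τ 1 g := by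
      rw [← muG_rho hn hτ g, ← integral_prod (fun q : (Fin n → ℝ) × (Fin n → ℝ) => (q.1 ⬝ᵥ q.2) ^ 2 / n) (ci2 _ (by fun_prop)), ← integral_const_mul]
      refine integral_mono (ci2 _ (by fun_prop)) (ci2 _ (by fun_prop)) fun q => ?_
      have a1 : ch n q.1 ^ 2 ≤ 1 := pow_le_one₀ (ch_nn n _) (ch_le n _)
      have a2 : ch n q.2 ^ 2 ≤ 1 := pow_le_one₀ (ch_nn n _) (ch_le n _)
      calc 2 / (n:ℝ) ^ 2 * ch n q.1 ^ 2 * ch n q.2 ^ 2 * (q.1 ⬝ᵥ q.2) ^ 2 ≤ 2 / (n:ℝ) ^ 2 * 1 * 1 * (q.1 ⬝ᵥ q.2) ^ 2 := by gcongr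
        _ = 2 / n * ((q.1 ⬝ᵥ q.2) ^ 2 / n) := by field_simp
    have e6 := mul_le_mul_of_nonneg_left e5 hn'.le
    have e7 : n * (2 / n * rho1 n τ 1 g) = 2 * rho1 n τ 1 g := by field_simp
    simp only [integral_const, probReal_univ, one_smul]
    nlinarith
  · have m1 : Measurable fun p : ((Fin n → ℝ) × (Fin n → ℝ)) × (Fin n → ℝ) => ch n p.1.1 := (cont_ch n).measurable.comp (measurable_fst.comp measurable_fst)
    have m2 : Measurable fun p : ((Fin n → ℝ) × (Fin n → ℝ)) × (Fin n → ℝ) => ch n p.1.2 := (cont_ch n).measurable.comp (measurable_snd.comp measurable_fst)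
    have m3 : Measurable fun p : ((Fin n → ℝ) × (Fin n → ℝ)) × (Fin n → ℝ) => p.2 ⬝ᵥ p.1.1 := by unfold dotProduct; fun_prop
    have m4 : Measurable fun p : ((Fin n → ℝ) × (Fin n → ℝ)) × (Fin n → ℝ) => p.2 ⬝ᵥ p.1.2 := by unfold dotProduct; fun_prop
    exact (((m1.pow_const 2).mul (m3.pow_const 2)).div_const _).mul (((m2.pow_const 2).mul (m4.pow_const 2)).div_const _)
  · filter_upwards [Measure.quasiMeasurePreserving_fst.ae (muG_ae n τ g), Measure.quasiMeasurePreserving_snd.ae (muG_ae n τ g)] with q ha hb' s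
    have a2 := sq_nn s
    have key : ∀ x : Fin n → ℝ, x ⬝ᵥ x ≤ n → ch n x ^ 2 * (s ⬝ᵥ x) ^ 2 / n ≤ s ⬝ᵥ s := fun x hx => by
      have a5 : ch n x ^ 2 ≤ 1 := pow_le_one₀ (ch_nn n x) (ch_le n x)
      rw [div_le_iff₀ hn']
      calc ch n x ^ 2 * (s ⬝ᵥ x) ^ 2 ≤ 1 * (s ⬝ᵥ x) ^ 2 := by gcongr
        _ ≤ (s ⬝ᵥ s) * (x ⬝ᵥ x) := by rw [one_mul]; exact dot_cs s x
        _ ≤ _ := by gcongr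
    rw [abs_of_nonneg (by positivity)]
    have := mul_le_mul (key _ ha) (key _ hb') (by positivity) a2
    refine this.trans ?_
    nlinarith
end

end

section

open MeasureTheory ProbabilityTheory Filter Matrix
open scoped NNReal ENNReal
noncomputable section
set_option linter.unusedSectionVars false

theorem Gav_cost {n : ℕ} (hn : 0 < n) {τ : ℝ} (hτ : 0 < τ) (hτ1 : τ < 1) (hb : 4 * τ ^ 2 ≤ n * (1 - τ) ^ 2) (g : Fin n × Fin n → ℝ) (V : Fin n → ℝ) {a : ℝ}
    (hV : V ⬝ᵥ V ≤ n * a) :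
    Gav (nu1 n τ 1) (L1 n 1 g) (fun z => (V ⬝ᵥ Tb n (n * 1) z) ^ 2 / n) ≤ a * (√n * (1 + rho1 n τ 1 g)) := by
  have hn' : (0:ℝ) < n := by exact_mod_cast hn
  have h1 : ∀ᵐ x ∂nu1 n τ 1, x ∈ ball n (n * 1) := nuW_ae n τ (n * 1) (w1 n τ)
  have e : Gav (nu1 n τ 1) (L1 n 1 g) (fun z => (V ⬝ᵥ Tb n (n * 1) z) ^ 2 / n) = ∫ z, (V ⬝ᵥ z) ^ 2 / n ∂muG n τ g := by
    rw [muG_int]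
    refine Gav_congr _ ?_
    filter_upwards [h1] with x hx
    rw [Tb_eq hx]
  rw [e, integral_div, div_le_iff₀ hn']
  obtain ⟨h0, h2⟩ := Qb hn hτ hτ1 hb g V
  refine h2.trans ?_
  have : 0 ≤ √n * (1 + rho1 n τ 1 g) := by positivity
  calc V ⬝ᵥ V * (√n * (1 + rho1 n τ 1 g)) ≤ n * a * (√n * (1 + rho1 n τ 1 g)) := by gcongr
    _ = _ := by ring

theorem lbB_slice {c θ : ℝ} (hc : 0 < c) (hcθ : c < θ) (hθ : 1 < θ) :
    ∃ C : ℝ, 0 ≤ C ∧ ∀ n : ℕ, ∀ e : ℝ, 0 < n → 0 < e → e ≤ 1 → e ^ 2 * √n = 1 → 4 * (1 / θ) ^ 2 ≤ n * (1 - 1 / θ) ^ 2 →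
      ∀ (g : Fin n × Fin n → ℝ), Integrable (fun s => Real.log (Zr n c θ s g)) (gaussPrior n 1) →
      (n / 2 * Real.log (c / θ) + n * ((θ - c) * (θ + 1 / θ - c) / 2 - (θ - c) ^ 2 / 4)) + Real.log (Z1 n (1 / θ) 1 g)
        - n * (e * C) * (1 + rho1 n (1 / θ) 1 g + dd1 n (1 / θ) 1 g) ≤ ∫ s, Real.log (Zr n c θ s g) ∂gaussPrior n 1 := by
  have hθ0 : 0 < θ := by linarith
  have hτ : 0 < 1 / θ := by positivity
  have hτ1 : 1 / θ < 1 := by rw [div_lt_one hθ0]; exact hθ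
  have hα : 0 < θ - c := by linarith
  obtain ⟨K, hK0, hK⟩ := exists_V hc hcθ hθ
  refine ⟨K * (5 + 4 * θ ^ 2) + (θ - c), by positivity, fun n e hn he he1 hen hb g hinteg => ?_⟩
  have hn' : (0:ℝ) < n := by exact_mod_cast hn
  have hn1 : (1:ℝ) ≤ n := by exact_mod_cast hn
  obtain ⟨B, hB⟩ : ∃ B, B = (n / 2 * Real.log (c / θ) + n * ((θ - c) * (θ + 1 / θ - c) / 2 - (θ - c) ^ 2 / 4)) + Real.log (Z1 n (1 / θ) 1 g) := ⟨_, rfl⟩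
  rw [← hB]
  have hρ := (Qb hn hτ hτ1 hb g 0).1
  have hdd : 0 ≤ dd1 n (1 / θ) 1 g := by rw [← muG_dd]; exact integral_nonneg fun x => by positivity
  obtain ⟨w, hw⟩ : ∃ w : (Fin n → ℝ) → ℝ, w = fun s => ((1 + dd1 n (1 / θ) 1 g + 2 * θ ^ 2 * dd1 n (1 / θ) 1 g) + 1 / (n:ℝ) ^ 2 * (s ⬝ᵥ s) ^ 2)
    + 2 * θ ^ 2 * (n * (Xs n (1 / θ) g s - ms n (1 / θ) g) ^ 2) + ds n (1 / θ) g s + (1 + rho1 n (1 / θ) 1 g) / n * (s ⬝ᵥ s) := ⟨_, rfl⟩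
  have hpt : ∀ s, (B - n * e * ((θ - c) * (1 + rho1 n (1 / θ) 1 g))) - n * e * K * w s ≤ Real.log (Zr n c θ s g) := by
    intro s
    obtain ⟨V, hV, hEv⟩ := hK n e hn he he1 hen hb g s
    have h1 := shift_lb hn hc hθ0 hτ1 hθ0.le hb s g V hV
    have h2 := Gav_cost hn hτ hτ1 hb g V hV
    have h3 : (θ - c) * (√n * (1 + rho1 n (1 / θ) 1 g)) ≤ n * e * ((θ - c) * (1 + rho1 n (1 / θ) 1 g)) := by
      have : √(n:ℝ) ≤ n * e := by
        have q1 : √(n:ℝ) ^ 2 = n := Real.sq_sqrt hn'.le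
        have q2 : √(n:ℝ) = n * e ^ 2 := by
          calc √(n:ℝ) = √(n:ℝ) * (e ^ 2 * √n) := by rw [hen, mul_one]
            _ = √(n:ℝ) ^ 2 * e ^ 2 := by ring
            _ = _ := by rw [q1]
        have q3 : e ^ 2 ≤ e := pow_le_of_le_one he.le he1 two_ne_zero
        calc √(n:ℝ) = n * e ^ 2 := q2
          _ ≤ _ := by gcongr
      calc (θ - c) * (√n * (1 + rho1 n (1 / θ) 1 g)) ≤ (θ - c) * (n * e * (1 + rho1 n (1 / θ) 1 g)) := by gcongr
        _ = _ := by ring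
    have h4 : n * (θ * Xs n (1 / θ) g s - As n (1 / θ) g) ^ 2 ≤ 2 * θ ^ 2 * (n * (Xs n (1 / θ) g s - ms n (1 / θ) g) ^ 2) + 2 * θ ^ 2 * dd1 n (1 / θ) 1 g := by
      have q := ms_As hn hτ hτ1 hb g
      have q2 : θ * Xs n (1 / θ) g s - As n (1 / θ) g = θ * (Xs n (1 / θ) g s - ms n (1 / θ) g) + θ * (ms n (1 / θ) g - 1 / θ * As n (1 / θ) g) := by
        field_simp; ring
      rw [q2]
      generalize Xs n (1 / θ) g s - ms n (1 / θ) g = a at *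
      generalize ms n (1 / θ) g - 1 / θ * As n (1 / θ) g = b at *
      have q3 : (θ * a + θ * b) ^ 2 ≤ 2 * θ ^ 2 * a ^ 2 + 2 * θ ^ 2 * b ^ 2 := by nlinarith [sq_nonneg (θ * a - θ * b)]
      have q4 := mul_le_mul_of_nonneg_left q3 hn'.le
      have q5 := mul_le_mul_of_nonneg_left q (by positivity : 0 ≤ 2 * θ ^ 2)
      linarith
    have h5 : n * (e * K * (1 + (s ⬝ᵥ s / n) ^ 2 + n * (θ * Xs n (1 / θ) g s - As n (1 / θ) g) ^ 2
          + ds n (1 / θ) g s + (s ⬝ᵥ s / n) * (1 + rho1 n (1 / θ) 1 g) + dd1 n (1 / θ) 1 g)) ≤ n * e * K * w s := by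
      rw [← mul_assoc, ← mul_assoc]
      refine mul_le_mul_of_nonneg_left ?_ (by positivity)
      rw [hw]
      have q1 : (s ⬝ᵥ s / n) ^ 2 = 1 / (n:ℝ) ^ 2 * (s ⬝ᵥ s) ^ 2 := by field_simp
      have q2 : (s ⬝ᵥ s / n) * (1 + rho1 n (1 / θ) 1 g) = (1 + rho1 n (1 / θ) 1 g) / n * (s ⬝ᵥ s) := by field_simp
      rw [q1, q2]
      beta_reduce
      linarith
    rw [hB]
    linarith
  obtain ⟨i1, v1⟩ := ds_mean hn hτ hτ1 hb g
  obtain ⟨i2, v2⟩ := Xs_var hn hτ hτ1 hb g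
  have j1 : Integrable (fun s : Fin n → ℝ => (1 + dd1 n (1 / θ) 1 g + 2 * θ ^ 2 * dd1 n (1 / θ) 1 g) + 1 / (n:ℝ) ^ 2 * (s ⬝ᵥ s) ^ 2) (gaussPrior n 1) :=
    (integrable_const _).add ((sqsq_int n 1).const_mul _)
  have j2 := i2.const_mul (2 * θ ^ 2)
  have j3 := (sq_int n 1).const_mul ((1 + rho1 n (1 / θ) 1 g) / n)
  have hwi : Integrable w (gaussPrior n 1) := by rw [hw]; exact ((j1.add j2).add i1).add j3
  have hwm : ∫ s, w s ∂gaussPrior n 1 ≤ (5 + 4 * θ ^ 2) * (1 + rho1 n (1 / θ) 1 g + dd1 n (1 / θ) 1 g) := by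
    have k1 : Integrable (fun s : Fin n → ℝ => ((1 + dd1 n (1 / θ) 1 g + 2 * θ ^ 2 * dd1 n (1 / θ) 1 g) + 1 / (n:ℝ) ^ 2 * (s ⬝ᵥ s) ^ 2) + 2 * θ ^ 2 * (n * (Xs n (1 / θ) g s - ms n (1 / θ) g) ^ 2)) (gaussPrior n 1) := j1.add j2
    have k2 : Integrable (fun s : Fin n → ℝ => (((1 + dd1 n (1 / θ) 1 g + 2 * θ ^ 2 * dd1 n (1 / θ) 1 g) + 1 / (n:ℝ) ^ 2 * (s ⬝ᵥ s) ^ 2) + 2 * θ ^ 2 * (n * (Xs n (1 / θ) g s - ms n (1 / θ) g) ^ 2)) + ds n (1 / θ) g s) (gaussPrior n 1) := k1.add i1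
    rw [hw]
    rw [integral_add k2 j3, integral_add k1 i1, integral_add j1 j2, integral_add (integrable_const _) ((sqsq_int n 1).const_mul _),
      integral_const_mul (1 / (n:ℝ) ^ 2), integral_const_mul (2 * θ ^ 2), integral_const_mul ((1 + rho1 n (1 / θ) 1 g) / n), sq_mean n one_pos, sqsq_mean n one_pos]
    simp only [integral_const, probReal_univ, one_smul]
    have q1 : 1 / (n:ℝ) ^ 2 * (1 ^ 2 * (n ^ 2 + 2 * n)) ≤ 3 := by
      rw [one_div, ← div_eq_inv_mul, div_le_iff₀ (by positivity)]
      nlinarith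
    have q2 : (1 + rho1 n (1 / θ) 1 g) / n * (n * 1) = 1 + rho1 n (1 / θ) 1 g := by field_simp
    rw [q2]
    have q3 := mul_le_mul_of_nonneg_left v2 (by positivity : 0 ≤ 2 * θ ^ 2)
    have q4 : 0 ≤ θ ^ 2 * dd1 n (1 / θ) 1 g := by positivity
    have q5 : 0 ≤ θ ^ 2 := by positivity
    nlinarith
  have hm := integral_mono ((integrable_const (B - n * e * ((θ - c) * (1 + rho1 n (1 / θ) 1 g)))).sub (hwi.const_mul (n * e * K))) hinteg hpt
  rw [integral_sub' (integrable_const _) (hwi.const_mul _), integral_const_mul] at hm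
  simp only [integral_const, probReal_univ, one_smul] at hm
  refine le_trans ?_ hm
  have p1 := mul_le_mul_of_nonneg_left hwm (by positivity : 0 ≤ n * e * K)
  have p2 : 0 ≤ n * e * (θ - c) * dd1 n (1 / θ) 1 g := by positivity
  linarith

theorem lbB {c θ : ℝ} (hc : 0 < c) (hcθ : c < θ) (hθ : 1 < θ) {η : ℝ} (hη : 0 < η) :
    ∀ᶠ n : ℕ in atTop, Ph c (θ - c) - η ≤ 1 / (n:ℝ) * Fr n c θ := by
  have hθ0 : 0 < θ := by linarith
  have hτ : 0 < 1 / θ := by positivity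
  have hτ1 : 1 / θ < 1 := by rw [div_lt_one hθ0]; exact hθ
  obtain ⟨C, hC0, hC⟩ := lbB_slice hc hcθ hθ
  obtain ⟨K, hK⟩ := baseA hτ hτ1 (by linarith)
  have hPh : Ph c (θ - c) = 1 / 2 * Real.log (c / θ) + ((θ - c) * (θ + 1 / θ - c) / 2 - (θ - c) ^ 2 / 4) := by
    unfold Ph
    have e1 : 1 + (θ - c) / c = (c / θ)⁻¹ := by field_simp; ring
    have e2 : c + (θ - c) = θ := by ring
    rw [e1, e2, Real.log_inv]
    field_simp; ring
  have hlim : Tendsto (fun n : ℕ => K * (1 / (n:ℝ)) + (√(√(n:ℝ)))⁻¹ * (C * (1 + 2 * K))) atTop (nhds 0) := by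
    have t1 : Tendsto (fun n : ℕ => 1 / (n:ℝ)) atTop (nhds 0) := tendsto_one_div_atTop_nhds_zero_nat
    have t2 : Tendsto (fun n : ℕ => (√(√(n:ℝ)))⁻¹) atTop (nhds 0) :=
      tendsto_inv_atTop_zero.comp (Real.tendsto_sqrt_atTop.comp (Real.tendsto_sqrt_atTop.comp tendsto_natCast_atTop_atTop))
    simpa using (t1.const_mul K).add (t2.mul_const (C * (1 + 2 * K)))
  filter_upwards [big_ev hτ1, hlim.eventually (gt_mem_nhds hη)] with n ⟨hn, hb⟩ hsm
  have hn' : (0:ℝ) < n := by exact_mod_cast hn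
  have hn1 : (1:ℝ) ≤ n := by exact_mod_cast hn
  obtain ⟨e, hed⟩ : ∃ e, e = (√(√(n:ℝ)))⁻¹ := ⟨_, rfl⟩
  rw [← hed] at hsm
  have hq : 0 < √(n:ℝ) := Real.sqrt_pos.2 hn'
  have hqq : 0 < √(√(n:ℝ)) := Real.sqrt_pos.2 hq
  have he : 0 < e := by rw [hed]; positivity
  have he1 : e ≤ 1 := by
    rw [hed]; refine inv_le_one_of_one_le₀ ?_
    rw [Real.one_le_sqrt, Real.one_le_sqrt]; exact hn1
  have hen : e ^ 2 * √n = 1 := by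
    rw [hed, inv_pow, Real.sq_sqrt hq.le]; field_simp
  obtain ⟨k1, k2, k3⟩ := hK n hn hb
  have iZ := logZ1_int hn hτ hτ1 hb
  have iρ := rho1_int hn hτ hτ1 hb
  have id := dd1_int hn hτ hτ1 hb
  obtain ⟨D, hD⟩ : ∃ D, D = (n / 2 * Real.log (c / θ) + n * ((θ - c) * (θ + 1 / θ - c) / 2 - (θ - c) ^ 2 / 4)) := ⟨_, rfl⟩
  have jA : Integrable (fun g => D + Real.log (Z1 n (1 / θ) 1 g)) (gpi (vk n)) := (integrable_const _).add iZ
  have jB0 : Integrable (fun g => 1 + rho1 n (1 / θ) 1 g) (gpi (vk n)) := (integrable_const _).add iρ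
  have jB : Integrable (fun g => 1 + rho1 n (1 / θ) 1 g + dd1 n (1 / θ) 1 g) (gpi (vk n)) := jB0.add id
  have hFr := Fr_lower hn hc hθ0.le (fun g => D + Real.log (Z1 n (1 / θ) 1 g) - n * (e * C) * (1 + rho1 n (1 / θ) 1 g + dd1 n (1 / θ) 1 g))
    (jA.sub (jB.const_mul _)) (fun g hg => by rw [hD]; exact hC n e hn he he1 hen hb g hg)
  rw [integral_sub jA (jB.const_mul _), integral_add (integrable_const _) iZ, integral_const_mul, integral_add jB0 id, integral_add (integrable_const _) iρ] at hFr
  simp only [integral_const, probReal_univ, one_smul, smul_eq_mul, mul_one] at hFr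
  have f1 : D - K - n * (e * C) * (1 + K + K) ≤ Fr n c θ := by
    refine le_trans ?_ hFr
    have : n * (e * C) * (1 + ∫ g, rho1 n (1 / θ) 1 g ∂gpi (vk n) + ∫ g, dd1 n (1 / θ) 1 g ∂gpi (vk n)) ≤ n * (e * C) * (1 + K + K) := by gcongr
    linarith
  have f2 := mul_le_mul_of_nonneg_left f1 (by positivity : 0 ≤ 1 / (n:ℝ))
  refine le_trans ?_ f2
  have f3 : 1 / (n:ℝ) * (D - K - n * (e * C) * (1 + K + K)) = Ph c (θ - c) - (K * (1 / (n:ℝ)) + e * (C * (1 + 2 * K))) := by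
    rw [hPh, hD]; field_simp; ring
  rw [f3]
  linarith
end

end

section

open MeasureTheory ProbabilityTheory Filter Matrix
open scoped NNReal ENNReal

noncomputable section
set_option linter.unusedSectionVars false

theorem Zr_conv {n : ℕ} (hn : 0 < n) {c θ θ0 θ1 : ℝ} (hθ : 0 ≤ θ) (h0 : θ < θ0) (h1 : θ0 < θ1) (s g) :
    (θ1 - θ) * Real.log (Zr n c θ0 s g) ≤ (θ1 - θ0) * Real.log (Zr n c θ s g) + (θ0 - θ) * Real.log (Zr n c θ1 s g) := by
  have hn' : (0:ℝ) < n := by exact_mod_cast hn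
  obtain ⟨A, hA⟩ : ∃ A : (Fin n → ℝ) → ℝ, A = fun x => 1 / (2 * n) * (s ⬝ᵥ x) ^ 2 := ⟨_, rfl⟩
  obtain ⟨ν, hν⟩ : ∃ ν, ν = gaussPrior n (1 / c) := ⟨_, rfl⟩
  have hA0 : ∀ x, 0 ≤ A x := fun x => by rw [hA]; positivity
  have hAm : Measurable A := by
    rw [hA]
    have : Continuous fun x : Fin n → ℝ => s ⬝ᵥ x := by unfold dotProduct; fun_prop
    have h2 := this.measurable
    fun_prop
  have hadd : ∀ t x, Hr n t s g x = (t - θ0) * A x + Hr n θ0 s g x := by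
    intro t x
    rw [hA]; unfold Hr
    field_simp; ring
  haveI : IsFiniteMeasure ν := by rw [hν]; unfold gaussPrior; infer_instance
  have I0 := Hr_exp_int hn (by linarith : 0 ≤ θ0) s g ν
  have I1 := Hr_exp_int hn (by linarith : 0 ≤ θ1) s g ν
  have I2 := Hr_exp_int hn hθ s g ν
  have IA : Integrable (fun x => A x * Real.exp (Hr n θ0 s g x)) ν := by
    refine Integrable.mono' (I1.const_mul (1 / (θ1 - θ0))) (hAm.mul (Hr_meas1 n θ0 s g).exp).aestronglyMeasurable (ae_of_all _ fun x => ?_)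
    rw [Real.norm_eq_abs, abs_of_nonneg (mul_nonneg (hA0 x) (Real.exp_pos _).le), hadd θ1 x, Real.exp_add, ← mul_assoc]
    refine mul_le_mul_of_nonneg_right ?_ (Real.exp_pos _).le
    have hd : 0 < θ1 - θ0 := by linarith
    rw [one_div, ← div_eq_inv_mul, le_div_iff₀ hd]
    have := Real.add_one_le_exp ((θ1 - θ0) * A x)
    linarith
  have hp : 0 < ∫ x, Real.exp (Hr n θ0 s g x) ∂ν := by rw [hν]; exact Zr_pos hn (by linarith) s g
  have key : ∀ t, Integrable (fun x => Real.exp (Hr n t s g x)) ν →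
      Real.log (Zr n c θ0 s g) + (t - θ0) * Gav ν (Hr n θ0 s g) A ≤ Real.log (Zr n c t s g) := by
    intro t It
    have e1 : (fun x => Real.exp (Hr n t s g x)) = fun x => Real.exp ((t - θ0) * A x + Hr n θ0 s g x) := by
      funext x; rw [hadd t x]
    have hI2 : Integrable (fun x => ((t - θ0) * A x) * Real.exp (Hr n θ0 s g x)) ν := by
      have := IA.const_mul (t - θ0)
      refine this.congr (ae_of_all _ fun x => ?_)
      simp only [mul_assoc]
    have hh := gibbs' ν (L := Hr n θ0 s g) (f := fun x => (t - θ0) * A x) hp I0 hI2 (by rw [← e1]; exact It)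
    have e2 : Gav ν (Hr n θ0 s g) (fun x => (t - θ0) * A x) = (t - θ0) * Gav ν (Hr n θ0 s g) A := by
      unfold Gav
      simp only [mul_assoc, integral_const_mul]
      ring
    rw [e2, ← e1] at hh
    unfold Zr
    rw [← hν]
    exact hh
  have k1 := mul_le_mul_of_nonneg_left (key θ I2) (by linarith : 0 ≤ θ1 - θ0)
  have k2 := mul_le_mul_of_nonneg_left (key θ1 I1) (by linarith : 0 ≤ θ0 - θ)
  linarith

theorem Fr_conv {n : ℕ} (hn : 0 < n) {c θ θ0 θ1 : ℝ} (hc : 0 < c) (hθ : 0 ≤ θ) (h0 : θ < θ0) (h1 : θ0 < θ1) :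
    (θ1 - θ) * Fr n c θ0 ≤ (θ1 - θ0) * Fr n c θ + (θ0 - θ) * Fr n c θ1 := by
  have i0 := logZr_int hn hc (by linarith : 0 ≤ θ0)
  have i1 := logZr_int hn hc (by linarith : 0 ≤ θ1)
  have i2 := logZr_int hn hc hθ
  unfold Fr
  rw [← integral_const_mul, ← integral_const_mul, ← integral_const_mul, ← integral_add (i2.const_mul _) (i1.const_mul _)]
  exact integral_mono (i0.const_mul _) ((i2.const_mul _).add (i1.const_mul _)) fun p => Zr_conv hn hθ h0 h1 p.1 p.2

theorem Ph_near {c x : ℝ} (hc : 0 < c) (hc1 : c ≤ 1) (hx : 0 ≤ x) : |Ph c (1 - c + x) - Ph c (1 - c)| ≤ x ^ 2 := by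
  have hx1 : 0 < 1 + x := by linarith
  have e : Ph c (1 - c + x) - Ph c (1 - c) = (1 - c) * (x ^ 2 / (1 + x)) / 2 + x ^ 2 / 4 - (Real.log (1 + x) - x / (1 + x)) / 2 := by
    unfold Ph
    have e1 : 1 + (1 - c + x) / c = (1 + x) / c := by field_simp; ring
    have e2 : 1 + (1 - c) / c = 1 / c := by field_simp; ring
    have e3 : c + (1 - c + x) = 1 + x := by ring
    have e4 : c + (1 - c) = 1 := by ring
    rw [e1, e2, e3, e4, Real.log_div hx1.ne' hc.ne', Real.log_div one_ne_zero hc.ne', Real.log_one]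
    field_simp; ring
  have l1 : Real.log (1 + x) ≤ x := by have := Real.log_le_sub_one_of_pos hx1; linarith
  have l2 : x / (1 + x) ≤ Real.log (1 + x) := by
    have := Real.one_sub_inv_le_log_of_pos hx1
    have e5 : 1 - (1 + x)⁻¹ = x / (1 + x) := by field_simp; ring
    linarith
  have l3 : x - x / (1 + x) = x ^ 2 / (1 + x) := by field_simp; ring
  have l4 : x ^ 2 / (1 + x) ≤ x ^ 2 := div_le_self (by positivity) (by linarith)
  have l5 : 0 ≤ x ^ 2 / (1 + x) := by positivity
  have l6 : (1 - c) * (x ^ 2 / (1 + x)) ≤ 1 * x ^ 2 := mul_le_mul (by linarith) l4 l5 zero_le_one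
  have l7 : 0 ≤ (1 - c) * (x ^ 2 / (1 + x)) := mul_nonneg (by linarith) l5
  rw [e, abs_le]
  constructor <;> linarith

theorem lbC {c θ : ℝ} (hc : 0 < c) (hc1 : c ≤ 1) (hθ : 0 ≤ θ) (hθ1 : θ ≤ 1) {η : ℝ} (hη : 0 < η) :
    ∀ᶠ n : ℕ in atTop, Ph c (1 - c) - η ≤ 1 / (n:ℝ) * Fr n c θ := by
  obtain ⟨h, hh0, hh1, hhη⟩ : ∃ h : ℝ, 0 < h ∧ h ≤ 1 ∧ 40 * h ≤ η :=
    ⟨min 1 (η / 40), by positivity, min_le_left _ _, by have := min_le_right 1 (η / 40); linarith⟩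
  have q2 : 0 < h ^ 2 := by positivity
  filter_upwards [eventually_gt_atTop 0, lbB hc (by linarith : c < 1 + h) (by linarith) q2,
    ub_eps hc (by linarith : 0 ≤ 1 + 2 * h) (by linarith : 0 ≤ 1 - c + 3 * h) (by linarith) q2] with n hn h1 h2
  have hn' : (0:ℝ) < n := by exact_mod_cast hn
  have h3 := mul_le_mul_of_nonneg_left (Fr_conv hn hc hθ (by linarith : θ < 1 + h) (by linarith : 1 + h < 1 + 2 * h)) (by positivity : 0 ≤ 1 / (n:ℝ))
  have n1 := (abs_le.1 (Ph_near hc hc1 hh0.le)).1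
  have n2 := (abs_le.1 (Ph_near hc hc1 (by positivity : 0 ≤ 3 * h))).2
  have e0 : 1 + h - c = 1 - c + h := by ring
  rw [e0] at h1
  obtain ⟨F, hF⟩ : ∃ F, F = 1 / (n:ℝ) * Fr n c θ := ⟨_, rfl⟩
  obtain ⟨F0, hF0⟩ : ∃ F, F = 1 / (n:ℝ) * Fr n c (1 + h) := ⟨_, rfl⟩
  obtain ⟨F1, hF1⟩ : ∃ F, F = 1 / (n:ℝ) * Fr n c (1 + 2 * h) := ⟨_, rfl⟩
  obtain ⟨P, hP⟩ : ∃ F, F = Ph c (1 - c) := ⟨_, rfl⟩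
  have h4 : (1 + 2 * h - θ) * F0 ≤ h * F + (1 + h - θ) * F1 := by
    rw [hF, hF0, hF1]; linarith
  rw [← hF0] at h1
  rw [← hF1] at h2
  rw [← hP] at n1 n2
  rw [← hF, ← hP]
  have a0 : P - 2 * h ^ 2 ≤ F0 := by linarith
  have a1 : F1 ≤ P + 10 * h ^ 2 := by linarith
  have b0 := mul_le_mul_of_nonneg_left a0 (by linarith : 0 ≤ 1 + 2 * h - θ)
  have b1 := mul_le_mul_of_nonneg_left a1 (by linarith : 0 ≤ 1 + h - θ)
  have b2 : (1 + 2 * h - θ) * (2 * h ^ 2) ≤ 3 * (2 * h ^ 2) := mul_le_mul_of_nonneg_right (by linarith) (by positivity)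
  have b3 : (1 + h - θ) * (10 * h ^ 2) ≤ 2 * (10 * h ^ 2) := mul_le_mul_of_nonneg_right (by linarith) (by positivity)
  have b4 : h * (P - 26 * h) ≤ h * F := by linarith
  have b5 := le_of_mul_le_mul_left b4 hh0
  linarith

theorem Ph_cont {c w : ℝ} (hc : 0 < c) (hw : 0 ≤ w) : ContinuousAt (Ph c) w := by
  unfold Ph
  have h1 : 1 + w / c ≠ 0 := by positivity
  have h2 : 2 * (c + w) ≠ 0 := by positivity
  fun_prop (disch := assumption)

theorem Fr_lim {c θ w : ℝ} (hc : 0 < c) (hθ : 0 ≤ θ) (hw : 0 ≤ w) (hcw : θ ≤ c + w)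
    (hl : ∀ η : ℝ, 0 < η → ∀ᶠ n : ℕ in atTop, Ph c w - η ≤ 1 / (n:ℝ) * Fr n c θ) :
    Tendsto (fun n : ℕ => 1 / (n:ℝ) * Fr n c θ) atTop (nhds (Ph c w)) := by
  rw [Metric.tendsto_nhds]
  intro ε hε
  obtain ⟨δ, hδ, hδ2⟩ := Metric.continuousAt_iff.1 (Ph_cont hc hw) (ε / 3) (by positivity)
  have hq := hδ2 (x := w + δ / 2) (by rw [Real.dist_eq]; rw [abs_of_nonneg] <;> linarith)
  rw [Real.dist_eq, abs_lt] at hq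
  filter_upwards [hl (ε / 2) (by positivity), ub_eps hc hθ (by linarith : 0 ≤ w + δ / 2) (by linarith) (by positivity : 0 < ε / 3)] with n h1 h2
  rw [Real.dist_eq, abs_lt]
  constructor <;> linarith [hq.1, hq.2]

theorem Fr_lim_all {c θ : ℝ} (hc : 0 < c) (hθ : 0 ≤ θ) :
    Tendsto (fun n : ℕ => 1 / (n:ℝ) * Fr n c θ) atTop
      (nhds (if θ ≤ 1 ∧ c ≤ 1 then Ph c (1 - c) else if 1 ≤ θ ∧ c ≤ θ then Ph c (θ - c) else 0)) := by
  have hP0 : Ph c 0 = 0 := by unfold Ph; simp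
  split_ifs with h1 h2
  · exact Fr_lim hc hθ (by linarith [h1.2]) (by linarith [h1.1]) fun η hη => lbC hc h1.2 hθ h1.1 hη
  · have h3 : 1 < θ := by
      by_contra h
      exact h1 ⟨by linarith, by linarith [h2.2]⟩
    refine Fr_lim hc hθ (by linarith [h2.2]) (by linarith) fun η hη => ?_
    rcases h2.2.lt_or_eq with h4 | h4
    · exact lbB hc h4 h3 hη
    · rw [h4] at hP0
      rw [h4, sub_self, hP0, zero_sub]
      exact lbA h3 hθ hη
  · have h3 : 1 < c := by
      by_contra h
      push Not at h
      by_cases h4 : θ ≤ 1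
      · exact h1 ⟨h4, h⟩
      · exact h2 ⟨by linarith, by linarith⟩
    have h4 : θ ≤ c := by
      by_contra h
      push Not at h
      exact h2 ⟨by linarith, h.le⟩
    rw [← hP0]
    refine Fr_lim hc hθ le_rfl (by linarith) fun η hη => ?_
    rw [hP0, zero_sub]
    exact lbA h3 hθ hη

theorem fLim_eq (sig sig' lam lam' : ℝ)
    (hsig : 0 < sig) (hsig' : 0 < sig') (hlam : 0 < lam) (hlam' : 0 < lam') {c θ : ℝ}
    (hc : c = 1 / (√lam' * sig' ^ 2)) (hθ : θ = √lam * sig ^ 2) :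
    fLim sig sig' lam lam' =
      -(if θ ≤ 1 ∧ c ≤ 1 then Ph c (1 - c) else if 1 ≤ θ ∧ c ≤ θ then Ph c (θ - c) else 0) := by
  obtain ⟨a, ha, rfl⟩ : ∃ a : ℝ, 0 < a ∧ lam = a ^ 2 := ⟨√lam, Real.sqrt_pos.2 hlam, (Real.sq_sqrt hlam.le).symm⟩
  obtain ⟨b, hb, rfl⟩ : ∃ a : ℝ, 0 < a ∧ lam' = a ^ 2 := ⟨√lam', Real.sqrt_pos.2 hlam', (Real.sq_sqrt hlam'.le).symm⟩
  have s1 : √(a ^ 2) = a := Real.sqrt_sq ha.le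
  have s2 : √(b ^ 2) = b := Real.sqrt_sq hb.le
  have s3 : √(a ^ 2 * b ^ 2) = a * b := by rw [← mul_pow, Real.sqrt_sq (by positivity)]
  have s4 : √(a ^ 2 / b ^ 2) = a / b := by rw [← div_pow, Real.sqrt_sq (by positivity)]
  have c1 : a ^ 2 ≤ 1 / sig ^ 4 ↔ θ ≤ 1 := by
    rw [hθ, s1, le_div_iff₀ (by positivity), ← sq_le_one_iff₀ (by positivity : 0 ≤ a * sig ^ 2)]
    ring_nf
  have c2 : 1 / sig' ^ 4 ≤ b ^ 2 ↔ c ≤ 1 := by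
    rw [hc, s2, div_le_iff₀ (by positivity), div_le_one (by positivity), ← one_le_sq_iff₀ (by positivity : 0 ≤ b * sig' ^ 2)]
    ring_nf
  have c3 : 1 / sig ^ 4 ≤ a ^ 2 ↔ 1 ≤ θ := by
    rw [hθ, s1, div_le_iff₀ (by positivity), ← one_le_sq_iff₀ (by positivity : 0 ≤ a * sig ^ 2)]
    ring_nf
  have c4 : 1 / (sig ^ 2 * sig' ^ 2) ≤ √(a ^ 2 * b ^ 2) ↔ c ≤ θ := by
    rw [hθ, hc, s1, s2, s3, div_le_iff₀ (by positivity), div_le_iff₀ (by positivity)]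
    ring_nf
  have hc0 : 0 < c := by rw [hc, s2]; positivity
  have hθ0 : 0 < θ := by rw [hθ, s1]; positivity
  unfold fLim
  simp only [c1, c2, c3, c4]
  rw [s2, s3, s4]
  rw [s2] at hc
  rw [s1] at hθ
  have hb2 : b * sig' ^ 2 = 1 / c := by rw [hc]; field_simp
  split_ifs with h1 h2
  · have e1 : (b ^ 2) ^ ((1:ℝ) / 4) * sig' = √(1 / c) := by
      rw [← hb2, Real.sqrt_mul hb.le, Real.sqrt_sq hsig'.le, Real.sqrt_eq_rpow, ← Real.rpow_natCast, ← Real.rpow_mul hb.le]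
      norm_num
    rw [e1, Real.log_sqrt (by positivity)]
    unfold Ph
    have e2 : 1 + (1 - c) / c = 1 / c := by field_simp; ring
    have e3 : c + (1 - c) = 1 := by ring
    rw [e2, e3]
    have e4 : -1 / (4 * b ^ 2 * sig' ^ 4) = - c ^ 2 / 4 := by rw [hc]; field_simp
    rw [e4, ← hc]
    ring
  · unfold Ph
    have e2 : 1 + (θ - c) / c = a * b * sig ^ 2 * sig' ^ 2 := by rw [hc, hθ]; field_simp; ring
    have e3 : c + (θ - c) = θ := by ring
    rw [e2, e3]
    generalize Real.log (a * b * sig ^ 2 * sig' ^ 2) = l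
    rw [hc, hθ]
    field_simp
    ring
  · simp

theorem freeEnergy_limit' (sig sig' lam lam' : ℝ)
    (hsig : 0 < sig) (hsig' : 0 < sig') (hlam : 0 < lam) (hlam' : 0 < lam') :
    Tendsto (fun n => freeEnergy n sig sig' lam lam') atTop
      (nhds (fLim sig sig' lam lam')) := by
  have h := (Fr_lim_all (c := 1 / (√lam' * sig' ^ 2)) (θ := √lam * sig ^ 2) (by positivity) (by positivity)).neg
  rw [fLim_eq sig sig' lam lam' hsig hsig' hlam hlam' rfl rfl]
  refine h.congr' ?_
  filter_upwards [eventually_gt_atTop 0] with n hn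
  rw [reduction n hn sig sig' lam lam' hsig hsig' hlam hlam', neg_mul]

end

end

/-- The mismatched free energy converges as `n → ∞` and its limit
is given by the explicit formula `fLim`. -/
theorem freeEnergy_limit (sig sig' lam lam' : ℝ)
    (hsig : 0 < sig) (hsig' : 0 < sig') (hlam : 0 < lam) (hlam' : 0 < lam') :
    Tendsto (fun n => freeEnergy n sig sig' lam lam') atTop
      (nhds (fLim sig sig' lam lam')) := by
  exact freeEnergy_limit' sig sig' lam lam' hsig hsig' hlam hlam'

end
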